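/- For every α > 0 and every (x,y) ∈ D₊, one has inf_{z∈ℝ²} θ_{x,y}(z;α) ≤ inf_{z∈ℝ²} θ_{1/2,√3/2}(z;α), with equality if and only if (x,y) = (1/2, √3/2). Equivalently: among all lattices in ℝ² of covolume 1, the minimal value min_{z∈ℝ²} ∑_{λ∈Λ} exp(−πα|λ+z|²) is maximized exactly by the hexagonal lattice, for every α > 0. -/

import Mathlib

/-- The shifted lattice theta function `θ_{x,y}(z;α)` for lattice parameters `(x,y)`,
shift `z = (z₁,z₂)` and Gaussian parameter `α`. -/
noncomputable def latticeTheta (x y : ℝ) (z : ℝ × ℝ) (α : ℝ) : ℝ :=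
  ∑' p : ℤ × ℤ,
    Real.exp (-(Real.pi * α / y) *
      (((p.1 : ℝ) + z.1) ^ 2 + 2 * x * ((p.1 : ℝ) + z.1) * ((p.2 : ℝ) + z.2) +
        (x ^ 2 + y ^ 2) * ((p.2 : ℝ) + z.2) ^ 2))

/-- The right half of the fundamental domain of the modular group. -/
def Dplus : Set (ℝ × ℝ) :=
  {p | 0 ≤ p.1 ∧ p.1 ≤ 1 / 2 ∧ 0 < p.2 ∧ 1 ≤ p.1 ^ 2 + p.2 ^ 2}

open Real

section Summability

theorem summable_exp_neg_mul_int_sq {c : ℝ} (hc : 0 < c) :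
    Summable fun n : ℤ => exp (-c * (n : ℝ) ^ 2) := by
  have h := summable_pow_mul_jacobiTheta₂_term_bound 0 (T := c / π) (by positivity) 0
  refine h.congr fun n => ?_
  have := pi_ne_zero
  rw [pow_zero, one_mul]
  congr 1
  field_simp
  ring

theorem summable_exp_neg_mul_sq_add_sq {c : ℝ} (hc : 0 < c) :
    Summable fun p : ℤ × ℤ => exp (-c * ((p.1 : ℝ) ^ 2 + (p.2 : ℝ) ^ 2)) := by
  have h := (summable_exp_neg_mul_int_sq hc).mul_of_nonneg (summable_exp_neg_mul_int_sq hc)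
    (fun _ => (exp_pos _).le) (fun _ => (exp_pos _).le)
  refine h.congr fun p => ?_
  rw [← exp_add, mul_add]

theorem summable_of_abs_le_gauss {f : ℤ × ℤ → ℝ} {c C : ℝ} (hc : 0 < c)
    (h : ∀ p : ℤ × ℤ, |f p| ≤ C * exp (-c * ((p.1 : ℝ) ^ 2 + (p.2 : ℝ) ^ 2))) : Summable f :=
  Summable.of_norm_bounded ((summable_exp_neg_mul_sq_add_sq hc).mul_left C) h

theorem summable_exp_neg_of_le {Q : ℤ × ℤ → ℝ} {c C : ℝ} (hc : 0 < c)
    (h : ∀ p : ℤ × ℤ, c * ((p.1 : ℝ) ^ 2 + (p.2 : ℝ) ^ 2) - C ≤ Q p) :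
    Summable fun p => exp (-Q p) := by
  refine summable_of_abs_le_gauss (C := exp C) hc fun p => ?_
  rw [abs_of_pos (exp_pos _), ← exp_add]
  exact exp_le_exp.2 (by linarith [h p])

/-- A quadratic weight does not destroy summability against a Gaussian. -/
theorem summable_sq_mul_exp_neg {f Q : ℤ × ℤ → ℝ} {c C K : ℝ} (hc : 0 < c)
    (h : ∀ p : ℤ × ℤ, c * ((p.1 : ℝ) ^ 2 + (p.2 : ℝ) ^ 2) - C ≤ Q p)
    (hf : ∀ p : ℤ × ℤ, |f p| ≤ K * ((p.1 : ℝ) ^ 2 + (p.2 : ℝ) ^ 2 + 1) ^ 2) :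
    Summable fun p => f p * exp (-Q p) := by
  have hK : 0 ≤ K := by
    have := (abs_nonneg _).trans (hf (0, 0))
    simpa using this
  refine summable_of_abs_le_gauss (c := c / 2) (C := K * ((4 / c) ^ 2 * exp (c / 2) * exp C))
    (by positivity) fun p => ?_
  set t : ℝ := (p.1 : ℝ) ^ 2 + (p.2 : ℝ) ^ 2 with ht
  have ht0 : 0 ≤ t := by positivity
  rw [abs_mul, abs_of_pos (exp_pos (-Q p))]
  have h1 : t + 1 ≤ 4 / c * exp (c / 4 * (t + 1)) := by
    have := add_one_le_exp (c / 4 * (t + 1))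
    rw [div_mul_eq_mul_div, le_div_iff₀ hc]
    nlinarith
  have h2 : (t + 1) ^ 2 ≤ (4 / c) ^ 2 * exp (c / 2 * (t + 1)) := by
    have h3 : exp (c / 2 * (t + 1)) = exp (c / 4 * (t + 1)) ^ 2 := by
      rw [← exp_nat_mul]; congr 1; push_cast; ring
    rw [h3, ← mul_pow]
    gcongr
  calc |f p| * exp (-Q p) ≤ (K * (t + 1) ^ 2) * exp (C - c * t) := by
        gcongr
        · exact hf p
        · linarith [h p]
    _ ≤ (K * ((4 / c) ^ 2 * exp (c / 2 * (t + 1)))) * exp (C - c * t) := by gcongr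
    _ = K * ((4 / c) ^ 2 * exp (c / 2) * exp C) * exp (-(c / 2) * t) := by
        have : exp (c / 2 * (t + 1)) * exp (C - c * t)
            = exp (c / 2) * exp C * exp (-(c / 2) * t) := by
          simp only [← exp_add]; congr 1; ring
        linear_combination (K * (4 / c) ^ 2) * this

theorem sq_add_sq_le_form {x y : ℝ} (hy : 0 < y) (a b : ℝ) :
    a ^ 2 + b ^ 2 ≤ (2 + (2 * x ^ 2 + 1) / y ^ 2) * (a ^ 2 + 2 * x * a * b + (x ^ 2 + y ^ 2) * b ^ 2) := by
  have h1 : (2 + (2 * x ^ 2 + 1) / y ^ 2) * (a ^ 2 + 2 * x * a * b + (x ^ 2 + y ^ 2) * b ^ 2)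
      = 2 * (a + x * b) ^ 2 + 2 * y ^ 2 * b ^ 2 + (2 * x ^ 2 + 1) / y ^ 2 * (a + x * b) ^ 2
        + (2 * x ^ 2 + 1) * b ^ 2 := by
    field_simp
    ring
  rw [h1]
  have : 0 ≤ (2 * x ^ 2 + 1) / y ^ 2 * (a + x * b) ^ 2 := by positivity
  nlinarith [sq_nonneg (a + 2 * x * b), sq_nonneg (y * b)]

theorem exists_form_ge (x : ℝ) {y : ℝ} (hy : 0 < y) (z : ℝ × ℝ) {κ : ℝ} (hκ : 0 < κ) :
    ∃ c C : ℝ, 0 < c ∧ ∀ p : ℤ × ℤ, c * ((p.1 : ℝ) ^ 2 + (p.2 : ℝ) ^ 2) - C ≤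
      κ * (((p.1 : ℝ) + z.1) ^ 2 + 2 * x * ((p.1 : ℝ) + z.1) * ((p.2 : ℝ) + z.2) +
        (x ^ 2 + y ^ 2) * ((p.2 : ℝ) + z.2) ^ 2) := by
  set K : ℝ := 2 + (2 * x ^ 2 + 1) / y ^ 2 with hK
  have hK0 : 0 < K := by positivity
  refine ⟨κ / (2 * K), κ / K * (z.1 ^ 2 + z.2 ^ 2), by positivity, fun p => ?_⟩
  have h := sq_add_sq_le_form (x := x) hy ((p.1 : ℝ) + z.1) ((p.2 : ℝ) + z.2)
  rw [← hK] at h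
  set F := ((p.1 : ℝ) + z.1) ^ 2 + 2 * x * ((p.1 : ℝ) + z.1) * ((p.2 : ℝ) + z.2) +
        (x ^ 2 + y ^ 2) * ((p.2 : ℝ) + z.2) ^ 2
  have h2 : ((p.1 : ℝ) ^ 2 + (p.2 : ℝ) ^ 2) / 2 - (z.1 ^ 2 + z.2 ^ 2) ≤ K * F := by
    nlinarith [sq_nonneg ((p.1 : ℝ) + 2 * z.1), sq_nonneg ((p.2 : ℝ) + 2 * z.2)]
  have h3 := mul_le_mul_of_nonneg_left h2 (show 0 ≤ κ / K by positivity)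
  have h4 : κ / K * (K * F) = κ * F := by field_simp
  have h5 : κ / (2 * K) * ((p.1 : ℝ) ^ 2 + (p.2 : ℝ) ^ 2)
      = κ / K * (((p.1 : ℝ) ^ 2 + (p.2 : ℝ) ^ 2) / 2) := by field_simp
  linarith

theorem summable_latticeTheta (x : ℝ) {y : ℝ} (hy : 0 < y) (z : ℝ × ℝ) {α : ℝ} (hα : 0 < α) :
    Summable fun p : ℤ × ℤ =>
    Real.exp (-(Real.pi * α / y) *
      (((p.1 : ℝ) + z.1) ^ 2 + 2 * x * ((p.1 : ℝ) + z.1) * ((p.2 : ℝ) + z.2) +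
        (x ^ 2 + y ^ 2) * ((p.2 : ℝ) + z.2) ^ 2)) := by
  obtain ⟨c, C, hc, h⟩ := exists_form_ge x hy z (κ := π * α / y) (by positivity)
  refine (summable_exp_neg_of_le hc h).congr fun p => ?_
  rw [neg_mul]

theorem latticeTheta_nonneg (x y : ℝ) (z : ℝ × ℝ) (α : ℝ) : 0 ≤ latticeTheta x y z α :=
  tsum_nonneg fun _ => (exp_pos _).le

theorem bddBelow_range_latticeTheta (x y α : ℝ) :
    BddBelow (Set.range fun z : ℝ × ℝ => latticeTheta x y z α) :=
  ⟨0, by rintro _ ⟨z, rfl⟩; exact latticeTheta_nonneg x y z α⟩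

theorem summable_exp_neg_mul_int_add_sq {c : ℝ} (hc : 0 < c) (u : ℝ) :
    Summable fun n : ℤ => exp (-c * ((n : ℝ) + u) ^ 2) := by
  refine Summable.of_nonneg_of_le (fun _ => (exp_pos _).le) (fun n => ?_)
    ((summable_exp_neg_mul_int_sq (c := c / 2) (by positivity)).mul_left (exp (c * u ^ 2)))
  rw [← exp_add]
  refine exp_le_exp.2 ?_
  nlinarith [mul_nonneg hc.le (sq_nonneg ((n : ℝ) + 2 * u))]

end Summability

section Poisson

theorem tsum_int_prod_swap {f : ℤ × ℤ → ℝ} (hf : Summable f) :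
    ∑' p, f p = ∑' l : ℤ, ∑' k : ℤ, f (k, l) := by
  rw [← (Equiv.prodComm ℤ ℤ).tsum_eq f]
  exact Summable.tsum_prod ((Equiv.prodComm ℤ ℤ).summable_iff.2 hf)

theorem tsum_gauss_mul_cos {g : ℝ} (hg : 0 < g) (z ξ φ : ℝ) :
    ∑' l : ℤ, exp (-π * g * ((l : ℝ) + z) ^ 2) * cos (2 * π * (φ + ξ * ((l : ℝ) + z))) =
      1 / √g * ∑' m : ℤ, exp (-π / g * ((m : ℝ) - ξ) ^ 2) * cos (2 * π * (φ + m * z)) := by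
  have hg' : (g : ℂ) ≠ 0 := by exact_mod_cast hg.ne'
  set w : ℂ := z - Complex.I * ξ / g with hw
  have h := Complex.tsum_exp_neg_quadratic (a := ((1 / g : ℝ) : ℂ))
    (by rw [Complex.ofReal_re]; positivity) (-Complex.I * w)
  set e : ℂ := Complex.exp (2 * π * Complex.I * φ - π * ξ ^ 2 / g) with he
  have hL : ∀ n : ℤ, Complex.exp (-π / ((1 / g : ℝ) : ℂ) * ((n : ℂ) + Complex.I * (-Complex.I * w)) ^ 2) * e
      = ((exp (-π * g * ((n : ℝ) + z) ^ 2) : ℝ) : ℂ) *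
        Complex.exp (((2 * π * (φ + ξ * ((n : ℝ) + z)) : ℝ) : ℂ) * Complex.I) := by
    intro n
    rw [he, Complex.ofReal_exp, ← Complex.exp_add, ← Complex.exp_add]
    congr 1
    have hI : Complex.I * (-Complex.I * w) = w := by
      rw [← mul_assoc, mul_neg, Complex.I_mul_I]; ring
    rw [hI, hw]
    push_cast
    field_simp
    ring_nf
    simp only [Complex.I_sq]
    ring
  have hR : ∀ n : ℤ, Complex.exp (-π * ((1 / g : ℝ) : ℂ) * (n : ℂ) ^ 2 + 2 * π * (-Complex.I * w) * n) * e
      = ((exp (-π / g * (((-n : ℤ) : ℝ) - ξ) ^ 2) : ℝ) : ℂ) *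
        Complex.exp (((2 * π * (φ + ((-n : ℤ) : ℝ) * z) : ℝ) : ℂ) * Complex.I) := by
    intro n
    rw [he, Complex.ofReal_exp, ← Complex.exp_add, ← Complex.exp_add]
    congr 1
    rw [hw]
    push_cast
    field_simp
    ring_nf
    simp only [Complex.I_sq]
    ring
  have hsq : ((1 : ℂ) / ((1 / g : ℝ) : ℂ) ^ (1 / 2 : ℂ)) = ((√g : ℝ) : ℂ) := by
    have : (1 / 2 : ℂ) = ((1 / 2 : ℝ) : ℂ) := by push_cast; rfl
    rw [this, ← Complex.ofReal_cpow (by positivity), ← Real.sqrt_eq_rpow,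
      Real.sqrt_div zero_le_one, Real.sqrt_one, ← Complex.ofReal_one, ← Complex.ofReal_div,
      one_div_one_div]
  rw [hsq] at h
  have h2 := congrArg (fun t : ℂ => t * e) h
  beta_reduce at h2
  rw [mul_assoc (((√g : ℝ) : ℂ)), ← tsum_mul_right, ← tsum_mul_right] at h2
  simp only [hL, hR] at h2
  have hre : ∀ r t : ℝ, (((r : ℝ) : ℂ) * Complex.exp ((t : ℂ) * Complex.I)).re = r * cos t := by
    intro r t
    rw [Complex.re_ofReal_mul, Complex.exp_ofReal_mul_I_re]
  have hnorm : ∀ r t : ℝ, 0 ≤ r → ‖(((r : ℝ) : ℂ) * Complex.exp ((t : ℂ) * Complex.I))‖ = r := by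
    intro r t hr
    rw [norm_mul, Complex.norm_exp_ofReal_mul_I, mul_one, Complex.norm_real, norm_of_nonneg hr]
  have s1 : Summable fun n : ℤ => ((exp (-π * g * ((n : ℝ) + z) ^ 2) : ℝ) : ℂ) *
        Complex.exp (((2 * π * (φ + ξ * ((n : ℝ) + z)) : ℝ) : ℂ) * Complex.I) := by
    refine Summable.of_norm ?_
    simp only [hnorm _ _ (exp_pos _).le]
    exact (summable_exp_neg_mul_int_add_sq (c := π * g) (by positivity) z).congr fun n => by
      congr 1; ring
  have s2 : Summable fun n : ℤ => ((exp (-π / g * (((-n : ℤ) : ℝ) - ξ) ^ 2) : ℝ) : ℂ) *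
        Complex.exp (((2 * π * (φ + ((-n : ℤ) : ℝ) * z) : ℝ) : ℂ) * Complex.I) := by
    refine Summable.of_norm ?_
    simp only [hnorm _ _ (exp_pos _).le]
    exact (summable_exp_neg_mul_int_add_sq (c := π / g) (by positivity) ξ).congr fun n => by
      congr 1; push_cast; ring
  have h3 := congrArg Complex.re h2
  rw [Complex.re_tsum s2, Complex.re_ofReal_mul, Complex.re_tsum s1] at h3
  simp only [hre] at h3
  rw [← (Equiv.neg ℤ).tsum_eq (fun m : ℤ => exp (-π / g * ((m : ℝ) - ξ) ^ 2) * cos (2 * π * (φ + m * z)))]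
  simp only [Equiv.neg_apply]
  have hg0 : √g ≠ 0 := by positivity
  rw [h3, ← mul_assoc, one_div_mul_cancel hg0, one_mul]

theorem tsum_gauss {g : ℝ} (hg : 0 < g) (z : ℝ) :
    ∑' l : ℤ, exp (-π * g * ((l : ℝ) + z) ^ 2) =
      1 / √g * ∑' m : ℤ, exp (-π / g * (m : ℝ) ^ 2) * cos (2 * π * (m * z)) := by
  simpa using tsum_gauss_mul_cos hg z 0 0

theorem latticeTheta_eq_rows (x : ℝ) {y : ℝ} (hy : 0 < y) (z : ℝ × ℝ) {α : ℝ} (hα : 0 < α) :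
    latticeTheta x y z α = ∑' l : ℤ, exp (-π * (α * y) * ((l : ℝ) + z.2) ^ 2) *
      ∑' k : ℤ, exp (-π * (α / y) * ((k : ℝ) + (z.1 + x * (l + z.2))) ^ 2) := by
  have hs := summable_latticeTheta x hy z hα
  rw [latticeTheta, tsum_int_prod_swap hs]
  refine tsum_congr fun l => ?_
  rw [← tsum_mul_left]
  refine tsum_congr fun k => ?_
  rw [← exp_add]
  congr 1
  field_simp
  ring

theorem latticeTheta_eq_fourier (x : ℝ) {y : ℝ} (hy : 0 < y) (z : ℝ × ℝ) {α : ℝ} (hα : 0 < α) :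
    latticeTheta x y z α = 1 / α * ∑' p : ℤ × ℤ,
      exp (-(π / α) * (((p.1 : ℝ) - p.2 * x) ^ 2 / y + y * (p.2 : ℝ) ^ 2)) *
        cos (2 * π * (p.2 * z.1 + p.1 * z.2)) := by
  rw [latticeTheta_eq_rows x hy z hα]
  have h1 : ∀ l : ℤ, exp (-π * (α * y) * ((l : ℝ) + z.2) ^ 2) *
      ∑' k : ℤ, exp (-π * (α / y) * ((k : ℝ) + (z.1 + x * (l + z.2))) ^ 2) =
      1 / √(α / y) * ∑' k : ℤ, exp (-π * (α * y) * ((l : ℝ) + z.2) ^ 2) *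
        (exp (-π / (α / y) * (k : ℝ) ^ 2) * cos (2 * π * (k * (z.1 + x * (l + z.2))))) := by
    intro l
    rw [tsum_gauss (by positivity) _, tsum_mul_left]
    ring
  simp only [h1]
  rw [tsum_mul_left]
  have hsum : Summable (Function.uncurry fun (l k : ℤ) => exp (-π * (α * y) * ((l : ℝ) + z.2) ^ 2) *
        (exp (-π / (α / y) * (k : ℝ) ^ 2) * cos (2 * π * (k * (z.1 + x * (l + z.2)))))) := by
    refine Summable.of_norm_bounded
      ((summable_exp_neg_mul_int_add_sq (c := π * (α * y)) (by positivity) z.2).mul_of_nonneg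
      (summable_exp_neg_mul_int_sq (c := π / (α / y)) (by positivity))
      (fun _ => (exp_pos _).le) (fun _ => (exp_pos _).le)) fun p => ?_
    simp only [Function.uncurry, norm_mul, norm_of_nonneg (exp_pos _).le, norm_eq_abs]
    rw [← mul_assoc, ← neg_mul, neg_div]
    exact mul_le_of_le_one_right (by positivity) (abs_cos_le_one _)
  rw [← hsum.tsum_comm]
  have h2 : ∀ k : ℤ, ∑' l : ℤ, exp (-π * (α * y) * ((l : ℝ) + z.2) ^ 2) *
        (exp (-π / (α / y) * (k : ℝ) ^ 2) * cos (2 * π * (k * (z.1 + x * (l + z.2))))) =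
      1 / √(α * y) * ∑' m : ℤ, exp (-(π / α) * (((m : ℝ) - k * x) ^ 2 / y + y * (k : ℝ) ^ 2)) *
        cos (2 * π * (k * z.1 + m * z.2)) := by
    intro k
    have := tsum_gauss_mul_cos (g := α * y) (by positivity) z.2 (k * x) (k * z.1)
    calc _ = exp (-π / (α / y) * (k : ℝ) ^ 2) * ∑' l : ℤ, exp (-π * (α * y) * ((l : ℝ) + z.2) ^ 2) *
        cos (2 * π * (k * z.1 + k * x * (l + z.2))) := by
          rw [← tsum_mul_left]
          refine tsum_congr fun l => ?_
          rw [show k * (z.1 + x * (l + z.2)) = k * z.1 + k * x * (l + z.2) by ring]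
          ring
      _ = _ := by
          rw [this, mul_left_comm, ← tsum_mul_left]
          congr 1
          refine tsum_congr fun m => ?_
          rw [← mul_assoc, ← exp_add]
          congr 2
          field_simp
          ring
  simp only [h2]
  rw [tsum_mul_left, ← mul_assoc]
  have h3 : 1 / √(α / y) * (1 / √(α * y)) = 1 / α := by
    rw [one_div_mul_one_div, ← Real.sqrt_mul (by positivity)]
    rw [show α / y * (α * y) = α ^ 2 by field_simp, Real.sqrt_sq hα.le]
  rw [h3]
  congr 1
  have hs : Summable fun p : ℤ × ℤ =>
      exp (-(π / α) * (((p.1 : ℝ) - p.2 * x) ^ 2 / y + y * (p.2 : ℝ) ^ 2)) *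
        cos (2 * π * (p.2 * z.1 + p.1 * z.2)) := by
    have h4 := summable_latticeTheta (-x) hy (0, 0) (α := 1 / α) (by positivity)
    refine Summable.of_norm_bounded h4 fun p => ?_
    rw [norm_mul, norm_of_nonneg (exp_pos _).le, norm_eq_abs]
    refine (mul_le_of_le_one_right (exp_pos _).le (abs_cos_le_one _)).trans (le_of_eq ?_)
    congr 1
    simp only [add_zero]
    field_simp
    ring
  rw [tsum_int_prod_swap hs]

end Poisson

section TripleProduct

open Filter Topology

/-- The reciprocal `q`-Pochhammer symbol `1 / ∏_{i=1}^n (1 - Q^i)`, extended by zero to `n < 0`. -/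
noncomputable def invPoch (Q : ℝ) (n : ℤ) : ℝ :=
  if n < 0 then 0 else (∏ i ∈ Finset.range n.toNat, (1 - Q ^ (i + 1)))⁻¹

theorem invPoch_natCast (Q : ℝ) (n : ℕ) :
    invPoch Q n = (∏ i ∈ Finset.range n, (1 - Q ^ (i + 1)))⁻¹ := by
  simp [invPoch]

theorem one_sub_pow_succ_pos {Q : ℝ} (h0 : 0 < Q) (h1 : Q < 1) (n : ℕ) : 0 < 1 - Q ^ (n + 1) :=
  sub_pos.2 (pow_lt_one₀ h0.le h1 (Nat.succ_ne_zero n))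

theorem invPoch_nonneg {Q : ℝ} (h0 : 0 < Q) (h1 : Q < 1) (n : ℤ) : 0 ≤ invPoch Q n := by
  unfold invPoch
  split_ifs
  · exact le_rfl
  · exact inv_nonneg.2 (Finset.prod_nonneg fun i _ => (one_sub_pow_succ_pos h0 h1 i).le)

theorem invPoch_eq_mul_succ {Q : ℝ} (h0 : 0 < Q) (h1 : Q < 1) (n : ℤ) :
    invPoch Q n = (1 - Q ^ (n + 1)) * invPoch Q (n + 1) := by
  rcases lt_trichotomy n (-1) with h | rfl | h
  · rw [invPoch, if_pos (by omega), invPoch, if_pos (by omega), mul_zero]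
  · simp [invPoch]
  · obtain ⟨m, rfl⟩ := Int.eq_ofNat_of_zero_le (show 0 ≤ n by omega)
    have e : ((m : ℤ) + 1) = ((m + 1 : ℕ) : ℤ) := by push_cast; rfl
    rw [e, invPoch_natCast, invPoch_natCast, Finset.prod_range_succ, zpow_natCast]
    have h2 := (one_sub_pow_succ_pos h0 h1 m).ne'
    rw [mul_inv, mul_comm, mul_assoc, inv_mul_cancel₀ h2, mul_one]

theorem invPoch_natCast_le {Q : ℝ} (h0 : 0 < Q) (h1 : Q < 1) (n : ℕ) :
    invPoch Q n ≤ exp (∑ i ∈ Finset.range n, Q ^ (i + 1) / (1 - Q)) := by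
  rw [invPoch_natCast, ← Finset.prod_inv_distrib, exp_sum]
  refine Finset.prod_le_prod (fun i _ => (inv_pos.2 (one_sub_pow_succ_pos h0 h1 i)).le)
    fun i _ => ?_
  have h2 := one_sub_pow_succ_pos h0 h1 i
  have h3 : Q ^ (i + 1) ≤ Q := by
    rw [pow_succ]; exact mul_le_of_le_one_left h0.le (pow_le_one₀ h0.le h1.le)
  have h4 := add_one_le_exp (Q ^ (i + 1) / (1 - Q))
  refine le_trans ?_ h4
  have h5 : Q ^ (i + 1) / (1 - Q ^ (i + 1)) ≤ Q ^ (i + 1) / (1 - Q) := by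
    gcongr
  refine le_trans (le_of_eq ?_) (add_le_add_left h5 1)
  field_simp
  ring

theorem exists_invPoch_bound {Q : ℝ} (h0 : 0 < Q) (h1 : Q < 1) :
    ∃ R : ℝ, ∀ n : ℤ, invPoch Q n ≤ R := by
  refine ⟨exp (1 / (1 - Q) / (1 - Q)), fun n => ?_⟩
  rcases lt_or_ge n 0 with h | h
  · rw [invPoch, if_pos h]; exact (exp_pos _).le
  · obtain ⟨m, rfl⟩ := Int.eq_ofNat_of_zero_le h
    refine (invPoch_natCast_le h0 h1 m).trans (exp_le_exp.2 ?_)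
    rw [← Finset.sum_div]
    have h2 : 0 < 1 - Q := by linarith
    gcongr
    have h3 : ∑ i ∈ Finset.range m, Q ^ (i + 1) ≤ ∑ i ∈ Finset.range m, Q ^ i :=
      Finset.sum_le_sum fun i _ => pow_le_pow_of_le_one h0.le h1.le (Nat.le_succ i)
    refine h3.trans ?_
    rw [one_div, ← tsum_geometric_of_lt_one h0.le h1]
    exact (summable_geometric_of_lt_one h0.le h1).sum_le_tsum _ fun i _ => by positivity

theorem exists_tendsto_invPoch {Q : ℝ} (h0 : 0 < Q) (h1 : Q < 1) :
    ∃ L : ℝ, 0 < L ∧ Tendsto (fun n : ℤ => invPoch Q n) atTop (𝓝 L) := by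
  obtain ⟨R, hR⟩ := exists_invPoch_bound h0 h1
  have hmono : Monotone (invPoch Q) := by
    refine monotone_int_of_le_succ fun n => ?_
    rw [invPoch_eq_mul_succ h0 h1 n]
    rcases lt_or_ge (n + 1) 0 with h | h
    · rw [invPoch, if_pos h, mul_zero]
    · refine mul_le_of_le_one_left (invPoch_nonneg h0 h1 _) ?_
      linarith [zpow_pos h0 (n + 1)]
  refine ⟨_, ?_, tendsto_atTop_ciSup hmono ⟨R, by rintro _ ⟨n, rfl⟩; exact hR n⟩⟩
  have h2 : invPoch Q 0 = 1 := by simp [invPoch]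
  exact lt_of_lt_of_le (by rw [h2]; exact one_pos)
    (le_ciSup (f := invPoch Q) ⟨R, by rintro _ ⟨n, rfl⟩; exact hR n⟩ 0)

theorem invPoch_mul_rec {Q : ℝ} (h0 : 0 < Q) (h1 : Q < 1) (N k : ℤ) :
    (1 - Q ^ (2 * N + 1)) * (1 - Q ^ (2 * N + 2)) *
        (invPoch Q (N + 1 - k) * invPoch Q (N + 1 + k)) =
      (1 + Q ^ (2 * N + 1)) * (invPoch Q (N - k) * invPoch Q (N + k)) +
        Q ^ (N + 1 - k) * (invPoch Q (N - (k - 1)) * invPoch Q (N + (k - 1))) +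
        Q ^ (N + 1 + k) * (invPoch Q (N - (k + 1)) * invPoch Q (N + (k + 1))) := by
  have a1 := invPoch_eq_mul_succ h0 h1 (N - k)
  have a2 := invPoch_eq_mul_succ h0 h1 (N + k)
  have a3 := invPoch_eq_mul_succ h0 h1 (N - (k + 1))
  have a4 := invPoch_eq_mul_succ h0 h1 (N + (k - 1))
  rw [show N - (k + 1) + 1 = N - k by ring] at a3
  rw [show N + (k - 1) + 1 = N + k by ring] at a4
  rw [a3, a4, show N - (k - 1) = N - k + 1 by ring, show N + (k + 1) = N + k + 1 by ring,
    a1, a2, show N + 1 - k = N - k + 1 by ring, show N + 1 + k = N + k + 1 by ring]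
  have e1 : Q ^ (2 * N + 1) = Q * (Q ^ (N - k) * Q ^ (N + k)) := by
    rw [← zpow_add₀ h0.ne', ← zpow_one_add₀ h0.ne']; congr 1; ring
  have e2 : Q ^ (2 * N + 2) = Q ^ 2 * (Q ^ (N - k) * Q ^ (N + k)) := by
    rw [← zpow_add₀ h0.ne', ← zpow_natCast Q 2, ← zpow_add₀ h0.ne']; congr 1; push_cast; ring
  rw [e1, e2, zpow_add_one₀ h0.ne', zpow_add_one₀ h0.ne']
  ring

/-- Finite theta sums with `q`-binomial weights. -/
noncomputable def finTheta (q : ℝ) (N : ℕ) (t : ℝ) : ℝ :=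
  ∑' k : ℤ, q ^ (k ^ 2) * (invPoch (q ^ 2) (N - k) * invPoch (q ^ 2) (N + k)) * cos (k * t)

theorem summable_zpow_sq {q : ℝ} (h0 : 0 < q) (h1 : q < 1) :
    Summable fun k : ℤ => q ^ (k ^ 2) := by
  have h := summable_exp_neg_mul_int_sq (c := -log q) (by linarith [log_neg h0 h1])
  refine h.congr fun k => ?_
  rw [neg_neg, ← rpow_intCast, rpow_def_of_pos h0]
  push_cast
  rfl

theorem sq_lt_one_of_pos {q : ℝ} (h0 : 0 < q) (h1 : q < 1) : q ^ 2 < 1 :=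
  pow_lt_one₀ h0.le h1 two_ne_zero

theorem exists_finTheta_bound {q : ℝ} (h0 : 0 < q) (h1 : q < 1) :
    ∃ R : ℝ, ∀ (N : ℕ) (k : ℤ) (t : ℝ),
      ‖q ^ (k ^ 2) * (invPoch (q ^ 2) (N - k) * invPoch (q ^ 2) (N + k)) * cos t‖
        ≤ q ^ (k ^ 2) * R := by
  have hQ0 : 0 < q ^ 2 := by positivity
  have hQ1 := sq_lt_one_of_pos h0 h1
  obtain ⟨R, hR⟩ := exists_invPoch_bound hQ0 hQ1
  refine ⟨R * R, fun N k t => ?_⟩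
  have n1 := invPoch_nonneg hQ0 hQ1 (N - k)
  have n2 := invPoch_nonneg hQ0 hQ1 (N + k)
  rw [norm_mul, norm_of_nonneg (mul_nonneg (zpow_pos h0 _).le (mul_nonneg n1 n2)), norm_eq_abs]
  refine (mul_le_of_le_one_right (mul_nonneg (zpow_pos h0 _).le (mul_nonneg n1 n2))
    (abs_cos_le_one t)).trans ?_
  exact mul_le_mul_of_nonneg_left
    (mul_le_mul (hR _) (hR _) n2 (n1.trans (hR _))) (zpow_pos h0 _).le

theorem finTheta_succ {q : ℝ} (h0 : 0 < q) (h1 : q < 1) (N : ℕ) (t : ℝ) :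
    (1 - (q ^ 2) ^ (2 * N + 1)) * (1 - (q ^ 2) ^ (2 * N + 2)) * finTheta q (N + 1) t =
      (1 + (q ^ (2 * N + 1)) ^ 2 + 2 * q ^ (2 * N + 1) * cos t) * finTheta q N t := by
  have hQ0 : 0 < q ^ 2 := by positivity
  have hQ1 := sq_lt_one_of_pos h0 h1
  obtain ⟨R, hR⟩ := exists_finTheta_bound h0 h1
  have hsq := (summable_zpow_sq h0 h1).mul_right R
  set f : ℤ → ℝ := fun k => q ^ (k ^ 2) * (invPoch (q ^ 2) (N - k) * invPoch (q ^ 2) (N + k))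
    with hf
  have s1 : ∀ g : ℤ → ℝ, Summable fun k : ℤ => f k * cos (g k) := fun g =>
    Summable.of_norm_bounded hsq fun k => hR N k (g k)
  have hF : finTheta q N t = ∑' k : ℤ, f k * cos (k * t) := rfl
  have e1 : 2 * cos t * finTheta q N t
      = ∑' k : ℤ, (f (k - 1) * cos (k * t) + f (k + 1) * cos (k * t)) := by
    have t1 := s1 fun k => ((k : ℝ) + 1) * t
    have t2 := s1 fun k => ((k : ℝ) - 1) * t
    have t1' := (Equiv.subRight (1 : ℤ)).summable_iff.2 t1
    have t2' := (Equiv.addRight (1 : ℤ)).summable_iff.2 t2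
    have e2 := (Equiv.subRight (1 : ℤ)).tsum_eq fun k => f k * cos (((k : ℝ) + 1) * t)
    have e3 := (Equiv.addRight (1 : ℤ)).tsum_eq fun k => f k * cos (((k : ℝ) - 1) * t)
    simp only [Function.comp_def, Equiv.subRight_apply, Equiv.coe_addRight, Int.cast_sub,
      Int.cast_add, Int.cast_one, sub_add_cancel, add_sub_cancel_right] at t1' t2' e2 e3
    rw [t1'.tsum_add t2', e2, e3, ← t1.tsum_add t2, hF, ← tsum_mul_left]
    refine tsum_congr fun k => ?_
    rw [add_mul, sub_mul, one_mul, cos_add, cos_sub]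
    ring
  have t3 : Summable fun k : ℤ => f (k - 1) * cos (k * t) + f (k + 1) * cos (k * t) := by
    have t1 := s1 fun k => ((k : ℝ) + 1) * t
    have t2 := s1 fun k => ((k : ℝ) - 1) * t
    have t1' := (Equiv.subRight (1 : ℤ)).summable_iff.2 t1
    have t2' := (Equiv.addRight (1 : ℤ)).summable_iff.2 t2
    simp only [Function.comp_def, Equiv.subRight_apply, Equiv.coe_addRight, Int.cast_sub,
      Int.cast_add, Int.cast_one, sub_add_cancel, add_sub_cancel_right] at t1' t2'
    exact t1'.add t2'
  have e4 : (1 + (q ^ (2 * N + 1)) ^ 2 + 2 * q ^ (2 * N + 1) * cos t) * finTheta q N t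
      = ∑' k : ℤ, ((1 + (q ^ (2 * N + 1)) ^ 2) * (f k * cos (k * t)) +
        q ^ (2 * N + 1) * (f (k - 1) * cos (k * t) + f (k + 1) * cos (k * t))) := by
    rw [((s1 fun k => (k : ℝ) * t).mul_left _).tsum_add (t3.mul_left _), tsum_mul_left,
      tsum_mul_left, ← e1, hF]
    ring
  rw [e4, finTheta, ← tsum_mul_left]
  refine tsum_congr fun k => ?_
  have hrec := invPoch_mul_rec hQ0 hQ1 N k
  have p1 : (q ^ 2) ^ (2 * (N : ℤ) + 1) = (q ^ 2) ^ (2 * N + 1) := by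
    rw [← zpow_natCast (q ^ 2) (2 * N + 1)]; push_cast; rfl
  have p2 : (q ^ 2) ^ (2 * (N : ℤ) + 2) = (q ^ 2) ^ (2 * N + 2) := by
    rw [← zpow_natCast (q ^ 2) (2 * N + 2)]; push_cast; rfl
  have p3 : (q ^ (2 * N + 1)) ^ 2 = (q ^ 2) ^ (2 * N + 1) := by rw [← pow_mul, ← pow_mul, mul_comm]
  have p4 : q ^ (k ^ 2) * (q ^ 2) ^ ((N : ℤ) + 1 - k) = q ^ (2 * N + 1) * q ^ ((k - 1) ^ 2) := by
    rw [← zpow_natCast q 2, ← zpow_mul, ← zpow_natCast, ← zpow_add₀ h0.ne', ← zpow_add₀ h0.ne']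
    congr 1; push_cast; ring
  have p5 : q ^ (k ^ 2) * (q ^ 2) ^ ((N : ℤ) + 1 + k) = q ^ (2 * N + 1) * q ^ ((k + 1) ^ 2) := by
    rw [← zpow_natCast q 2, ← zpow_mul, ← zpow_natCast, ← zpow_add₀ h0.ne', ← zpow_add₀ h0.ne']
    congr 1; push_cast; ring
  rw [p1, p2] at hrec
  simp only [hf, p3]
  push_cast
  linear_combination (q ^ (k ^ 2) * cos (k * t)) * hrec
    + cos (k * t) * (invPoch (q ^ 2) (N - (k - 1)) * invPoch (q ^ 2) (N + (k - 1))) * p4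
    + cos (k * t) * (invPoch (q ^ 2) (N - (k + 1)) * invPoch (q ^ 2) (N + (k + 1))) * p5

theorem finTheta_zero (q t : ℝ) : finTheta q 0 t = 1 := by
  rw [finTheta, tsum_eq_single 0]
  · simp [invPoch]
  · intro k hk
    rcases lt_or_gt_of_ne hk with h | h
    · rw [invPoch, invPoch, if_pos (show ((0 : ℕ) : ℤ) + k < 0 by simpa using h)]; simp
    · rw [invPoch, if_pos (show ((0 : ℕ) : ℤ) - k < 0 by simpa using h)]; simp

/-- The properties of the Jacobi theta function, as a function of the cosine, that are used
below. They are stable under products and limits. -/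
structure ThetaLike (f : ℝ → ℝ) : Prop where
  nonneg : ∀ s ∈ Set.Icc (-1 : ℝ) 1, 0 ≤ f s
  mono : MonotoneOn f (Set.Icc (-1) 1)
  convex : ConvexOn ℝ (Set.Icc (-1) 1) f
  anti : ∀ s t, 0 ≤ s → s ≤ t → t ≤ 1 → f t * f (-t) ≤ f s * f (-s)

theorem ThetaLike.mul {f g : ℝ → ℝ} (hf : ThetaLike f) (hg : ThetaLike g) :
    ThetaLike (fun s => f s * g s) where
  nonneg s hs := mul_nonneg (hf.nonneg s hs) (hg.nonneg s hs)
  mono s hs t ht hst := mul_le_mul (hf.mono hs ht hst) (hg.mono hs ht hst) (hg.nonneg s hs)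
    (hf.nonneg t ht)
  convex := hf.convex.mul hg.convex (fun s hs => hf.nonneg s hs) (fun s hs => hg.nonneg s hs)
    (hf.mono.monovaryOn hg.mono)
  anti s t hs hst ht := by
    have h1 := mul_le_mul (hf.anti s t hs hst ht) (hg.anti s t hs hst ht)
      (mul_nonneg (hg.nonneg t ⟨by linarith, ht⟩) (hg.nonneg (-t) ⟨by linarith, by linarith⟩))
      (mul_nonneg (hf.nonneg s ⟨by linarith, by linarith⟩)
        (hf.nonneg (-s) ⟨by linarith, by linarith⟩))
    calc _ = f t * f (-t) * (g t * g (-t)) := by ring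
      _ ≤ _ := h1
      _ = _ := by ring

theorem thetaLike_affine {a b : ℝ} (hb : 0 ≤ b) (hab : b ≤ a) :
    ThetaLike fun s => a + b * s where
  nonneg s hs := by nlinarith [hs.1]
  mono s _ t _ hst := by
    have := mul_le_mul_of_nonneg_left hst hb
    simpa using this
  convex := by
    refine ⟨convex_Icc _ _, fun s _ t _ u v _ _ huv => le_of_eq ?_⟩
    simp only [smul_eq_mul]
    linear_combination (-a) * huv
  anti s t hs hst ht := by
    have : s ^ 2 ≤ t ^ 2 := by gcongr
    nlinarith [mul_le_mul_of_nonneg_left this (sq_nonneg b)]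

theorem thetaLike_of_tendsto {f : ℕ → ℝ → ℝ} {g : ℝ → ℝ} (hf : ∀ n, ThetaLike (f n))
    (h : ∀ s ∈ Set.Icc (-1 : ℝ) 1, Tendsto (fun n => f n s) atTop (𝓝 (g s))) : ThetaLike g where
  nonneg s hs := ge_of_tendsto' (h s hs) fun n => (hf n).nonneg s hs
  mono s hs t ht hst := le_of_tendsto_of_tendsto' (h s hs) (h t ht) fun n => (hf n).mono hs ht hst
  convex := by
    refine ⟨convex_Icc _ _, fun s hs t ht u v hu hv huv => ?_⟩
    exact le_of_tendsto_of_tendsto' (h _ (convex_Icc _ _ hs ht hu hv huv))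
      (((h s hs).const_smul u).add ((h t ht).const_smul v))
      fun n => (hf n).convex.2 hs ht hu hv huv
  anti s t hs hst ht := by
    refine le_of_tendsto_of_tendsto'
      ((h t ⟨by linarith, ht⟩).mul (h (-t) ⟨by linarith, by linarith⟩))
      ((h s ⟨by linarith, by linarith⟩).mul (h (-s) ⟨by linarith, by linarith⟩))
      fun n => (hf n).anti s t hs hst ht

theorem exists_thetaLike_finTheta {q : ℝ} (h0 : 0 < q) (h1 : q < 1) (N : ℕ) :
    ∃ f : ℝ → ℝ, ThetaLike f ∧
      ∀ t, finTheta q (N + 1) t = (1 + q ^ 2 + 2 * q * cos t) * f (cos t) := by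
  have hQ0 : 0 < q ^ 2 := by positivity
  have hQ1 := sq_lt_one_of_pos h0 h1
  have hc0 : ∀ N : ℕ, 0 < (1 - (q ^ 2) ^ (2 * N + 1)) * (1 - (q ^ 2) ^ (2 * N + 2)) := fun N =>
    mul_pos (one_sub_pow_succ_pos hQ0 hQ1 (2 * N)) (one_sub_pow_succ_pos hQ0 hQ1 (2 * N + 1))
  induction N with
  | zero =>
    set c := (1 - (q ^ 2) ^ (2 * 0 + 1)) * (1 - (q ^ 2) ^ (2 * 0 + 2)) with hc
    refine ⟨fun s => 1 / c + 0 * s, thetaLike_affine le_rfl (one_div_nonneg.2 (hc0 0).le),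
      fun t => ?_⟩
    have h3 := finTheta_succ h0 h1 0 t
    rw [← hc, finTheta_zero, mul_one] at h3
    have hc1 : c ≠ 0 := (hc0 0).ne'
    beta_reduce
    rw [zero_mul, add_zero, mul_one_div, eq_div_iff hc1, mul_comm, h3]
    simp
  | succ N ih =>
    obtain ⟨f, hf, hft⟩ := ih
    set c := (1 - (q ^ 2) ^ (2 * (N + 1) + 1)) * (1 - (q ^ 2) ^ (2 * (N + 1) + 2)) with hc
    have hc1 : 0 < c := hc0 (N + 1)
    set r := q ^ (2 * (N + 1) + 1) with hr
    have hr0 : 0 < r := by positivity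
    have h2 : ThetaLike fun s => (1 + r ^ 2) / c + 2 * r / c * s := by
      refine thetaLike_affine (by positivity) ?_
      gcongr
      nlinarith [sq_nonneg (1 - r)]
    refine ⟨_, h2.mul hf, fun t => ?_⟩
    have h3 := finTheta_succ h0 h1 (N + 1) t
    rw [← hc, ← hr, hft] at h3
    have : finTheta q (N + 1 + 1) t
        = (1 + r ^ 2 + 2 * r * cos t) * ((1 + q ^ 2 + 2 * q * cos t) * f (cos t)) / c := by
      rw [eq_div_iff hc1.ne', ← h3]; ring
    rw [this]
    field_simp

theorem exists_tendsto_finTheta {q : ℝ} (h0 : 0 < q) (h1 : q < 1) :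
    ∃ L : ℝ, 0 < L ∧ ∀ t, Tendsto (fun N => finTheta q N t) atTop
      (𝓝 (∑' k : ℤ, q ^ (k ^ 2) * (L * L) * cos (k * t))) := by
  have hQ0 : 0 < q ^ 2 := by positivity
  have hQ1 := sq_lt_one_of_pos h0 h1
  obtain ⟨L, hL, hlim⟩ := exists_tendsto_invPoch hQ0 hQ1
  obtain ⟨R, hR⟩ := exists_finTheta_bound h0 h1
  refine ⟨L, hL, fun t => ?_⟩
  refine tendsto_tsum_of_dominated_convergence ((summable_zpow_sq h0 h1).mul_right R)
    (fun k => ?_) (Eventually.of_forall fun N k => hR N k _)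
  have a1 : Tendsto (fun N : ℕ => (N : ℤ) - k) atTop atTop :=
    tendsto_atTop_add_const_right _ (-k) tendsto_natCast_atTop_atTop
  have a2 : Tendsto (fun N : ℕ => (N : ℤ) + k) atTop atTop :=
    tendsto_atTop_add_const_right _ k tendsto_natCast_atTop_atTop
  exact (((hlim.comp a1).mul (hlim.comp a2)).const_mul _).mul_const _

theorem ThetaLike.strictMonoOn {a b : ℝ} {g : ℝ → ℝ} (hb : 0 < b) (hab : b ≤ a)
    (hg : ThetaLike g) (hpos : ∀ s ∈ Set.Icc (-1 : ℝ) 1, 0 < (a + b * s) * g s) :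
    StrictMonoOn (fun s => (a + b * s) * g s) (Set.Icc (-1) 1) := by
  intro s hs t ht hst
  have h1 : 0 < g s := by
    refine lt_of_le_of_ne (hg.nonneg s hs) fun h => ?_
    have := hpos s hs
    rw [← h, mul_zero] at this
    exact lt_irrefl _ this
  have h2 := hg.mono hs ht hst.le
  have h3 : 0 ≤ a + b * t := by nlinarith [ht.1]
  calc (a + b * s) * g s < (a + b * t) * g s :=
        mul_lt_mul_of_pos_right (by linarith [mul_lt_mul_of_pos_left hst hb]) h1
    _ ≤ (a + b * t) * g t := mul_le_mul_of_nonneg_left h2 h3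

/-- The one-dimensional Gaussian sum is a convex increasing function of `cos (2πu)`. -/
theorem exists_thetaLike_gauss {c : ℝ} (hc : 0 < c) :
    ∃ f : ℝ → ℝ, ThetaLike f ∧ (∀ s ∈ Set.Icc (-1 : ℝ) 1, 0 < f s) ∧
      StrictMonoOn f (Set.Icc (-1) 1) ∧
      ∀ u : ℝ, ∑' k : ℤ, exp (-c * ((k : ℝ) + u) ^ 2) = f (cos (2 * π * u)) := by
  set g := c / π with hg
  have hg0 : 0 < g := by positivity
  set q := exp (-π / g) with hq
  have h0 : 0 < q := exp_pos _
  have h1 : q < 1 := by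
    rw [hq, exp_lt_one_iff, neg_div]
    have : 0 < π / g := by positivity
    linarith
  obtain ⟨L, hL, hlim⟩ := exists_tendsto_finTheta h0 h1
  choose F hF hFt using exists_thetaLike_finTheta h0 h1
  have haff : ∀ t, 0 < 1 + q ^ 2 + 2 * q * cos t := fun t => by
    nlinarith [neg_one_le_cos t, sq_pos_of_pos (sub_pos.2 h1)]
  have hFlim : ∀ t, Tendsto (fun N => F N (cos t)) atTop
      (𝓝 (L * L * (∑' k : ℤ, q ^ (k ^ 2) * cos (k * t)) / (1 + q ^ 2 + 2 * q * cos t))) := by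
    intro t
    have h2 := ((hlim t).comp (tendsto_add_atTop_nat 1)).div_const (1 + q ^ 2 + 2 * q * cos t)
    simp only [Function.comp_def, hFt, mul_div_cancel_left₀ _ (haff t).ne'] at h2
    rw [← tsum_mul_left]
    convert! h2 using 4
    ext k
    ring
  set f : ℝ → ℝ := fun s => 1 / √g * (∑' k : ℤ, q ^ (k ^ 2) * cos (k * arccos s)) with hf
  have key : ∀ t, ∑' k : ℤ, q ^ (k ^ 2) * cos (k * t)
      = ∑' k : ℤ, q ^ (k ^ 2) * cos (k * arccos (cos t)) := by
    intro t
    have h2 := hFlim (arccos (cos t))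
    rw [cos_arccos (neg_one_le_cos t) (cos_le_one t)] at h2
    have h3 := tendsto_nhds_unique (hFlim t) h2
    rw [div_left_inj' (haff t).ne'] at h3
    exact mul_left_cancel₀ (by positivity) h3
  set κ := 1 / √g / (L * L) with hκ
  have hκ0 : 0 < κ := by positivity
  have hval : ∀ u : ℝ, ∑' k : ℤ, exp (-c * ((k : ℝ) + u) ^ 2) = f (cos (2 * π * u)) := by
    intro u
    have h2 := tsum_gauss hg0 u
    have h3 : -π * g = -c := by rw [hg]; field_simp
    rw [h3] at h2
    rw [h2, hf]
    beta_reduce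
    rw [← key]
    congr 1
    refine tsum_congr fun k => ?_
    congr 1
    · rw [hq, ← rpow_intCast, ← exp_mul]
      push_cast
      rfl
    · congr 1; ring
  have hpos : ∀ s ∈ Set.Icc (-1 : ℝ) 1, 0 < f s := by
    intro s hs
    have h2 := hval (arccos s / (2 * π))
    rw [mul_div_cancel₀ _ (by positivity), cos_arccos hs.1 hs.2] at h2
    rw [← h2]
    exact (summable_exp_neg_mul_int_add_sq hc _).tsum_pos (fun _ => (exp_pos _).le) 0 (exp_pos _)
  set h : ℝ → ℝ := fun s => f s / (1 + q ^ 2 + 2 * q * s) with hh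
  have hfh : ∀ s ∈ Set.Icc (-1 : ℝ) 1, f s = (1 + q ^ 2 + 2 * q * s) * h s := by
    intro s hs
    have := haff (arccos s)
    rw [cos_arccos hs.1 hs.2] at this
    rw [hh]
    beta_reduce
    rw [mul_div_cancel₀ _ this.ne']
  have hT : ThetaLike h := by
    refine thetaLike_of_tendsto (f := fun N s => (κ + 0 * s) * F N s)
      (fun N => (thetaLike_affine le_rfl hκ0.le).mul (hF N)) fun s hs => ?_
    have h2 := (hFlim (arccos s)).const_mul κ
    rw [cos_arccos hs.1 hs.2] at h2
    simp only [zero_mul, add_zero]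
    convert! h2 using 2
    rw [hh, hf, hκ]
    beta_reduce
    have hsq : √g ≠ 0 := by positivity
    field_simp
    simp only [mul_comm]
  have hb : 2 * q ≤ 1 + q ^ 2 := by nlinarith [sq_nonneg (1 - q)]
  have hb0 : 0 < 2 * q := by positivity
  have hmul := (thetaLike_affine hb0.le hb).mul hT
  have hstrict := hT.strictMonoOn hb0 hb fun s hs => by rw [← hfh s hs]; exact hpos s hs
  refine ⟨fun s => (1 + q ^ 2 + 2 * q * s) * h s, hmul, fun s hs => ?_, hstrict, fun u => ?_⟩
  · beta_reduce; rw [← hfh s hs]; exact hpos s hs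
  · rw [hval]; exact hfh _ ⟨neg_one_le_cos _, cos_le_one _⟩

end TripleProduct

section Hexagonal

open Filter Topology

theorem tsum_int_even_add_odd {f : ℤ → ℝ} (hf : Summable f) :
    ∑' l, f l = ∑' n : ℤ, f (2 * n) + ∑' n : ℤ, f (2 * n + 1) := by
  have i1 : Function.Injective fun n : ℤ => 2 * n := fun a b h => by
    have : 2 * a = 2 * b := h
    omega
  have i2 : Function.Injective fun n : ℤ => 2 * n + 1 := fun a b h => by
    have : 2 * a + 1 = 2 * b + 1 := h
    omega
  have h1 := i1.hasSum_range_iff.2 (hf.comp_injective i1).hasSum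
  have h2 := i2.hasSum_range_iff.2 (hf.comp_injective i2).hasSum
  refine (HasSum.add_isCompl (t := Set.range fun n : ℤ => 2 * n + 1) ?_ h1 h2).tsum_eq
  have e1 : (Set.range fun n : ℤ => 2 * n) = {n | Even n} := by
    ext n; simp [even_iff_exists_two_mul]
  have e2 : (Set.range fun n : ℤ => 2 * n + 1) = {n | Odd n} := by
    ext n; simp [Odd]
  rw [e1, e2]
  exact Int.isCompl_even_odd

/-- Gaussian sum over the shifted hexagonal lattice. -/
noncomputable def hexSum (c : ℝ) (z : ℝ × ℝ) : ℝ :=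
  ∑' p : ℤ × ℤ, exp (-(c * (((p.1 : ℝ) + z.1) ^ 2 + ((p.1 : ℝ) + z.1) * ((p.2 : ℝ) + z.2) +
    ((p.2 : ℝ) + z.2) ^ 2)))

theorem sqrt_three_sq : (√3 : ℝ) ^ 2 = 3 := Real.sq_sqrt (by norm_num)

theorem exists_hexForm_ge {c : ℝ} (hc : 0 < c) (z : ℝ × ℝ) :
    ∃ δ C : ℝ, 0 < δ ∧ ∀ p : ℤ × ℤ, δ * ((p.1 : ℝ) ^ 2 + (p.2 : ℝ) ^ 2) - C ≤
      c * (((p.1 : ℝ) + z.1) ^ 2 + ((p.1 : ℝ) + z.1) * ((p.2 : ℝ) + z.2) +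
        ((p.2 : ℝ) + z.2) ^ 2) := by
  obtain ⟨δ, C, hδ, h⟩ := exists_form_ge (1 / 2) (y := √3 / 2) (by positivity) z hc
  refine ⟨δ, C, hδ, fun p => (h p).trans (le_of_eq ?_)⟩
  rw [div_pow √3, sqrt_three_sq]
  ring

theorem summable_hexSum {c : ℝ} (hc : 0 < c) (z : ℝ × ℝ) :
    Summable fun p : ℤ × ℤ => exp (-(c * (((p.1 : ℝ) + z.1) ^ 2 +
      ((p.1 : ℝ) + z.1) * ((p.2 : ℝ) + z.2) + ((p.2 : ℝ) + z.2) ^ 2))) := by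
  obtain ⟨δ, C, hδ, h⟩ := exists_hexForm_ge hc z
  exact summable_exp_neg_of_le hδ h

theorem latticeTheta_hex (z : ℝ × ℝ) (α : ℝ) :
    latticeTheta (1 / 2) (√3 / 2) z α = hexSum (2 * π * α / √3) z := by
  rw [latticeTheta, hexSum]
  refine tsum_congr fun p => ?_
  rw [div_pow √3, sqrt_three_sq]
  congr 1
  field_simp
  ring

theorem hexSum_swap (c : ℝ) (z : ℝ × ℝ) : hexSum c (z.2, z.1) = hexSum c z := by
  rw [hexSum, hexSum, ← (Equiv.prodComm ℤ ℤ).tsum_eq]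
  refine tsum_congr fun p => ?_
  simp only [Equiv.prodComm_apply, Prod.fst_swap, Prod.snd_swap]
  ring_nf

/-- The rotation of order six (up to sign) of the hexagonal lattice, in coordinates. -/
def hexRot : ℤ × ℤ ≃ ℤ × ℤ where
  toFun p := (-p.1 - p.2, p.1)
  invFun p := (p.2, -p.1 - p.2)
  left_inv p := by ext <;> grind
  right_inv p := by ext <;> grind

theorem hexSum_rot (c : ℝ) (z : ℝ × ℝ) : hexSum c (-z.1 - z.2, z.1) = hexSum c z := by
  rw [hexSum, hexSum, ← hexRot.tsum_eq]
  refine tsum_congr fun p => ?_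
  simp only [hexRot, Equiv.coe_fn_mk]
  push_cast
  congr 1
  ring

theorem tsum_gauss_add_int (c u : ℝ) (n : ℤ) :
    ∑' k : ℤ, exp (-c * ((k : ℝ) + (u + n)) ^ 2) = ∑' k : ℤ, exp (-c * ((k : ℝ) + u) ^ 2) := by
  rw [← (Equiv.addRight n).tsum_eq fun k : ℤ => exp (-c * ((k : ℝ) + u) ^ 2)]
  refine tsum_congr fun k => ?_
  simp only [Equiv.coe_addRight, Int.cast_add]
  ring_nf

theorem hexSum_eq_rectangular {c : ℝ} (hc : 0 < c) (z : ℝ × ℝ) :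
    hexSum c z =
      (∑' k : ℤ, exp (-c * ((k : ℝ) + (z.1 + z.2 / 2)) ^ 2)) *
        (∑' n : ℤ, exp (-(3 * c) * ((n : ℝ) + z.2 / 2) ^ 2)) +
      (∑' k : ℤ, exp (-c * ((k : ℝ) + (z.1 + z.2 / 2 + 1 / 2)) ^ 2)) *
        (∑' n : ℤ, exp (-(3 * c) * ((n : ℝ) + (z.2 / 2 + 1 / 2)) ^ 2)) := by
  have hs := summable_hexSum hc z
  have hrow : Summable fun l : ℤ => ∑' k : ℤ, exp (-(c * (((k : ℝ) + z.1) ^ 2 +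
      ((k : ℝ) + z.1) * ((l : ℝ) + z.2) + ((l : ℝ) + z.2) ^ 2))) :=
    ((Equiv.prodComm ℤ ℤ).summable_iff.2 hs).prod
  rw [hexSum, tsum_int_prod_swap hs, tsum_int_even_add_odd hrow]
  congr 1
  · rw [mul_comm, ← tsum_mul_right]
    refine tsum_congr fun n => ?_
    rw [← tsum_gauss_add_int c _ n, ← tsum_mul_left]
    refine tsum_congr fun k => ?_
    rw [← exp_add]
    push_cast
    congr 1
    ring
  · rw [mul_comm, ← tsum_mul_right]
    refine tsum_congr fun n => ?_
    rw [← tsum_gauss_add_int c _ n, ← tsum_mul_left]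
    refine tsum_congr fun k => ?_
    rw [← exp_add]
    push_cast
    congr 1
    ring

/-- The rotation of order three about the deep hole of the hexagonal lattice. -/
def holeRot : ℤ × ℤ ≃ ℤ × ℤ where
  toFun p := (p.2, -1 - p.1 - p.2)
  invFun p := (-1 - p.1 - p.2, p.1)
  left_inv p := by ext <;> grind
  right_inv p := by ext <;> grind

theorem hexSum_hole_summable {c : ℝ} (hc : 0 < c) (f : ℤ × ℤ → ℝ) {K : ℝ}
    (hf : ∀ p : ℤ × ℤ, |f p| ≤ K * ((p.1 : ℝ) ^ 2 + (p.2 : ℝ) ^ 2 + 1) ^ 2) :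
    Summable fun p => f p * exp (-(c * (((p.1 : ℝ) + 1 / 3) ^ 2 +
      ((p.1 : ℝ) + 1 / 3) * ((p.2 : ℝ) + 1 / 3) + ((p.2 : ℝ) + 1 / 3) ^ 2))) := by
  obtain ⟨δ, C, hδ, h⟩ := exists_hexForm_ge hc (1 / 3, 1 / 3)
  exact summable_sq_mul_exp_neg hδ h hf

theorem hexSum_hole_first_moment {c : ℝ} (hc : 0 < c) :
    ∑' p : ℤ × ℤ, ((p.2 : ℝ) + 1 / 3) * exp (-(c * (((p.1 : ℝ) + 1 / 3) ^ 2 +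
      ((p.1 : ℝ) + 1 / 3) * ((p.2 : ℝ) + 1 / 3) + ((p.2 : ℝ) + 1 / 3) ^ 2))) = 0 := by
  set e : ℤ × ℤ → ℝ := fun p => exp (-(c * (((p.1 : ℝ) + 1 / 3) ^ 2 +
      ((p.1 : ℝ) + 1 / 3) * ((p.2 : ℝ) + 1 / 3) + ((p.2 : ℝ) + 1 / 3) ^ 2))) with he
  have s1 : Summable fun p : ℤ × ℤ => ((p.1 : ℝ) + 1 / 3) * e p :=
    hexSum_hole_summable hc (K := 1) _ fun p => by
      rw [abs_le]; constructor <;>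
      nlinarith [sq_nonneg ((p.1 : ℝ) - 1), sq_nonneg ((p.1 : ℝ) + 1), sq_nonneg (p.1 : ℝ),
        sq_nonneg (p.2 : ℝ), sq_nonneg ((p.1 : ℝ) ^ 2 + (p.2 : ℝ) ^ 2)]
  have s2 : Summable fun p : ℤ × ℤ => ((p.2 : ℝ) + 1 / 3) * e p :=
    hexSum_hole_summable hc (K := 1) _ fun p => by
      rw [abs_le]; constructor <;>
      nlinarith [sq_nonneg ((p.2 : ℝ) - 1), sq_nonneg ((p.2 : ℝ) + 1), sq_nonneg (p.1 : ℝ),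
        sq_nonneg (p.2 : ℝ), sq_nonneg ((p.1 : ℝ) ^ 2 + (p.2 : ℝ) ^ 2)]
  have h1 : ∑' p : ℤ × ℤ, ((p.1 : ℝ) + 1 / 3) * e p = ∑' p : ℤ × ℤ, ((p.2 : ℝ) + 1 / 3) * e p := by
    rw [← (Equiv.prodComm ℤ ℤ).tsum_eq]
    refine tsum_congr fun p => ?_
    simp only [he, Equiv.prodComm_apply, Prod.fst_swap, Prod.snd_swap]
    ring_nf
  have h2 : ∑' p : ℤ × ℤ, ((p.2 : ℝ) + 1 / 3) * e p
      = ∑' p : ℤ × ℤ, (-(((p.1 : ℝ) + 1 / 3) * e p) - ((p.2 : ℝ) + 1 / 3) * e p) := by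
    rw [← holeRot.tsum_eq fun p : ℤ × ℤ => ((p.2 : ℝ) + 1 / 3) * e p]
    refine tsum_congr fun p => ?_
    simp only [he, holeRot, Equiv.coe_fn_mk]
    push_cast
    ring_nf
  rw [s1.neg.tsum_sub s2, tsum_neg, h1] at h2
  linarith

theorem hexSum_near_hole {c : ℝ} (hc : 0 < c) (h : ℝ) :
    hexSum c (1 / 3, 1 / 3) * (1 - 3 * c * h ^ 2) ≤ hexSum c (1 / 3 - h, 1 / 3 + 2 * h) := by
  set e : ℤ × ℤ → ℝ := fun p => exp (-(c * (((p.1 : ℝ) + 1 / 3) ^ 2 +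
      ((p.1 : ℝ) + 1 / 3) * ((p.2 : ℝ) + 1 / 3) + ((p.2 : ℝ) + 1 / 3) ^ 2))) with he
  have s0 : Summable e := summable_hexSum hc (1 / 3, 1 / 3)
  have s2 : Summable fun p : ℤ × ℤ => ((p.2 : ℝ) + 1 / 3) * e p :=
    hexSum_hole_summable hc (K := 1) _ fun p => by
      rw [abs_le]; constructor <;>
      nlinarith [sq_nonneg ((p.2 : ℝ) - 1), sq_nonneg ((p.2 : ℝ) + 1), sq_nonneg (p.1 : ℝ),
        sq_nonneg (p.2 : ℝ), sq_nonneg ((p.1 : ℝ) ^ 2 + (p.2 : ℝ) ^ 2)]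
  have hm := hexSum_hole_first_moment hc
  have h1 : hexSum c (1 / 3, 1 / 3) * (1 - 3 * c * h ^ 2)
      = ∑' p : ℤ × ℤ, ((1 - 3 * c * h ^ 2) * e p - 3 * c * h * (((p.2 : ℝ) + 1 / 3) * e p)) := by
    rw [(s0.mul_left _).tsum_sub (s2.mul_left _), tsum_mul_left, tsum_mul_left, hm, mul_zero,
      sub_zero, mul_comm]
    rfl
  rw [h1, hexSum]
  refine Summable.tsum_le_tsum (fun p => ?_) ((s0.mul_left _).sub (s2.mul_left _))
    (summable_hexSum hc _)
  set a := (p.1 : ℝ) + 1 / 3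
  set b := (p.2 : ℝ) + 1 / 3
  have h2 := add_one_le_exp (-(c * (3 * h * b + 3 * h ^ 2)))
  have h3 : exp (-(c * (((p.1 : ℝ) + (1 / 3 - h)) ^ 2 + ((p.1 : ℝ) + (1 / 3 - h)) *
      ((p.2 : ℝ) + (1 / 3 + 2 * h)) + ((p.2 : ℝ) + (1 / 3 + 2 * h)) ^ 2)))
      = exp (-(c * (3 * h * b + 3 * h ^ 2))) * e p := by
    rw [he, ← exp_add]
    congr 1
    ring
  rw [h3]
  have h4 := mul_le_mul_of_nonneg_right h2 (exp_pos (-(c * (a ^ 2 + a * b + b ^ 2)))).le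
  have h5 : e p = exp (-(c * (a ^ 2 + a * b + b ^ 2))) := rfl
  rw [← h5] at h4
  refine le_trans (le_of_eq ?_) h4
  ring

/-- A convex function whose values near `s₀` drop at most quadratically is minimal at `s₀`. -/
theorem ConvexOn.le_of_quadratic_lower_bound {G : ℝ → ℝ} {S : Set ℝ} (hG : ConvexOn ℝ S G)
    {s₀ C : ℝ} (hs₀ : s₀ ∈ S)
    (h : ∀ᶠ s in 𝓝 s₀, s ∈ S → G s₀ - C * (s - s₀) ^ 2 ≤ G s) {s : ℝ} (hs : s ∈ S) :
    G s₀ ≤ G s := by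
  have ht : Tendsto (fun t : ℝ => (1 - t) * s₀ + t * s) (𝓝[>] 0) (𝓝 s₀) := by
    have : Tendsto (fun t : ℝ => (1 - t) * s₀ + t * s) (𝓝 0) (𝓝 ((1 - 0) * s₀ + 0 * s)) := by
      apply Continuous.tendsto
      fun_prop
    simp only [sub_zero, one_mul, zero_mul, add_zero] at this
    exact this.mono_left nhdsWithin_le_nhds
  have hlim : Tendsto (fun t : ℝ => G s₀ - C * (t * (s - s₀) ^ 2)) (𝓝[>] 0) (𝓝 (G s₀)) := by
    have : Tendsto (fun t : ℝ => G s₀ - C * (t * (s - s₀) ^ 2)) (𝓝 0)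
        (𝓝 (G s₀ - C * (0 * (s - s₀) ^ 2))) := by
      apply Continuous.tendsto
      fun_prop
    simp only [zero_mul, mul_zero, sub_zero] at this
    exact this.mono_left nhdsWithin_le_nhds
  refine le_of_tendsto hlim ?_
  filter_upwards [ht.eventually h, Ioo_mem_nhdsGT one_pos] with t h1 h2
  have h3 := hG.2 hs₀ hs (sub_nonneg.2 h2.2.le) h2.1.le (by ring)
  have h4 := h1 (hG.1 hs₀ hs (sub_nonneg.2 h2.2.le) h2.1.le (by ring))
  simp only [smul_eq_mul] at h3
  have h5 : t * (G s₀ - C * (t * (s - s₀) ^ 2)) ≤ t * G s := by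
    have : (1 - t) * s₀ + t * s - s₀ = t * (s - s₀) := by ring
    rw [this] at h4
    nlinarith
  exact le_of_mul_le_mul_left h5 h2.1

/-- The hexagonal theta function attains its minimum at the deep hole. -/
theorem hexSum_hole_le {c : ℝ} (hc : 0 < c) (z : ℝ × ℝ) :
    hexSum c (1 / 3, 1 / 3) ≤ hexSum c z := by
  obtain ⟨φ, hφ, hφpos, hφs, hφv⟩ := exists_thetaLike_gauss hc
  obtain ⟨ψ, hψ, hψpos, hψs, hψv⟩ := exists_thetaLike_gauss (c := 3 * c) (by positivity)
  have hF : ∀ z : ℝ × ℝ, hexSum c z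
      = φ (cos (2 * π * (z.1 + z.2 / 2))) * ψ (cos (π * z.2))
        + φ (-cos (2 * π * (z.1 + z.2 / 2))) * ψ (-cos (π * z.2)) := by
    intro z
    rw [hexSum_eq_rectangular hc, hφv, hψv, hφv, hψv]
    rw [show 2 * π * (z.1 + z.2 / 2 + 1 / 2) = 2 * π * (z.1 + z.2 / 2) + π by ring,
      show 2 * π * (z.2 / 2 + 1 / 2) = π * z.2 + π by ring,
      show 2 * π * (z.2 / 2) = π * z.2 by ring, cos_add_pi, cos_add_pi]
  set G : ℝ → ℝ := fun s => φ (-1) * ψ s + φ 1 * ψ (-s) with hG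
  have hφ1 : 0 < φ (-1) := hφpos _ ⟨le_rfl, by norm_num⟩
  have hφ2 : 0 < φ 1 := hφpos _ ⟨by norm_num, le_rfl⟩
  have hline : ∀ h : ℝ, hexSum c (1 / 3 - h, 1 / 3 + 2 * h) = G (cos (π / 3 + 2 * π * h)) := by
    intro h
    rw [hF, hG]
    simp only
    rw [show 2 * π * (1 / 3 - h + (1 / 3 + 2 * h) / 2) = π by ring,
      show π * (1 / 3 + 2 * h) = π / 3 + 2 * π * h by ring, cos_pi, neg_neg]
  have hhole : hexSum c (1 / 3, 1 / 3) = G (1 / 2) := by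
    have := hline 0
    rwa [mul_zero, mul_zero, add_zero, add_zero, sub_zero, cos_pi_div_three] at this
  have hGc : ConvexOn ℝ (Set.Icc (-1) 1) G := by
    have h1 : ConvexOn ℝ (Set.Icc (-1 : ℝ) 1) fun s => ψ (-s) := by
      refine ⟨convex_Icc _ _, fun s hs t ht u v hu hv huv => ?_⟩
      have := hψ.convex.2 (x := -s) (y := -t) ⟨by linarith [hs.2], by linarith [hs.1]⟩
        ⟨by linarith [ht.2], by linarith [ht.1]⟩ hu hv huv
      refine le_trans (le_of_eq ?_) this
      simp only [smul_eq_mul]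
      ring_nf
    exact (hψ.convex.smul hφ1.le).add (h1.smul hφ2.le)
  have hGmin : ∀ s ∈ Set.Icc (-1 : ℝ) 1, G (1 / 2) ≤ G s := by
    obtain ⟨K, hK⟩ := (hasDerivAt_arccos (x := 1 / 2) (by norm_num)
      (by norm_num)).isBigO_sub.bound
    refine fun s hs => hGc.le_of_quadratic_lower_bound
      (C := G (1 / 2) * (3 * c) * (K / (2 * π)) ^ 2) (by constructor <;> norm_num) ?_ hs
    filter_upwards [hK] with t ht htS
    have h13 : arccos (1 / 2) = π / 3 := by
      rw [← cos_pi_div_three, arccos_cos] <;> linarith [pi_pos]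
    rw [h13, norm_eq_abs, norm_eq_abs] at ht
    have h1 := hexSum_near_hole hc ((arccos t - π / 3) / (2 * π))
    rw [hline, hhole, mul_div_cancel₀ _ (by positivity), add_sub_cancel,
      cos_arccos htS.1 htS.2] at h1
    refine le_trans ?_ h1
    have h2 : (arccos t - π / 3) ^ 2 ≤ K ^ 2 * (t - 1 / 2) ^ 2 := by
      rw [← sq_abs (arccos t - π / 3), ← sq_abs (t - 1 / 2), ← mul_pow]
      exact pow_le_pow_left₀ (abs_nonneg _) ht 2
    have h3 : 0 ≤ G (1 / 2) * (3 * c) / (2 * π) ^ 2 := by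
      rw [← hhole]
      have : 0 ≤ hexSum c (1 / 3, 1 / 3) := tsum_nonneg fun _ => (exp_pos _).le
      positivity
    have h4 := mul_le_mul_of_nonneg_left h2 h3
    rw [div_pow, div_pow]
    have e1 : G (1 / 2) * (3 * c) / (2 * π) ^ 2 * (arccos t - π / 3) ^ 2
      = G (1 / 2) * (3 * c * ((arccos t - π / 3) ^ 2 / (2 * π) ^ 2)) := by ring
    have e2 : G (1 / 2) * (3 * c) / (2 * π) ^ 2 * (K ^ 2 * (t - 1 / 2) ^ 2)
      = G (1 / 2) * (3 * c) * (K ^ 2 / (2 * π) ^ 2) * (t - 1 / 2) ^ 2 := by ring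
    linarith
  have hcmp1 : ∀ D, 1 / 2 < D → D ≤ 1 → φ 1 * ψ (-D) ≤ φ (-1) * ψ (1 / 2) := by
    intro D hD hD1
    have h1 := hGmin D ⟨by linarith, hD1⟩
    simp only [hG] at h1
    have h2 := hψ.anti (1 / 2) D (by norm_num) hD.le hD1
    have h3 : ψ (-D) < ψ (-(1 / 2)) := hψs ⟨by linarith, by linarith⟩
      ⟨by norm_num, by norm_num⟩ (by linarith)
    have h4 : 0 < ψ (-D) := hψpos _ ⟨by linarith, by linarith⟩
    have h5 : φ 1 * ψ (-D) * (ψ (-(1 / 2)) - ψ (-D))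
        ≤ φ (-1) * ψ (1 / 2) * (ψ (-(1 / 2)) - ψ (-D)) := by
      have h6 := mul_le_mul_of_nonneg_left h1 h4.le
      have h7 := mul_le_mul_of_nonneg_left h2 hφ1.le
      linarith
    exact le_of_mul_le_mul_right h5 (by linarith)
  have hcmp2 : φ 1 * ψ (-(1 / 2)) ≤ φ (-1) * ψ (1 / 2) := by
    have hlim : Tendsto (fun t : ℝ => (1 - t) * (φ (-1) * ψ (1 / 2)) + t * (φ 1 * ψ 0)) (𝓝[>] 0)
        (𝓝 (φ (-1) * ψ (1 / 2))) := by
      have : Tendsto (fun t : ℝ => (1 - t) * (φ (-1) * ψ (1 / 2)) + t * (φ 1 * ψ 0)) (𝓝 0)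
          (𝓝 ((1 - 0) * (φ (-1) * ψ (1 / 2)) + 0 * (φ 1 * ψ 0))) := by
        apply Continuous.tendsto
        fun_prop
      simp only [sub_zero, one_mul, zero_mul, add_zero] at this
      exact this.mono_left nhdsWithin_le_nhds
    refine ge_of_tendsto hlim ?_
    filter_upwards [Ioo_mem_nhdsGT (show (0 : ℝ) < 1 / 2 by norm_num)] with t ht
    have h1t : 0 < 1 - t := by linarith [ht.2]
    have hD1 : 1 / 2 < 1 / (2 * (1 - t)) := by
      rw [div_lt_div_iff₀ (by norm_num) (by positivity)]; linarith [ht.1]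
    have hD2 : 1 / (2 * (1 - t)) ≤ 1 := by
      rw [div_le_one (by positivity)]; linarith [ht.2]
    have h1 := hψ.convex.2 (x := -(1 / (2 * (1 - t)))) (y := 0)
      ⟨by linarith, by linarith⟩ ⟨by norm_num, by norm_num⟩ h1t.le ht.1.le (by ring)
    simp only [smul_eq_mul, mul_zero, add_zero] at h1
    rw [show (1 - t) * -(1 / (2 * (1 - t))) = -(1 / 2) by field_simp] at h1
    have h2 := mul_le_mul_of_nonneg_left (hcmp1 _ hD1 hD2) h1t.le
    have h3 := mul_le_mul_of_nonneg_left h1 hφ2.le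
    linarith
  have hmain : ∀ C ∈ Set.Icc (-1 : ℝ) 1, ∀ D, 1 / 2 ≤ D → D ≤ 1 →
      G (1 / 2) ≤ φ C * ψ D + φ (-C) * ψ (-D) := by
    intro C hC D hD hD1
    have hle : φ 1 * ψ (-D) ≤ φ (-1) * ψ D := by
      have h1 : ψ (1 / 2) ≤ ψ D := hψ.mono ⟨by norm_num, by norm_num⟩ ⟨by linarith, hD1⟩ hD
      rcases hD.lt_or_eq with h | h
      · exact (hcmp1 D h hD1).trans (mul_le_mul_of_nonneg_left h1 hφ1.le)
      · rw [← h]; exact hcmp2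
    refine (hGmin D ⟨by linarith, hD1⟩).trans ?_
    simp only [hG]
    have hC1 : φ (-1) ≤ φ C := hφ.mono ⟨le_rfl, by norm_num⟩ hC hC.1
    have hC0 : 0 < φ C := hφpos C hC
    have hprod : φ 1 * φ (-1) ≤ φ C * φ (-C) := by
      rcases le_total 0 C with h | h
      · exact hφ.anti C 1 h hC.2 le_rfl
      · have := hφ.anti (-C) 1 (by linarith) (by linarith [hC.1]) le_rfl
        rw [neg_neg] at this
        linarith
    have hψD : 0 ≤ ψ (-D) := hψ.nonneg _ ⟨by linarith, by linarith⟩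
    have h2 : 0 ≤ (φ C - φ (-1)) * (φ (-1) * ψ D - φ 1 * ψ (-D)) :=
      mul_nonneg (by linarith) (by linarith)
    have hψD' : 0 ≤ ψ D := hψ.nonneg _ ⟨by linarith, hD1⟩
    have h3 : 0 ≤ (φ C - φ (-1)) * ((φ C - φ (-1)) * ψ D) :=
      mul_nonneg (by linarith) (mul_nonneg (by linarith) hψD')
    have h4 := mul_le_mul_of_nonneg_right hprod hψD
    have h5 : φ C * (φ (-1) * ψ D + φ 1 * ψ (-D)) ≤ φ C * (φ C * ψ D + φ (-C) * ψ (-D)) := by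
      nlinarith
    exact le_of_mul_le_mul_left h5 hC0
  have hany : ∀ z : ℝ × ℝ, 1 / 2 ≤ |cos (π * z.2)| → G (1 / 2) ≤ hexSum c z := by
    intro z hz
    rw [hF]
    rcases le_abs.1 hz with h | h
    · exact hmain _ ⟨neg_one_le_cos _, cos_le_one _⟩ _ h (cos_le_one _)
    · have := hmain (-cos (2 * π * (z.1 + z.2 / 2)))
        ⟨by linarith [cos_le_one (2 * π * (z.1 + z.2 / 2))],
          by linarith [neg_one_le_cos (2 * π * (z.1 + z.2 / 2))]⟩ _ h
        (by linarith [neg_one_le_cos (π * z.2)])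
      rw [neg_neg, neg_neg] at this
      linarith
  rw [hhole]
  by_cases h1 : 1 / 2 ≤ |cos (π * z.2)|
  · exact hany z h1
  by_cases h2 : 1 / 2 ≤ |cos (π * z.1)|
  · rw [← hexSum_swap]
    exact hany (z.2, z.1) h2
  · rw [← hexSum_rot, ← hexSum_swap]
    refine hany _ ?_
    simp only
    rw [show π * (-z.1 - z.2) = -(π * z.1 + π * z.2) by ring, cos_neg, cos_add]
    push Not at h1 h2
    rw [abs_lt] at h1 h2
    have s1 := sin_sq_add_cos_sq (π * z.1)
    have s2 := sin_sq_add_cos_sq (π * z.2)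
    set a := cos (π * z.1)
    set b := cos (π * z.2)
    set s := sin (π * z.1)
    set t := sin (π * z.2)
    have ha : a ^ 2 < 1 / 4 := by nlinarith
    have hb : b ^ 2 < 1 / 4 := by nlinarith
    have hab : |a * b| ≤ 1 / 4 := by
      rw [abs_le]; constructor <;> nlinarith [sq_nonneg (a - b), sq_nonneg (a + b)]
    have hst : 3 / 4 ≤ |s * t| := by
      refine abs_le_of_sq_le_sq' ?_ (abs_nonneg _) |>.2
      rw [sq_abs, mul_pow]
      nlinarith
    have := abs_sub_abs_le_abs_sub (s * t) (a * b)
    rw [abs_sub_comm] at this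
    linarith

end Hexagonal

section Tools

theorem hasSum_pow_natAbs {r : ℝ} (h0 : 0 ≤ r) (h1 : r < 1) :
    HasSum (fun n : ℤ => r ^ n.natAbs) ((1 + r) / (1 - r)) := by
  have hg := hasSum_geometric_of_lt_one h0 h1
  have h : HasSum (fun n : ℤ => r ^ n.natAbs) ((1 - r)⁻¹ + r * (1 - r)⁻¹) := by
    refine HasSum.of_nat_of_neg_add_one (by simpa using hg) ?_
    refine (hg.mul_left r).congr_fun ?_
    intro n
    rw [show (-((n : ℤ) + 1)).natAbs = n + 1 by omega, pow_succ, mul_comm]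
  convert h using 1
  field_simp

theorem hasSum_pow_natAbs_prod {r : ℝ} (h0 : 0 ≤ r) (h1 : r < 1) :
    HasSum (fun p : ℤ × ℤ => r ^ p.1.natAbs * r ^ p.2.natAbs) (((1 + r) / (1 - r)) ^ 2) := by
  have h := hasSum_pow_natAbs h0 h1
  rw [sq]
  have hn : 0 ≤ fun n : ℤ => r ^ n.natAbs := fun n => pow_nonneg h0 _
  exact HasSum.mul (f := fun n : ℤ => r ^ n.natAbs) (g := fun n : ℤ => r ^ n.natAbs) h h
    (h.summable.mul_of_nonneg h.summable hn hn)

theorem tsum_le_finset_add_geometric {f : ℤ × ℤ → ℝ} (hf : Summable f) (F : Finset (ℤ × ℤ))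
    {K r : ℝ} (hK : 0 ≤ K) (h0 : 0 ≤ r) (h1 : r < 1)
    (h : ∀ p ∉ F, f p ≤ K * (r ^ p.1.natAbs * r ^ p.2.natAbs)) :
    ∑' p, f p ≤ ∑ p ∈ F, f p + K * ((1 + r) / (1 - r)) ^ 2 := by
  have s1 : HasSum (fun p => if p ∈ F then f p else 0) (∑ p ∈ F, f p) := by
    have h2 : HasSum (fun p => if p ∈ F then f p else 0) (∑ p ∈ F, if p ∈ F then f p else 0) :=
      hasSum_sum_of_ne_finset_zero fun p hp => if_neg hp
    rwa [Finset.sum_congr rfl fun p hp => if_pos hp] at h2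
  refine hasSum_le (fun p => ?_) hf.hasSum (s1.add ((hasSum_pow_natAbs_prod h0 h1).mul_left K))
  by_cases hp : p ∈ F
  · rw [if_pos hp]
    have : 0 ≤ K * (r ^ p.1.natAbs * r ^ p.2.natAbs) := by positivity
    linarith
  · rw [if_neg hp, zero_add]
    exact h p hp

theorem exp_neg_sq_le_pow_natAbs {b : ℝ} (hb : 0 ≤ b) (n : ℤ) :
    exp (-(b * (n : ℝ) ^ 2)) ≤ exp (-b) ^ n.natAbs := by
  rw [← exp_nat_mul, exp_le_exp]
  have h : (n.natAbs : ℝ) ≤ (n : ℝ) ^ 2 := by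
    rw [Nat.cast_natAbs]
    have : |n| ≤ n ^ 2 := by
      rw [← sq_abs]
      nlinarith [abs_nonneg n, sq_nonneg (|n| - 1), Int.le_self_sq |n|]
    exact_mod_cast this
  nlinarith

theorem exp_neg_sq_add_sq_le_pow {b : ℝ} (hb : 0 ≤ b) (p : ℤ × ℤ) :
    exp (-(b * ((p.1 : ℝ) ^ 2 + (p.2 : ℝ) ^ 2))) ≤
      exp (-b) ^ p.1.natAbs * exp (-b) ^ p.2.natAbs := by
  rw [mul_add, neg_add, exp_add]
  exact mul_le_mul (exp_neg_sq_le_pow_natAbs hb _) (exp_neg_sq_le_pow_natAbs hb _)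
    (exp_pos _).le (by positivity)

theorem exp_neg_le_of_one_le {t u : ℝ} (n : ℕ) (hn : 0 < n) (ht : 0 ≤ t)
    (h : 1 ≤ u * (1 + t / n) ^ n) : exp (-t) ≤ u := by
  have h1 : (1 + t / n) ^ n ≤ exp t := by
    calc (1 + t / n) ^ n ≤ exp (t / n) ^ n := by
          gcongr
          linarith [add_one_le_exp (t / n)]
      _ = exp t := by
          rw [← exp_nat_mul]
          congr 1
          field_simp
  have hu : 0 < u := by
    by_contra hu
    have : 0 < (1 + t / n) ^ n := by positivity
    nlinarith
  rw [exp_neg, inv_le_comm₀ (exp_pos _) hu]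
  calc u⁻¹ ≤ (1 + t / n) ^ n := by rw [inv_le_iff_one_le_mul₀ hu, mul_comm]; exact h
    _ ≤ _ := h1

theorem exp_le_of_le_mul {t u : ℝ} (n : ℕ) (ht : t < n) (h : 1 ≤ u * (1 - t / n) ^ n) :
    exp t ≤ u := by
  have hn : (0 : ℝ) ≤ n := n.cast_nonneg
  rcases n.eq_zero_or_pos with rfl | hn
  · simp only [CharP.cast_eq_zero, pow_zero, mul_one] at *
    exact (exp_le_one_iff.2 ht.le).trans h
  have hn' : (0 : ℝ) < n := by exact_mod_cast hn
  have h0 : 0 < 1 - t / n := by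
    rw [sub_pos, div_lt_one hn']
    exact ht
  have h1 : (1 - t / n) ^ n ≤ exp (-t) := by
    calc (1 - t / n) ^ n ≤ exp (-(t / n)) ^ n := by
          gcongr
          linarith [add_one_le_exp (-(t / n))]
      _ = exp (-t) := by
          rw [← exp_nat_mul]
          congr 1
          field_simp
  have hu : 0 < u := by
    by_contra hu
    have : 0 < (1 - t / n) ^ n := by positivity
    nlinarith
  have h2 : 1 ≤ u * exp (-t) := h.trans (mul_le_mul_of_nonneg_left h1 hu.le)
  rw [exp_neg] at h2
  rwa [← div_eq_mul_inv, one_le_div (exp_pos _)] at h2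

theorem cos_two_pi_mul_int_div_three (n : ℤ) :
    cos (2 * π * (n * (1 / 3))) = if (3 : ℤ) ∣ n then 1 else -(1 / 2) := by
  have hc : cos (2 * π * (1 / 3)) = -(1 / 2) := by
    rw [show 2 * π * (1 / 3) = π - π / 3 by ring, cos_pi_sub, cos_pi_div_three]
  obtain ⟨j, rfl | rfl | rfl⟩ : ∃ j : ℤ, n = 3 * j ∨ n = 3 * j + 1 ∨ n = 3 * j - 1 :=
    ⟨(n + 1) / 3, by omega⟩
  · rw [if_pos ⟨j, rfl⟩]
    exact (congrArg cos (by push_cast; ring)).trans (cos_int_mul_two_pi j)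
  · rw [if_neg (by omega), ← hc, ← cos_add_int_mul_two_pi (2 * π * (1 / 3)) j]
    congr 1; push_cast; ring
  · rw [if_neg (by omega), ← hc, ← cos_neg (2 * π * (1 / 3)),
      ← cos_add_int_mul_two_pi (-(2 * π * (1 / 3))) j]
    congr 1; push_cast; ring

end Tools

section Average

open MeasureTheory

theorem integral_cos_int (n : ℤ) (φ : ℝ) :
    ∫ t in (0 : ℝ)..1, cos (2 * π * (n * t + φ)) = if n = 0 then cos (2 * π * φ) else 0 := by
  by_cases hn : n = 0
  · simp [hn]
  · rw [if_neg hn]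
    have hn' : (n : ℝ) ≠ 0 := by exact_mod_cast hn
    have h : ∀ t ∈ Set.uIcc (0 : ℝ) 1, HasDerivAt
        (fun t : ℝ => sin (2 * π * (n * t + φ)) / (2 * π * n)) (cos (2 * π * (n * t + φ))) t := by
      intro t _
      have h1 : HasDerivAt (fun t : ℝ => 2 * π * (n * t + φ)) (2 * π * n) t := by
        simpa using (((hasDerivAt_id t).const_mul (n : ℝ)).add_const φ).const_mul (2 * π)
      have h2 := h1.sin.div_const (2 * π * n)
      rwa [mul_div_cancel_right₀ _ (mul_ne_zero two_pi_pos.ne' hn')] at h2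
    rw [intervalIntegral.integral_eq_sub_of_hasDerivAt h
      (Continuous.intervalIntegrable (by fun_prop) _ _)]
    have : sin (2 * π * (n * 1 + φ)) = sin (2 * π * (n * 0 + φ)) := by
      rw [← sin_add_int_mul_two_pi (2 * π * (n * 0 + φ)) n]
      congr 1; ring
    rw [this, sub_self]

theorem iInf_latticeTheta_le_average (x : ℝ) {y : ℝ} (hy : 0 < y) {α : ℝ} (hα : 0 < α) :
    ⨅ z, latticeTheta x y z α ≤
      1 / α * ∑' n : ℤ, exp (-π / (α * y) * (n : ℝ) ^ 2) * cos (2 * π * (n * (1 / 2))) := by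
  set w : ℤ × ℤ → ℝ := fun p =>
    exp (-(π / α) * (((p.1 : ℝ) - p.2 * x) ^ 2 / y + y * (p.2 : ℝ) ^ 2)) with hw
  have hws : Summable w := by
    obtain ⟨c, C, hc, h⟩ := exists_form_ge (-x) hy (0, 0) (κ := π / α / y) (by positivity)
    refine (summable_exp_neg_of_le hc h).congr fun p => ?_
    simp only [hw]
    congr 1
    field_simp
    ring
  set f : ℤ × ℤ → C(ℝ, ℝ) := fun p =>
    ⟨fun t => w p * cos (2 * π * (p.2 * t + p.1 * (1 / 2))), by fun_prop⟩ with hf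
  have hfn : ∀ p t, |f p t| ≤ w p := fun p t => by
    simp only [hf, ContinuousMap.coe_mk, abs_mul]
    rw [abs_of_pos (exp_pos _)]
    exact mul_le_of_le_one_right (exp_pos _).le (abs_cos_le_one _)
  have hs : Summable fun p : ℤ × ℤ =>
      ‖(f p).restrict (⟨Set.uIcc 0 1, isCompact_uIcc⟩ : TopologicalSpace.Compacts ℝ)‖ := by
    refine hws.of_nonneg_of_le (fun _ => norm_nonneg _) fun p => ?_
    rw [ContinuousMap.norm_le _ (exp_pos _).le]
    exact fun t => hfn p t
  have hintegral := intervalIntegral.hasSum_intervalIntegral_of_summable_norm hs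
  have hθ : ∀ t, ∑' p, f p t = α * latticeTheta x y (t, 1 / 2) α := fun t => by
    rw [latticeTheta_eq_fourier x hy _ hα, ← mul_assoc, mul_one_div_cancel hα.ne', one_mul]
    rfl
  have hcont : Continuous fun t => ∑' p, f p t :=
    continuous_tsum (fun p => (f p).continuous) hws hfn
  set m := ⨅ z, latticeTheta x y z α with hm
  have h1 : α * m ≤ ∫ t in (0 : ℝ)..1, ∑' p, f p t := by
    have : ∫ _ in (0 : ℝ)..1, α * m ≤ ∫ t in (0 : ℝ)..1, ∑' p, f p t := by
      refine intervalIntegral.integral_mono_on zero_le_one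
        (continuous_const.intervalIntegrable _ _) (hcont.intervalIntegrable _ _) fun t _ => ?_
      rw [hθ]
      exact mul_le_mul_of_nonneg_left (ciInf_le (bddBelow_range_latticeTheta x y α) _) hα.le
    simpa using this
  have h2 : ∫ t in (0 : ℝ)..1, ∑' p, f p t =
      ∑' n : ℤ, exp (-π / (α * y) * (n : ℝ) ^ 2) * cos (2 * π * (n * (1 / 2))) := by
    rw [← hintegral.tsum_eq]
    have hfi : ∀ p : ℤ × ℤ, ∫ t in (0 : ℝ)..1, f p t =
        if p.2 = 0 then w p * cos (2 * π * (p.1 * (1 / 2))) else 0 := fun p => by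
      simp only [hf, ContinuousMap.coe_mk, intervalIntegral.integral_const_mul, integral_cos_int]
      split_ifs <;> simp
    simp only [hfi]
    have hinj : Function.Injective fun n : ℤ => (n, (0 : ℤ)) := fun a b h => by
      simpa using h
    rw [← hinj.tsum_eq]
    · refine tsum_congr fun n => ?_
      simp only [if_true, hw]
      congr 2
      field_simp
      simp
    · intro p hp
      rw [Function.mem_support] at hp
      by_contra hr
      refine hp (if_neg fun h0 => hr ⟨p.1, ?_⟩)
      rw [← h0]
  rw [h2] at h1
  rw [one_div, ← div_eq_inv_mul, le_div_iff₀ hα]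
  linarith

end Average

section AverageBounds

theorem tsum_half_le {g : ℝ} (hg : 1 ≤ g) :
    ∑' l : ℤ, exp (-π * g * ((l : ℝ) + 1 / 2) ^ 2) ≤ 2.01 * exp (-(π * g / 4)) := by
  set r := exp (-(2 * π * g)) with hr
  have hr0 : 0 < r := exp_pos _
  have hr1 : r ≤ 0.004 := by
    refine (exp_le_exp.2 (?_ : -(2 * π * g) ≤ -6)).trans
      (exp_neg_le_of_one_le 60 (by norm_num) (by norm_num) (by norm_num))
    nlinarith [pi_gt_three]
  have hgeo := (hasSum_geometric_of_lt_one hr0.le (by linarith)).mul_left (exp (-(π * g / 4)))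
  have hb : ∀ n : ℕ, exp (-π * g * ((n : ℝ) + 1 / 2) ^ 2) ≤ exp (-(π * g / 4)) * r ^ n := by
    intro n
    rw [hr, ← exp_nat_mul, ← exp_add, exp_le_exp]
    have h1 : (0 : ℝ) ≤ n ^ 2 - n := by
      rcases n.eq_zero_or_pos with rfl | h
      · simp
      · have : (1 : ℝ) ≤ n := by exact_mod_cast h
        nlinarith
    have : 0 < π * g := by positivity
    nlinarith
  have hs : Summable fun n : ℕ => exp (-π * g * ((n : ℝ) + 1 / 2) ^ 2) :=
    hgeo.summable.of_nonneg_of_le (fun _ => (exp_pos _).le) hb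
  have hle := hasSum_le hb hs.hasSum hgeo
  have h2 : HasSum (fun l : ℤ => exp (-π * g * ((l : ℝ) + 1 / 2) ^ 2))
      (∑' n : ℕ, exp (-π * g * ((n : ℝ) + 1 / 2) ^ 2) +
        ∑' n : ℕ, exp (-π * g * ((n : ℝ) + 1 / 2) ^ 2)) := by
    refine HasSum.of_nat_of_neg_add_one (by simpa using hs.hasSum) ?_
    refine hs.hasSum.congr_fun fun n => ?_
    push_cast
    congr 1
    ring
  rw [h2.tsum_eq]
  have h3 : (1 - r)⁻¹ ≤ 1.005 := by
    rw [inv_le_comm₀ (by linarith) (by norm_num)]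
    linarith [show (1.005 : ℝ)⁻¹ ≤ 0.996 by norm_num]
  nlinarith [exp_pos (-(π * g / 4))]

theorem tsum_alternating_le {A : ℝ} (g : ℝ) (hA : A = exp (-π / g)) (hA1 : A ≤ 1 / 8) :
    ∑' n : ℤ, exp (-π / g * (n : ℝ) ^ 2) * cos (2 * π * (n * (1 / 2))) ≤ 1 - 1.99 * A := by
  have hA0 : 0 < A := hA ▸ exp_pos _
  have hg : -π / g ≤ 0 := by
    by_contra h
    push Not at h
    linarith [add_one_le_exp (-π / g)]
  have hpow : ∀ n : ℤ, exp (-π / g * (n : ℝ) ^ 2) ≤ A ^ n.natAbs := by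
    intro n
    have := exp_neg_sq_le_pow_natAbs (b := -(-π / g)) (by linarith) n
    rwa [neg_neg, ← hA, ← neg_mul, neg_neg] at this
  have hs : Summable fun n : ℤ => exp (-π / g * (n : ℝ) ^ 2) * cos (2 * π * (n * (1 / 2))) := by
    refine (hasSum_pow_natAbs hA0.le (by linarith)).summable.of_norm_bounded fun n => ?_
    rw [norm_mul, Real.norm_eq_abs, Real.norm_eq_abs, abs_of_pos (exp_pos _)]
    exact (mul_le_of_le_one_right (exp_pos _).le (abs_cos_le_one _)).trans (hpow n)
  set F : Finset ℤ := {0, 1, -1} with hF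
  set f : ℤ → ℝ := fun n => exp (-π / g * (n : ℝ) ^ 2) * cos (2 * π * (n * (1 / 2))) with hf
  have h1 : ∑' n : ℤ, f n ≤ (1 - A - A - A ^ 2 * (1 + A + A)) + A ^ 2 * ((1 + A) / (1 - A)) := by
    have s1 : HasSum (fun n : ℤ => if n ∈ F then f n - A ^ 2 * A ^ n.natAbs else 0)
        (1 - A - A - A ^ 2 * (1 + A + A)) := by
      have h2 : HasSum (fun n : ℤ => if n ∈ F then f n - A ^ 2 * A ^ n.natAbs else 0)
        (∑ n ∈ F, if n ∈ F then f n - A ^ 2 * A ^ n.natAbs else 0) :=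
        hasSum_sum_of_ne_finset_zero fun p hp => if_neg hp
      convert h2 using 1
      rw [Finset.sum_congr rfl fun p hp => if_pos hp, hF, Finset.sum_insert (by decide),
        Finset.sum_insert (by decide), Finset.sum_singleton]
      have e1 : 2 * π * (((1 : ℤ) : ℝ) * (1 / 2)) = π := by push_cast; ring
      have e2 : 2 * π * (((-1 : ℤ) : ℝ) * (1 / 2)) = -π := by push_cast; ring
      simp only [hf]
      rw [e1, e2, cos_neg, cos_pi]
      simp only [Int.cast_zero, Int.cast_one, Int.cast_neg, even_two, Even.neg_pow, one_pow,
        mul_one, zero_mul, mul_zero, cos_zero, Int.natAbs_zero, Int.natAbs_one, Int.natAbs_neg,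
        ne_eq, OfNat.ofNat_ne_zero, not_false_eq_true, zero_pow, exp_zero, pow_zero, pow_one, ← hA]
      ring
    refine hasSum_le (fun n => ?_) hs.hasSum
      (s1.add ((hasSum_pow_natAbs hA0.le (by linarith)).mul_left (A ^ 2)))
    by_cases hn : n ∈ F
    · rw [if_pos hn]
      simp only [hf]
      linarith
    · rw [if_neg hn, zero_add]
      refine (mul_le_of_le_one_right (exp_pos _).le (cos_le_one _)).trans ?_
      rw [← pow_add, hA, ← exp_nat_mul, exp_le_exp]
      have h2 : 2 ≤ n.natAbs := by
        simp only [hF, Finset.mem_insert, Finset.mem_singleton] at hn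
        omega
      have h3 : ((2 + n.natAbs : ℕ) : ℝ) ≤ (n : ℝ) ^ 2 := by
        have h4 : (n.natAbs : ℝ) ^ 2 = (n : ℝ) ^ 2 := by
          rw [Nat.cast_natAbs, Int.cast_abs, sq_abs]
        have h5 : (2 : ℝ) ≤ n.natAbs := by exact_mod_cast h2
        push_cast
        nlinarith
      nlinarith
  refine h1.trans ?_
  have h4 : A ^ 2 * ((1 + A) / (1 - A)) = A ^ 2 * (1 + A + A) + 2 * A ^ 4 / (1 - A) := by
    field_simp [show (1 - A) ≠ 0 by linarith]
    ring
  have h5 : 2 * A ^ 4 / (1 - A) ≤ 0.005 * A := by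
    rw [div_le_iff₀ (by linarith)]
    have : A ^ 3 ≤ (1 / 8) ^ 3 := pow_le_pow_left₀ hA0.le hA1 3
    nlinarith
  linarith

end AverageBounds

section HoleBounds

theorem sqrt_three_gt : 1.7320 < √3 := by
  rw [Real.lt_sqrt (by norm_num)]; norm_num

theorem sqrt_three_lt : √3 < 1.7321 := by
  rw [Real.sqrt_lt' (by norm_num)]; norm_num

theorem three_mul_exp_le_hexSum_hole {c : ℝ} (hc : 0 < c) :
    3 * exp (-(c / 3)) ≤ hexSum c (1 / 3, 1 / 3) := by
  have h := (summable_hexSum hc (1 / 3, 1 / 3)).sum_le_tsum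
    ({(0, 0), (-1, 0), (0, -1)} : Finset (ℤ × ℤ)) fun _ _ => (exp_pos _).le
  refine le_trans (le_of_eq ?_) h
  rw [Finset.sum_insert (by decide), Finset.sum_insert (by decide), Finset.sum_singleton]
  push_cast
  ring_nf

theorem latticeTheta_hex_eq_fourier {α : ℝ} (hα : 0 < α) :
    latticeTheta (1 / 2) (√3 / 2) (1 / 3, 1 / 3) α = 1 / α * ∑' p : ℤ × ℤ,
      exp (-(π / α * (2 / √3) * ((p.1 : ℝ) ^ 2 - p.1 * p.2 + (p.2 : ℝ) ^ 2))) *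
        if (3 : ℤ) ∣ p.1 + p.2 then 1 else -(1 / 2) := by
  rw [latticeTheta_eq_fourier _ (by positivity) _ hα]
  congr 1
  refine tsum_congr fun p => ?_
  rw [← cos_two_pi_mul_int_div_three]
  congr 2
  · have h := sqrt_three_sq
    field_simp
    rw [h]
    ring
  · push_cast
    ring

theorem summable_hexDual {a : ℝ} (ha : 0 < a) :
    Summable fun p : ℤ × ℤ => exp (-(a * ((p.1 : ℝ) ^ 2 - p.1 * p.2 + (p.2 : ℝ) ^ 2))) := by
  refine summable_exp_neg_of_le (c := a / 2) (C := 0) (by positivity) fun p => ?_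
  nlinarith [mul_nonneg ha.le (sq_nonneg ((p.1 : ℝ) - p.2))]

theorem le_hexDual {a : ℝ} (ha : 4 ≤ a) :
    1 - 3.02 * exp (-a) ≤ ∑' p : ℤ × ℤ,
      exp (-(a * ((p.1 : ℝ) ^ 2 - p.1 * p.2 + (p.2 : ℝ) ^ 2))) *
        if (3 : ℤ) ∣ p.1 + p.2 then 1 else -(1 / 2) := by
  have ha0 : 0 < a := by linarith
  set q := exp (-a) with hq
  set f : ℤ × ℤ → ℝ := fun p => -(exp (-(a * ((p.1 : ℝ) ^ 2 - p.1 * p.2 + (p.2 : ℝ) ^ 2))) *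
        if (3 : ℤ) ∣ p.1 + p.2 then 1 else -(1 / 2)) with hf
  have hs : Summable f := by
    refine (summable_hexDual ha0).of_norm_bounded fun p => ?_
    rw [hf, norm_neg, norm_mul, Real.norm_eq_abs, abs_of_pos (exp_pos _)]
    refine mul_le_of_le_one_right (exp_pos _).le ?_
    split_ifs <;> norm_num
  set F : Finset (ℤ × ℤ) := {(0, 0), (1, 0), (-1, 0), (0, 1), (0, -1), (1, 1), (-1, -1)} with hF
  have h := tsum_le_finset_add_geometric hs F (K := q ^ 3) (r := exp (-(a / 8)))
    (by positivity) (exp_pos _).le (by rw [exp_lt_one_iff]; linarith) fun p hp => by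
      by_cases h3 : (3 : ℤ) ∣ p.1 + p.2
      · simp only [hf, if_pos h3]
        have := exp_pos (-(a * ((p.1 : ℝ) ^ 2 - p.1 * p.2 + (p.2 : ℝ) ^ 2)))
        have : 0 ≤ q ^ 3 * (exp (-(a / 8)) ^ p.1.natAbs * exp (-(a / 8)) ^ p.2.natAbs) := by
          positivity
        linarith
      · simp only [hf, if_neg h3]
        have h4 : 4 ≤ p.1 ^ 2 - p.1 * p.2 + p.2 ^ 2 := by
          obtain ⟨m, k⟩ := p
          by_contra hlt
          push Not at hlt
          have hm1 : m < 3 := by nlinarith [sq_nonneg (m - 2 * k)]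
          have hm2 : -3 < m := by nlinarith [sq_nonneg (m - 2 * k)]
          have hk1 : k < 3 := by nlinarith [sq_nonneg (k - 2 * m)]
          have hk2 : -3 < k := by nlinarith [sq_nonneg (k - 2 * m)]
          interval_cases m <;> interval_cases k <;> revert hp hlt h3 <;> decide
        have h4' : (4 : ℝ) ≤ (p.1 : ℝ) ^ 2 - p.1 * p.2 + (p.2 : ℝ) ^ 2 := by exact_mod_cast h4
        have h5 := exp_neg_sq_add_sq_le_pow (b := a / 8) (by linarith) p
        have h6 : exp (-(a * ((p.1 : ℝ) ^ 2 - p.1 * p.2 + (p.2 : ℝ) ^ 2))) ≤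
            q ^ 3 * exp (-(a / 8 * ((p.1 : ℝ) ^ 2 + (p.2 : ℝ) ^ 2))) := by
          rw [hq, ← exp_nat_mul, ← exp_add, exp_le_exp]
          push_cast
          nlinarith [mul_nonneg ha0.le (sq_nonneg ((p.1 : ℝ) - p.2))]
        have h7 := mul_le_mul_of_nonneg_left h5 (by positivity : 0 ≤ q ^ 3)
        have := exp_pos (-(a * ((p.1 : ℝ) ^ 2 - p.1 * p.2 + (p.2 : ℝ) ^ 2)))
        linarith
  have hsum : ∑ p ∈ F, f p = -1 + 3 * q := by
    rw [hF]
    repeat rw [Finset.sum_insert (by decide)]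
    rw [Finset.sum_singleton]
    simp only [hf]
    norm_num
    rw [← hq]
    ring
  rw [hsum, tsum_neg] at h
  have hr : exp (-(a / 8)) ≤ 0.62 := by
    refine (exp_le_exp.2 (by linarith : -(a / 8) ≤ -(1 / 2))).trans
      (exp_neg_le_of_one_le 10 (by norm_num) (by norm_num) (by norm_num))
  have hq' : q ≤ 0.02 := by
    refine (exp_le_exp.2 (by linarith : -a ≤ -4)).trans
      (exp_neg_le_of_one_le 200 (by norm_num) (by norm_num) (by norm_num))
  have hg : (1 + exp (-(a / 8))) / (1 - exp (-(a / 8))) ≤ 4.27 := by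
    rw [div_le_iff₀ (by linarith)]
    linarith
  have hg0 : 0 ≤ (1 + exp (-(a / 8))) / (1 - exp (-(a / 8))) :=
    div_nonneg (by linarith [exp_pos (-(a / 8))]) (by linarith)
  have hg2 : ((1 + exp (-(a / 8))) / (1 - exp (-(a / 8)))) ^ 2 ≤ 4.27 ^ 2 := by gcongr
  have hq0 : 0 < q := exp_pos _
  have h8 : q ^ 3 * ((1 + exp (-(a / 8))) / (1 - exp (-(a / 8)))) ^ 2 ≤ q ^ 3 * 4.27 ^ 2 := by
    gcongr
  have h9 : q ^ 3 * 4.27 ^ 2 ≤ 0.0075 * q := by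
    have : q ^ 2 ≤ 0.02 ^ 2 := pow_le_pow_left₀ hq0.le (by linarith) 2
    nlinarith
  linarith

end HoleBounds

section AverageComparison

theorem iInf_latticeTheta_le_sqrt (x : ℝ) {y α : ℝ} (hy : 0 < y) (hα : 0 < α) (hg : 1 ≤ α * y) :
    ⨅ z, latticeTheta x y z α ≤ 1 / α * (√(α * y) * (2.01 * exp (-(π * (α * y) / 4)))) := by
  refine (iInf_latticeTheta_le_average x hy hα).trans ?_
  have h := tsum_gauss (by positivity : 0 < α * y) (1 / 2)
  have h2 := tsum_half_le hg
  rw [h, one_div_mul_eq_div, div_le_iff₀ (by positivity)] at h2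
  refine mul_le_mul_of_nonneg_left (h2.trans (le_of_eq ?_)) (by positivity)
  ring

theorem le_mul_exp_sub_div {a y : ℝ} (ha : 0 < a) : y ≤ a * exp ((y - a) / a) := by
  have := mul_le_mul_of_nonneg_left (add_one_le_exp ((y - a) / a)) ha.le
  rw [mul_add, mul_div_cancel₀ _ ha.ne'] at this
  linarith

theorem iInf_latticeTheta_lt_of_sq (x : ℝ) {y α : ℝ} (hy : 0 < y) (hα : 0 < α) (hg : 1 ≤ α * y)
    (h : 4.05 * (y * exp (-(π * (α * y) / 2) + π * α * (4 / (3 * √3)))) < 9 * α) :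
    ⨅ z, latticeTheta x y z α < latticeTheta (1 / 2) (√3 / 2) (1 / 3, 1 / 3) α := by
  refine (iInf_latticeTheta_le_sqrt x hy hα hg).trans_lt ?_
  rw [latticeTheta_hex]
  refine lt_of_lt_of_le ?_ (three_mul_exp_le_hexSum_hole (by positivity))
  rw [one_div_mul_eq_div, div_lt_iff₀ hα]
  refine lt_of_pow_lt_pow_left₀ 2 (by positivity) ?_
  rw [mul_pow, mul_pow 2.01, Real.sq_sqrt (by positivity), mul_pow, mul_pow 3, ← exp_nat_mul,
    ← exp_nat_mul]
  have e1 : exp (((2 : ℕ) : ℝ) * -(π * (α * y) / 4)) =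
      exp (-(π * (α * y) / 2) + π * α * (4 / (3 * √3))) *
        exp (((2 : ℕ) : ℝ) * -(2 * π * α / √3 / 3)) := by
    rw [← exp_add]
    congr 1
    push_cast
    field_simp
    ring
  rw [e1]
  set E := exp (-(π * (α * y) / 2) + π * α * (4 / (3 * √3)))
  have hE : 0 < E := exp_pos _
  set H := exp (((2 : ℕ) : ℝ) * -(2 * π * α / √3 / 3))
  have hH : 0 < H := exp_pos _
  have h1 : 4.05 * (y * E) * (α * H) < 9 * α * (α * H) :=
    mul_lt_mul_of_pos_right h (by positivity)
  have h2 : 0 ≤ y * E * (α * H) := by positivity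
  nlinarith

theorem iInf_latticeTheta_lt_of_long_large (x : ℝ) {y α : ℝ} (hα : 0.85 ≤ α) (hy : 1.5397 ≤ y) :
    ⨅ z, latticeTheta x y z α < latticeTheta (1 / 2) (√3 / 2) (1 / 3, 1 / 3) α := by
  have hy0 : 0 < y := by linarith
  have hα0 : 0 < α := by linarith
  refine iInf_latticeTheta_lt_of_sq x hy0 hα0 (by nlinarith) ?_
  have h1 := le_mul_exp_sub_div (a := 1.5397) (y := y) (by norm_num)
  have hs : 4 / (3 * √3) ≤ 1.5397 / 2 := by
    rw [div_le_iff₀ (by positivity)]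
    linarith [sqrt_three_gt]
  have h2 : exp (-(π * (α * y) / 2) + π * α * (4 / (3 * √3))) ≤
      exp (-((y - 1.5397) / 1.5397)) := by
    rw [exp_le_exp]
    have h3 := mul_le_mul_of_nonneg_left hs (by positivity : 0 ≤ π * α)
    have h4 : 2.55 ≤ π * α := by nlinarith [pi_gt_three]
    have h5 := mul_le_mul_of_nonneg_right h4 (by linarith : 0 ≤ y - 1.5397)
    have h6 : (y - 1.5397) / 1.5397 ≤ 1 * (y - 1.5397) := by
      rw [div_le_iff₀ (by norm_num)]; nlinarith
    nlinarith
  have h3 : y * exp (-(π * (α * y) / 2) + π * α * (4 / (3 * √3))) ≤ 1.5397 := by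
    calc _ ≤ (1.5397 * exp ((y - 1.5397) / 1.5397)) * exp (-((y - 1.5397) / 1.5397)) := by
          gcongr
      _ = 1.5397 := by rw [mul_assoc, ← exp_add, add_neg_cancel, exp_zero, mul_one]
  linarith

theorem iInf_latticeTheta_lt_of_long_moderate (x : ℝ) {y α : ℝ} (hα : 0.85 ≤ α) (hα4 : α ≤ 4)
    (hy : 1.3 ≤ y) :
    ⨅ z, latticeTheta x y z α < latticeTheta (1 / 2) (√3 / 2) (1 / 3, 1 / 3) α := by
  have hy0 : 0 < y := by linarith
  have hα0 : 0 < α := by linarith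
  refine iInf_latticeTheta_lt_of_sq x hy0 hα0 (by nlinarith) ?_
  have h1 := le_mul_exp_sub_div (a := 1.3) (y := y) (by norm_num)
  have hs : 4 / (3 * √3) ≤ 0.7699 := by
    rw [div_le_iff₀ (by positivity)]
    linarith [sqrt_three_gt]
  have h2 : exp (-(π * (α * y) / 2) + π * α * (4 / (3 * √3))) ≤
      exp (-((y - 1.3) / 1.3)) * exp (0.3768 * α) := by
    rw [← exp_add, exp_le_exp]
    have h3 := mul_le_mul_of_nonneg_left hs (by positivity : 0 ≤ π * α)
    have h4 : 2.55 ≤ π * α := by nlinarith [pi_gt_three]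
    have h5 := mul_le_mul_of_nonneg_right h4 (by linarith : 0 ≤ y - 1.3)
    have h6 : (y - 1.3) / 1.3 ≤ 1 * (y - 1.3) := by
      rw [div_le_iff₀ (by norm_num)]; nlinarith
    have h7 : π * α ≤ 3.1416 * α := by nlinarith [pi_lt_d4]
    nlinarith
  have h3 : y * exp (-(π * (α * y) / 2) + π * α * (4 / (3 * √3))) ≤ 1.3 * exp (0.3768 * α) := by
    calc _ ≤ (1.3 * exp ((y - 1.3) / 1.3)) * (exp (-((y - 1.3) / 1.3)) * exp (0.3768 * α)) := by
          gcongr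
      _ = 1.3 * exp (0.3768 * α) := by
          rw [mul_assoc, ← mul_assoc (exp _), ← exp_add, add_neg_cancel, exp_zero, one_mul]
  have ha : 0 ≤ (4 - α) * (20 / 63) := by linarith
  have hb : 0 ≤ (α - 0.85) * (20 / 63) := by linarith
  have hc := convexOn_exp.2 (Set.mem_univ (0.3768 * 0.85)) (Set.mem_univ (0.3768 * 4)) ha hb
    (by ring)
  simp only [smul_eq_mul] at hc
  rw [show (4 - α) * (20 / 63) * (0.3768 * 0.85) + (α - 0.85) * (20 / 63) * (0.3768 * 4) = 0.3768 * α by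
    ring] at hc
  have e1 : exp (0.3768 * 0.85) ≤ 1.4 :=
    exp_le_of_le_mul 20 (by norm_num) (by norm_num)
  have e2 : exp (0.3768 * 4) ≤ 4.7 :=
    exp_le_of_le_mul 50 (by norm_num) (by norm_num)
  have h5 : exp (0.3768 * α) ≤ (4 - α) * (20 / 63) * 1.4 + (α - 0.85) * (20 / 63) * 4.7 := by
    refine hc.trans (add_le_add ?_ ?_)
    · exact mul_le_mul_of_nonneg_left e1 ha
    · exact mul_le_mul_of_nonneg_left e2 hb
  have h6 : (4 - α) * (20 / 63) * 1.4 + (α - 0.85) * (20 / 63) * 4.7 < 1.7 * α := by linarith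
  linarith

theorem iInf_latticeTheta_lt_of_small (x : ℝ) {y α : ℝ} (hα : 0 < α) (hα' : α ≤ 0.85)
    (hy : 0 < y) (h : 1.52 * exp (-(π / α * (2 / √3))) ≤ exp (-π / (α * y))) :
    ⨅ z, latticeTheta x y z α < latticeTheta (1 / 2) (√3 / 2) (1 / 3, 1 / 3) α := by
  have ha : 4 ≤ π / α * (2 / √3) := by
    have h1 : 3.14 / 0.85 ≤ π / α := by
      rw [div_le_div_iff₀ (by norm_num) hα]
      nlinarith [pi_gt_d2]
    have h2 : 1.15 ≤ 2 / √3 := by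
      rw [le_div_iff₀ (by positivity)]
      linarith [sqrt_three_lt]
    nlinarith
  have hd := le_hexDual ha
  have hq' : exp (-(π / α * (2 / √3))) ≤ 0.02 := by
    refine (exp_le_exp.2 (by linarith : -(π / α * (2 / √3)) ≤ -4)).trans
      (exp_neg_le_of_one_le 200 (by norm_num) (by norm_num) (by norm_num))
  rw [latticeTheta_hex_eq_fourier hα]
  rcases le_total 1.5 (α * y) with hg | hg
  · refine (iInf_latticeTheta_le_sqrt x hy hα (by linarith)).trans_lt ?_
    refine mul_lt_mul_of_pos_left (lt_of_lt_of_le ?_ hd) (by positivity)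
    have h1 : √(α * y) * (2.01 * exp (-(π * (α * y) / 4))) < 0.9 := by
      refine lt_of_pow_lt_pow_left₀ 2 (by norm_num) ?_
      rw [mul_pow, mul_pow 2.01, Real.sq_sqrt (by positivity), ← exp_nat_mul]
      set g := α * y
      have h1 := le_mul_exp_sub_div (a := 1.5) (y := g) (by norm_num)
      have h2 : exp (((2 : ℕ) : ℝ) * -(π * g / 4)) ≤ exp (-((g - 1.5) / 1.5)) * exp (-2.25) := by
        rw [← exp_add, exp_le_exp]
        push_cast
        have h3 := mul_le_mul_of_nonneg_right pi_gt_three.le (by linarith : 0 ≤ g)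
        have h4 : (g - 1.5) / 1.5 ≤ 1 * (g - 1.5) := by
          rw [div_le_iff₀ (by norm_num)]; nlinarith
        linarith
      have h3 : g * exp (((2 : ℕ) : ℝ) * -(π * g / 4)) ≤ 1.5 * exp (-2.25) := by
        calc _ ≤ (1.5 * exp ((g - 1.5) / 1.5)) * (exp (-((g - 1.5) / 1.5)) * exp (-2.25)) := by
              gcongr
          _ = 1.5 * exp (-2.25) := by
              rw [mul_assoc, ← mul_assoc (exp _), ← exp_add, add_neg_cancel, exp_zero, one_mul]
      have e1 : exp (-2.25) ≤ 0.11 :=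
        exp_neg_le_of_one_le 100 (by norm_num) (by norm_num) (by norm_num)
      nlinarith
    linarith
  · refine (iInf_latticeTheta_le_average x hy hα).trans_lt ?_
    refine mul_lt_mul_of_pos_left (lt_of_le_of_lt (tsum_alternating_le _ rfl ?_)
      (lt_of_lt_of_le ?_ hd)) (by positivity)
    · have : -π / (α * y) ≤ -2.09 := by
        rw [div_le_iff₀ (by positivity)]
        nlinarith [pi_gt_d2]
      refine (exp_le_exp.2 this).trans
        ((exp_neg_le_of_one_le 250 (by norm_num) (by norm_num) (by norm_num)))
    · linarith [exp_pos (-(π / α * (2 / √3)))]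

end AverageComparison

section Skew

theorem abs_sin_nat_mul_le (n : ℕ) (t : ℝ) : |sin (n * t)| ≤ n * |sin t| := by
  induction n with
  | zero => simp
  | succ n ih =>
    push_cast
    rw [add_mul, one_mul, sin_add]
    refine (abs_add_le _ _).trans ?_
    rw [abs_mul, abs_mul, add_mul, one_mul]
    exact add_le_add
      ((mul_le_of_le_one_right (abs_nonneg _) (abs_cos_le_one _)).trans ih)
      (mul_le_of_le_one_left (abs_nonneg _) (abs_cos_le_one _))

theorem one_sub_cos_int_mul_le (l : ℤ) (t : ℝ) : 1 - cos (l * t) ≤ (l : ℝ) ^ 2 * (1 - cos t) := by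
  have key : ∀ s : ℝ, 1 - cos s = 2 * |sin (s / 2)| ^ 2 := fun s => by
    rw [sq_abs, sin_sq_eq_half_sub]
    ring_nf
  have h : |sin (l * t / 2)| ≤ |(l : ℝ)| * |sin (t / 2)| := by
    have h1 := abs_sin_nat_mul_le l.natAbs (t / 2)
    rw [Nat.cast_natAbs, Int.cast_abs] at h1
    refine le_trans (le_of_eq ?_) h1
    rcases abs_cases (l : ℝ) with ⟨h, _⟩ | ⟨h, _⟩ <;> rw [h]
    · ring_nf
    · rw [neg_mul, sin_neg, abs_neg, mul_div_assoc]
  rw [key, key]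
  have := pow_le_pow_left₀ (abs_nonneg _) h 2
  rw [mul_pow, sq_abs (l : ℝ)] at this
  linarith

theorem ThetaLike.add_neg_le {f : ℝ → ℝ} (hf : ThetaLike f) {C : ℝ} (h1 : -1 ≤ C) (h2 : C ≤ 1) :
    f (-C) - f (-1) ≤ f 1 - f C := by
  have m1 : (1 : ℝ) ∈ Set.Icc (-1 : ℝ) 1 := by constructor <;> norm_num
  have m2 : (-1 : ℝ) ∈ Set.Icc (-1 : ℝ) 1 := by constructor <;> norm_num
  have a1 := hf.convex.2 m1 m2 (by linarith : 0 ≤ (1 - C) / 2) (by linarith : 0 ≤ (1 + C) / 2)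
    (by ring)
  have a2 := hf.convex.2 m1 m2 (by linarith : 0 ≤ (1 + C) / 2) (by linarith : 0 ≤ (1 - C) / 2)
    (by ring)
  simp only [smul_eq_mul] at a1 a2
  rw [show (1 - C) / 2 * 1 + (1 + C) / 2 * -1 = -C by ring] at a1
  rw [show (1 + C) / 2 * 1 + (1 - C) / 2 * -1 = C by ring] at a2
  linarith

theorem ThetaLike.sub_le_mul {f : ℝ → ℝ} (hf : ThetaLike f) {u v M : ℝ} (hM : 1 ≤ M)
    (hu : 0 ≤ u) (hu2 : u ≤ 2) (hv : 0 ≤ v) (hv2 : v ≤ 2) (h : v ≤ M * u) :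
    f 1 - f (1 - v) ≤ M * (f 1 - f (1 - u)) := by
  have m1 : (1 : ℝ) ∈ Set.Icc (-1 : ℝ) 1 := by constructor <;> norm_num
  have mu : 1 - u ∈ Set.Icc (-1 : ℝ) 1 := by constructor <;> linarith
  have mv : 1 - v ∈ Set.Icc (-1 : ℝ) 1 := by constructor <;> linarith
  have hmu := hf.mono mu m1 (by linarith)
  have hmv := hf.mono mv m1 (by linarith)
  rcases le_or_gt v u with hvu | hvu
  · have := hf.mono mu mv (by linarith)
    nlinarith
  · have hv0 : 0 < v := hu.trans_lt hvu
    have a := hf.convex.2 m1 mv (sub_nonneg.2 ((div_le_one hv0).2 hvu.le) : 0 ≤ 1 - u / v)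
      (by positivity : 0 ≤ u / v) (by ring)
    simp only [smul_eq_mul] at a
    rw [show (1 - u / v) * 1 + u / v * (1 - v) = 1 - u by field_simp; ring] at a
    have h3 : u / v * (f 1 - f (1 - v)) ≤ f 1 - f (1 - u) := by linarith
    have h4 : 1 ≤ M * (u / v) := by
      rw [← mul_div_assoc, le_div_iff₀ hv0]
      linarith
    nlinarith

theorem sq_mul_exp_le_geometric {γ z : ℝ} (hγ : 2.31 ≤ γ) (hz0 : 0 ≤ z) (hz : z ≤ 1 / 2) (l : ℤ)
    (hl : l ≠ 1) (hl' : l ≠ -1) :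
    (l : ℝ) ^ 2 * exp (-γ * ((l : ℝ) + z) ^ 2) ≤
      exp (-γ * (-1 + z) ^ 2) * (1 / 4 * (4 / 9) ^ l.natAbs) := by
  rcases eq_or_ne l 0 with rfl | h0
  · simp only [Int.cast_zero, ne_eq, OfNat.ofNat_ne_zero, not_false_eq_true, zero_pow, zero_mul]
    positivity
  obtain ⟨n, hn⟩ : ∃ n : ℕ, l.natAbs = n + 2 := ⟨l.natAbs - 2, by omega⟩
  have hr : exp (-γ) ≤ 1 / 9 := (exp_le_exp.2 (by linarith : -γ ≤ -2.31)).trans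
    (exp_neg_le_of_one_le 250 (by norm_num) (by norm_num) (by norm_num))
  have h1 : (l : ℝ) ^ 2 ≤ 1 / 4 * 4 ^ l.natAbs := by
    have e : (l : ℝ) ^ 2 = (l.natAbs : ℝ) ^ 2 := by rw [Nat.cast_natAbs, Int.cast_abs, sq_abs]
    rw [e, hn]
    have h2 : n + 2 ≤ 2 ^ (n + 1) := by
      have := Nat.lt_two_pow_self (n := n + 1)
      omega
    have h3 : ((n : ℝ) + 2) ≤ 2 ^ (n + 1) := by exact_mod_cast h2
    have h4 : ((n : ℝ) + 2) ^ 2 ≤ (2 ^ (n + 1)) ^ 2 := by gcongr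
    push_cast
    calc _ ≤ ((2 : ℝ) ^ (n + 1)) ^ 2 := h4
      _ = _ := by rw [← pow_mul, mul_comm, pow_mul]; norm_num [pow_succ]; ring
  have h2 : exp (-γ * ((l : ℝ) + z) ^ 2) ≤ exp (-γ * (-1 + z) ^ 2) * (1 / 9) ^ l.natAbs := by
    have h3 : exp (-γ * ((l : ℝ) + z) ^ 2) ≤ exp (-γ * (-1 + z) ^ 2) * exp (-γ) ^ l.natAbs := by
      rw [← exp_nat_mul, ← exp_add, exp_le_exp]
      have h4 : (l.natAbs : ℝ) ≤ ((l : ℝ) + z) ^ 2 - (-1 + z) ^ 2 := by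
        rw [Nat.cast_natAbs, Int.cast_abs]
        rcases lt_or_gt_of_ne h0 with h | h
        · have : (l : ℝ) ≤ -2 := by exact_mod_cast (by omega : l ≤ -2)
          rw [abs_of_neg (by linarith)]
          nlinarith
        · have : (2 : ℝ) ≤ l := by exact_mod_cast (by omega : 2 ≤ l)
          rw [abs_of_pos (by linarith)]
          nlinarith
      nlinarith
    refine h3.trans ?_
    have : exp (-γ) ^ l.natAbs ≤ (1 / 9) ^ l.natAbs :=
      pow_le_pow_left₀ (exp_pos _).le hr _
    gcongr
  calc _ ≤ (1 / 4 * 4 ^ l.natAbs) * (exp (-γ * (-1 + z) ^ 2) * (1 / 9) ^ l.natAbs) := by gcongr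
    _ = exp (-γ * (-1 + z) ^ 2) * (1 / 4 * (4 * (1 / 9)) ^ l.natAbs) := by rw [mul_pow]; ring
    _ = _ := by norm_num

theorem latticeTheta_skew_le {x y α z : ℝ} (hy : 0 < y) (hα : 0 < α)
    (hγ : 2.31 ≤ π * (α * y)) (hz0 : 0 ≤ z) (hz : z ≤ 1 / 2) :
    latticeTheta x y (1 / 2 - x * z, z) α ≤ latticeTheta (1 / 2) y (1 / 2 - 1 / 2 * z, z) α := by
  obtain ⟨f, hf, -, -, hfe⟩ := exists_thetaLike_gauss (c := π * (α / y)) (by positivity)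
  set w : ℤ → ℝ := fun l => exp (-π * (α * y) * ((l : ℝ) + z) ^ 2) with hw
  have hrow : ∀ t : ℝ, latticeTheta t y (1 / 2 - t * z, z) α =
      ∑' l : ℤ, w l * f (cos (2 * π * (1 / 2 + t * l))) := by
    intro t
    rw [latticeTheta_eq_rows t hy _ hα]
    refine tsum_congr fun l => ?_
    rw [← hfe, show 1 / 2 - t * z + t * ((l : ℝ) + z) = 1 / 2 + t * l by ring]
    simp only [hw, neg_mul]
  have m1 : (1 : ℝ) ∈ Set.Icc (-1 : ℝ) 1 := by constructor <;> norm_num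
  have hws : Summable w := by
    have := summable_exp_neg_mul_int_add_sq (c := π * (α * y)) (by positivity) z
    simpa only [hw, neg_mul] using this
  have hsum : ∀ t : ℝ, Summable fun l : ℤ => w l * f (cos (2 * π * (1 / 2 + t * l))) := by
    intro t
    refine (hws.mul_right (f 1)).of_nonneg_of_le (fun l => mul_nonneg (exp_pos _).le
      (hf.nonneg _ ⟨neg_one_le_cos _, cos_le_one _⟩)) fun l => ?_
    exact mul_le_mul_of_nonneg_left (hf.mono ⟨neg_one_le_cos _, cos_le_one _⟩ m1 (cos_le_one _))
      (exp_pos _).le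
  rw [hrow, hrow]
  set θ := 2 * π * (1 / 2 - x) with hθ
  have hVm := hf.mono (a := cos θ) ⟨neg_one_le_cos _, cos_le_one _⟩ m1 (cos_le_one _)
  set V := f 1 - f (cos θ) with hV
  have hV0 : 0 ≤ V := by linarith
  set E := exp (-(π * (α * y)) * (-1 + z) ^ 2) with hE
  have hpt : ∀ l : ℤ, w l * f (cos (2 * π * (1 / 2 + x * l))) ≤
      w l * f (cos (2 * π * (1 / 2 + 1 / 2 * l))) +
        V * E * (1 / 4 * (4 / 9) ^ l.natAbs - if l = -1 then 1 else 0) := by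
    intro l
    have hwl : 0 < w l := exp_pos _
    have hE0 : 0 < E := exp_pos _
    rcases Int.even_or_odd' l with ⟨j, rfl | rfl⟩
    · rw [if_neg (by omega), sub_zero]
      have e1 : cos (2 * π * (1 / 2 + x * ((2 * j : ℤ) : ℝ))) = -cos (((2 * j : ℤ) : ℝ) * θ) := by
        rw [← cos_pi_sub, ← cos_add_int_mul_two_pi (π - _) j, hθ]
        push_cast
        ring_nf
      have e2 : cos (2 * π * (1 / 2 + 1 / 2 * ((2 * j : ℤ) : ℝ))) = -1 := by
        rw [← cos_pi, ← cos_add_int_mul_two_pi π j]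
        push_cast
        ring_nf
      rw [e1, e2]
      have h1 := hf.add_neg_le (neg_one_le_cos (((2 * j : ℤ) : ℝ) * θ)) (cos_le_one _)
      have h2 : f 1 - f (cos (((2 * j : ℤ) : ℝ) * θ)) ≤ ((2 * j : ℤ) : ℝ) ^ 2 * V := by
        rcases eq_or_ne j 0 with rfl | hj
        · simp
        · have := hf.sub_le_mul (u := 1 - cos θ) (v := 1 - cos (((2 * j : ℤ) : ℝ) * θ))
            (M := ((2 * j : ℤ) : ℝ) ^ 2) ?_ (by linarith [cos_le_one θ])
            (by linarith [neg_one_le_cos θ]) (by linarith [cos_le_one (((2 * j : ℤ) : ℝ) * θ)])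
            (by linarith [neg_one_le_cos (((2 * j : ℤ) : ℝ) * θ)]) (one_sub_cos_int_mul_le _ _)
          · simpa only [sub_sub_cancel] using this
          · have : 1 ≤ (2 * j) ^ 2 := by
              have : 0 < (2 * j) ^ 2 := by positivity
              omega
            exact_mod_cast this
      have h3 := sq_mul_exp_le_geometric hγ hz0 hz (2 * j) (by omega) (by omega)
      have h4 : w (2 * j) = exp (-(π * (α * y)) * (((2 * j : ℤ) : ℝ) + z) ^ 2) := by
        simp only [hw, neg_mul]
      rw [← h4] at h3
      have h5 := mul_le_mul_of_nonneg_left (h1.trans h2) hwl.le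
      have h6 := mul_le_mul_of_nonneg_left h3 hV0
      linarith
    · have e2 : cos (2 * π * (1 / 2 + 1 / 2 * ((2 * j + 1 : ℤ) : ℝ))) = 1 := by
        exact (congrArg cos (by push_cast; ring)).trans (cos_int_mul_two_pi (j + 1))
      rw [e2]
      by_cases hl : 2 * j + 1 = -1
      · rw [if_pos hl, hl]
        have e1 : cos (2 * π * (1 / 2 + x * ((-1 : ℤ) : ℝ))) = cos θ := by
          rw [hθ]
          push_cast
          ring_nf
        have e3 : w (-1) = E := by
          simp only [hw, hE, neg_mul]
          push_cast
          rfl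
        rw [e1, e3]
        have : 0 ≤ V * E * (1 / 4 * (4 / 9) ^ (-1 : ℤ).natAbs) := by positivity
        nlinarith
      · rw [if_neg hl, sub_zero]
        have := mul_le_mul_of_nonneg_left (hf.mono (a := cos (2 * π * (1 / 2 + x * ((2 * j + 1 : ℤ) : ℝ))))
          ⟨neg_one_le_cos _, cos_le_one _⟩ m1 (cos_le_one _)) hwl.le
        have : 0 ≤ V * E * (1 / 4 * (4 / 9) ^ (2 * j + 1).natAbs) := by positivity
        linarith
  have hg := ((hasSum_pow_natAbs (r := 4 / 9) (by norm_num) (by norm_num)).mul_left (1 / 4)).sub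
    (hasSum_ite_eq (-1 : ℤ) (1 : ℝ))
  have := hasSum_le hpt (hsum x).hasSum ((hsum (1 / 2)).hasSum.add (hg.mul_left (V * E)))
  have hneg : V * E * (1 / 4 * ((1 + 4 / 9) / (1 - 4 / 9)) - 1) ≤ 0 := by
    have : 0 ≤ V * E := mul_nonneg hV0 (exp_pos _).le
    norm_num
    linarith
  linarith

end Skew

section Taylor

theorem exp_sub_one_sub_le (x : ℝ) :
    exp x - 1 - x ≤ x ^ 2 * (1 / 3 + exp x / 6) := by
  set F : ℝ → ℝ := fun d => d ^ 2 / 6 - 1 + exp d * (1 - d + d ^ 2 / 3) with hF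
  have hd : ∀ d, HasDerivAt F (d / 3 * (1 + exp d * (d - 1))) d := by
    intro d
    have h1 := (((hasDerivAt_id d).pow 2).div_const 6).sub_const 1
    have h2 := (((hasDerivAt_id d).const_sub 1).add (((hasDerivAt_id d).pow 2).div_const 3))
    refine (h1.add ((hasDerivAt_exp d).mul h2)).congr_deriv ?_
    simp
    ring
  have hk : ∀ d, 0 ≤ 1 + exp d * (d - 1) := by
    intro d
    have h := add_one_le_exp (-d)
    have h1 : exp d * exp (-d) = 1 := by rw [← exp_add, add_neg_cancel, exp_zero]
    nlinarith [exp_pos d]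
  have hdiff : Differentiable ℝ F := fun d => (hd d).differentiableAt
  have h0 : F 0 = 0 := by simp [hF]
  have hpos : ∀ d, 0 ≤ F d := by
    intro d
    rcases le_total 0 d with h | h
    · have := monotoneOn_of_deriv_nonneg (convex_Ici 0) hdiff.continuous.continuousOn
        hdiff.differentiableOn (fun z hz => by
          rw [interior_Ici] at hz
          rw [(hd z).deriv]
          exact mul_nonneg (div_nonneg (le_of_lt hz) (by norm_num)) (hk z))
      exact h0 ▸ this (Set.self_mem_Ici) h h
    · have := antitoneOn_of_deriv_nonpos (convex_Iic 0) hdiff.continuous.continuousOn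
        hdiff.differentiableOn (fun z hz => by
          rw [interior_Iic] at hz
          rw [(hd z).deriv]
          exact mul_nonpos_of_nonpos_of_nonneg
            (div_nonpos_of_nonpos_of_nonneg (le_of_lt hz) (by norm_num)) (hk z))
      exact h0 ▸ this h Set.self_mem_Iic h
  have h1 := hpos (-x)
  have h2 : exp x * exp (-x) = 1 := by rw [← exp_add, add_neg_cancel, exp_zero]
  have h3 := mul_nonneg (exp_pos x).le h1
  simp only [hF] at h3
  have h4 : exp x * ((-x) ^ 2 / 6 - 1 + exp (-x) * (1 - -x + (-x) ^ 2 / 3)) =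
    x ^ 2 * (1 / 3 + exp x / 6) - (exp x - 1 - x) := by
    linear_combination (1 - -x + (-x) ^ 2 / 3) * h2
  linarith

end Taylor

section HoleForm

/-- The squared distances to the deep hole `(1/3, 1/3)` for the form `k² + kl + l²`,
normalised to vanish at the three nearest lattice points. -/
def holeForm (p : ℤ × ℤ) : ℤ := p.1 ^ 2 + p.1 * p.2 + p.2 ^ 2 + p.1 + p.2

/-- The component of `holeForm` along the second coordinate. -/
def holeRow (p : ℤ × ℤ) : ℤ := p.2 ^ 2 + p.2

theorem holeRow_nonneg (p : ℤ × ℤ) : 0 ≤ holeRow p := by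
  unfold holeRow
  rcases le_or_gt 0 p.2 with h | h
  · positivity
  · nlinarith

theorem holeRow_le (p : ℤ × ℤ) : holeRow p ≤ 2 * holeForm p := by
  obtain ⟨k, l⟩ := p
  simp only [holeRow, holeForm]
  rcases eq_or_ne l 0 with rfl | h
  · have : 0 ≤ k * (k + 1) := by
      rcases le_or_gt 0 k with h | h
      · positivity
      · nlinarith
    nlinarith
  · have : 1 ≤ l ^ 2 := by
      have : 0 < l ^ 2 := by positivity
      omega
    nlinarith [sq_nonneg (2 * k + l + 1)]

theorem holeRow_le_of_four_le {p : ℤ × ℤ} (h : 4 ≤ holeForm p) :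
    2 * holeRow p ≤ 3 * holeForm p := by
  obtain ⟨k, l⟩ := p
  simp only [holeRow, holeForm] at *
  have e := sq_nonneg (2 * k + l + 1)
  rcases lt_or_ge l 0 with h0 | h0
  · nlinarith
  rcases lt_or_ge 2 l with h3 | h3
  · nlinarith
  interval_cases l
  · linarith
  · linarith
  · have : 0 ≤ (k + 1) * (k + 2) := by
      rcases le_or_gt (-1) k with h | h
      · exact mul_nonneg (by linarith) (by linarith)
      · nlinarith
    nlinarith

theorem holeForm_nonneg (p : ℤ × ℤ) : 0 ≤ holeForm p := by
  linarith [holeRow_le p, holeRow_nonneg p]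

theorem hexForm_hole (p : ℤ × ℤ) :
    ((p.1 : ℝ) + 1 / 3) ^ 2 + ((p.1 : ℝ) + 1 / 3) * ((p.2 : ℝ) + 1 / 3) + ((p.2 : ℝ) + 1 / 3) ^ 2 =
      holeForm p + 1 / 3 := by
  simp only [holeForm]
  push_cast
  ring

theorem summable_mul_exp_holeForm {c : ℝ} (hc : 0 < c) (f : ℤ × ℤ → ℝ) {K : ℝ}
    (hf : ∀ p : ℤ × ℤ, |f p| ≤ K * ((p.1 : ℝ) ^ 2 + (p.2 : ℝ) ^ 2 + 1) ^ 2) :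
    Summable fun p => f p * exp (-(c * holeForm p)) := by
  refine ((hexSum_hole_summable hc f hf).mul_right (exp (c / 3))).congr fun p => ?_
  rw [hexForm_hole, mul_assoc, ← exp_add]
  congr 2
  ring

theorem hexSum_hole_eq (c : ℝ) :
    hexSum c (1 / 3, 1 / 3) = exp (-(c / 3)) * ∑' p, exp (-(c * holeForm p)) := by
  rw [hexSum, ← tsum_mul_left]
  refine tsum_congr fun p => ?_
  rw [hexForm_hole, ← exp_add]
  congr 1
  ring

theorem abs_holeForm_le (p : ℤ × ℤ) :
    |(holeForm p : ℝ)| ≤ 3 * ((p.1 : ℝ) ^ 2 + (p.2 : ℝ) ^ 2 + 1) ^ 2 := by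
  have h0 : (0 : ℝ) ≤ holeForm p := by exact_mod_cast holeForm_nonneg p
  rw [abs_of_nonneg h0]
  simp only [holeForm]
  push_cast
  nlinarith [sq_nonneg ((p.1 : ℝ) - 1), sq_nonneg ((p.2 : ℝ) - 1), sq_nonneg ((p.1 : ℝ) - p.2),
    sq_nonneg ((p.1 : ℝ) ^ 2 + (p.2 : ℝ) ^ 2), sq_nonneg (p.1 : ℝ), sq_nonneg (p.2 : ℝ)]

theorem abs_holeRow_le (p : ℤ × ℤ) :
    |(holeRow p : ℝ)| ≤ 6 * ((p.1 : ℝ) ^ 2 + (p.2 : ℝ) ^ 2 + 1) ^ 2 := by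
  have h0 : (0 : ℝ) ≤ holeRow p := by exact_mod_cast holeRow_nonneg p
  have h1 : (holeRow p : ℝ) ≤ 2 * holeForm p := by exact_mod_cast holeRow_le p
  rw [abs_of_nonneg h0]
  linarith [abs_holeForm_le p, le_abs_self (holeForm p : ℝ)]

theorem three_mul_tsum_holeRow {c : ℝ} (hc : 0 < c) :
    3 * ∑' p, (holeRow p : ℝ) * exp (-(c * holeForm p)) =
      2 * ∑' p, (holeForm p : ℝ) * exp (-(c * holeForm p)) := by
  set f : ℤ × ℤ → ℝ := fun p => (holeRow p : ℝ) * exp (-(c * holeForm p)) with hf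
  have hs : Summable f := summable_mul_exp_holeForm hc _ abs_holeRow_le
  have h1 : ∑' p, f (holeRot p) = ∑' p, f p := holeRot.tsum_eq f
  have h2 : ∑' p, f (holeRot (holeRot p)) = ∑' p, f p := (holeRot.trans holeRot).tsum_eq f
  have s1 : Summable fun p => f (holeRot p) := holeRot.summable_iff.2 hs
  have s2 : Summable fun p => f (holeRot (holeRot p)) := (holeRot.trans holeRot).summable_iff.2 hs
  have h3 : ∑' p, (f p + f (holeRot p) + f (holeRot (holeRot p))) = 3 * ∑' p, f p := by
    rw [(hs.add s1).tsum_add s2, hs.tsum_add s1, h1, h2]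
    ring
  rw [← h3, ← tsum_mul_left]
  refine tsum_congr fun p => ?_
  have e1 : holeForm (holeRot p) = holeForm p := by
    simp only [holeForm, holeRot, Equiv.coe_fn_mk]; ring
  have e2 : holeForm (holeRot (holeRot p)) = holeForm p := by
    simp only [holeForm, holeRot, Equiv.coe_fn_mk]; ring
  have e3 : (holeRow p : ℝ) + holeRow (holeRot p) + holeRow (holeRot (holeRot p)) =
      2 * holeForm p := by
    have : holeRow p + holeRow (holeRot p) + holeRow (holeRot (holeRot p)) = 2 * holeForm p := by
      simp only [holeForm, holeRow, holeRot, Equiv.coe_fn_mk]; ring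
    exact_mod_cast this
  simp only [hf, e1, e2]
  linear_combination exp (-(c * holeForm p)) * e3

end HoleForm

section SkewForm

/-- The quadratic form of the isosceles lattice `(1/2, y)` centred at its circumcentre,
normalised to vanish at the three nearest lattice points. -/
noncomputable def skewForm (y : ℝ) (p : ℤ × ℤ) : ℝ :=
  y * holeRow p + (holeForm p - 3 / 4 * holeRow p) / y

/-- The rate of change of `skewForm` relative to the hexagonal form. -/
noncomputable def skewRate (c : ℝ) (p : ℤ × ℤ) : ℝ :=
  holeRow p - c * (holeForm p - 3 / 4 * holeRow p)

theorem skewForm_sub {s y : ℝ} (hs : s ^ 2 = 4 / 3) (hy : 0 < y) (p : ℤ × ℤ) :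
    skewForm y p - s * holeForm p = (y - 3 / 4 * s) * skewRate (s / y) p := by
  unfold skewForm skewRate
  field_simp
  linear_combination (-3 * (4 * holeForm p - 3 * (holeRow p : ℝ))) * hs

theorem holeForm_div_le_skewForm {y : ℝ} (hy : 0 < y) (h : 3 / 4 ≤ y ^ 2) (p : ℤ × ℤ) :
    holeForm p / y ≤ skewForm y p := by
  have h0 : (0 : ℝ) ≤ holeRow p := by exact_mod_cast holeRow_nonneg p
  have e : skewForm y p - holeForm p / y = holeRow p * (y ^ 2 - 3 / 4) / y := by
    unfold skewForm
    field_simp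
    ring
  have : 0 ≤ holeRow p * (y ^ 2 - 3 / 4) / y :=
    div_nonneg (mul_nonneg h0 (by linarith)) hy.le
  linarith

theorem skewRate_sq_le {c : ℝ} (hc : 0 ≤ c) (hc1 : c ≤ 4 / 3) (p : ℤ × ℤ) :
    skewRate c p ^ 2 ≤ 8 * (holeForm p : ℝ) ^ 2 := by
  have h0 : (0 : ℝ) ≤ holeRow p := by exact_mod_cast holeRow_nonneg p
  have h1 : (holeRow p : ℝ) ≤ 2 * holeForm p := by exact_mod_cast holeRow_le p
  have h2 : skewRate c p ≤ 8 / 3 * holeForm p := by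
    unfold skewRate
    nlinarith
  have h3 : -(8 / 3 * holeForm p) ≤ skewRate c p := by
    unfold skewRate
    nlinarith
  have := sq_le_sq' h3 h2
  nlinarith [sq_nonneg (holeForm p : ℝ)]

theorem skewRate_sq_le_of_four_le {c : ℝ} (hc : 0 ≤ c) (hc1 : c ≤ 4 / 3) {p : ℤ × ℤ}
    (h : 4 ≤ holeForm p) : skewRate c p ^ 2 ≤ 2.8 * (holeForm p : ℝ) ^ 2 := by
  have h0 : (0 : ℝ) ≤ holeRow p := by exact_mod_cast holeRow_nonneg p
  have h1 : 2 * (holeRow p : ℝ) ≤ 3 * holeForm p := by exact_mod_cast holeRow_le_of_four_le h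
  have h2 : skewRate c p ≤ 5 / 3 * holeForm p := by
    unfold skewRate
    nlinarith
  have h3 : -(5 / 3 * holeForm p) ≤ skewRate c p := by
    unfold skewRate
    nlinarith
  have := sq_le_sq' h3 h2
  nlinarith [sq_nonneg (holeForm p : ℝ)]

theorem holeForm_sq_le (p : ℤ × ℤ) :
    (holeForm p : ℝ) ^ 2 ≤ 4 * ((p.1 : ℝ) ^ 2 + (p.2 : ℝ) ^ 2 + 1) ^ 2 := by
  have h0 : (0 : ℝ) ≤ holeForm p := by exact_mod_cast holeForm_nonneg p
  have h1 : (holeForm p : ℝ) ≤ 2 * ((p.1 : ℝ) ^ 2 + (p.2 : ℝ) ^ 2 + 1) := by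
    simp only [holeForm]
    push_cast
    nlinarith [sq_nonneg ((p.1 : ℝ) - 1), sq_nonneg ((p.2 : ℝ) - 1),
      sq_nonneg ((p.1 : ℝ) - p.2)]
  have := pow_le_pow_left₀ h0 h1 2
  linarith

theorem summable_skewRate_sq {c u : ℝ} (hc : 0 ≤ c) (hc1 : c ≤ 4 / 3) (hu : 0 < u) :
    Summable fun p => skewRate c p ^ 2 * exp (-(u * holeForm p)) :=
  summable_mul_exp_holeForm hu _ (K := 32) fun p => by
    rw [abs_of_nonneg (sq_nonneg _)]
    linarith [skewRate_sq_le hc hc1 p, holeForm_sq_le p]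

theorem summable_exp_holeForm {u : ℝ} (hu : 0 < u) :
    Summable fun p => exp (-(u * holeForm p)) := by
  have := summable_mul_exp_holeForm hu (fun _ => 1) (K := 1) fun p => by
    rw [abs_one]
    nlinarith [sq_nonneg (p.1 : ℝ), sq_nonneg (p.2 : ℝ),
      sq_nonneg ((p.1 : ℝ) ^ 2 + (p.2 : ℝ) ^ 2)]
  simpa using this

theorem summable_exp_skewForm {t y : ℝ} (ht : 0 < t) (hy : 0 < y) (h : 3 / 4 ≤ y ^ 2) :
    Summable fun p => exp (-(t * skewForm y p)) := by
  refine (summable_exp_holeForm (u := t / y) (by positivity)).of_nonneg_of_le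
    (fun p => (exp_pos _).le) fun p => ?_
  rw [exp_le_exp]
  have := mul_le_mul_of_nonneg_left (holeForm_div_le_skewForm hy h p) ht.le
  rw [div_mul_eq_mul_div, ← mul_div_assoc] at *
  linarith

theorem summable_skew_error {c s t y : ℝ} (hc : 0 ≤ c) (hc1 : c ≤ 4 / 3) (hs : 0 < s) (ht : 0 < t)
    (hy : 0 < y) (h : 3 / 4 ≤ y ^ 2) :
    Summable fun p => skewRate c p ^ 2 *
      (exp (-(t * (s * holeForm p))) / 3 + exp (-(t * skewForm y p)) / 6) := by
  have s1 := (summable_skewRate_sq hc hc1 (u := t * s) (by positivity)).div_const 3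
  have s2 : Summable fun p => skewRate c p ^ 2 * exp (-(t * skewForm y p)) := by
    refine (summable_skewRate_sq hc hc1 (u := t / y) (by positivity)).of_nonneg_of_le
      (fun p => mul_nonneg (sq_nonneg _) (exp_pos _).le) fun p => ?_
    refine mul_le_mul_of_nonneg_left (exp_le_exp.2 ?_) (sq_nonneg _)
    have := mul_le_mul_of_nonneg_left (holeForm_div_le_skewForm hy h p) ht.le
    rw [div_mul_eq_mul_div, ← mul_div_assoc] at *
    linarith
  refine (s1.add (s2.div_const 6)).congr fun p => ?_
  rw [mul_assoc t s]
  ring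

theorem tsum_exp_skewForm_le {s t y : ℝ} (hs0 : 0 < s) (hs : s ^ 2 = 4 / 3) (ht : 0 < t)
    (hy : 3 / 4 * s ≤ y) :
    ∑' p, exp (-(t * skewForm y p)) ≤ ∑' p, exp (-(t * s * holeForm p)) +
      (t * (y - 3 / 4 * s)) ^ 2 * ∑' p, skewRate (s / y) p ^ 2 *
        (exp (-(t * (s * holeForm p))) / 3 + exp (-(t * skewForm y p)) / 6) := by
  have hy0 : 0 < y := by linarith
  have hy2 : 3 / 4 ≤ y ^ 2 := by nlinarith
  have hc : 0 ≤ s / y := by positivity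
  have hc1 : s / y ≤ 4 / 3 := by rw [div_le_iff₀ hy0]; linarith
  set c := s / y with hcdef
  have hts : 0 < t * s := by positivity
  have sA : Summable fun p => (holeRow p : ℝ) * exp (-(t * s * holeForm p)) :=
    summable_mul_exp_holeForm hts _ abs_holeRow_le
  have sT : Summable fun p => (holeForm p : ℝ) * exp (-(t * s * holeForm p)) :=
    summable_mul_exp_holeForm hts _ abs_holeForm_le
  have sX : Summable fun p => skewRate c p * exp (-(t * s * holeForm p)) := by
    refine ((sA.mul_left (1 + 3 / 4 * c)).sub (sT.mul_left c)).congr fun p => ?_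
    unfold skewRate
    ring
  have hX : 0 ≤ ∑' p, skewRate c p * exp (-(t * s * holeForm p)) := by
    have e : ∑' p, skewRate c p * exp (-(t * s * holeForm p)) =
        (1 + 3 / 4 * c) * ∑' p, (holeRow p : ℝ) * exp (-(t * s * holeForm p)) -
          c * ∑' p, (holeForm p : ℝ) * exp (-(t * s * holeForm p)) := by
      rw [← tsum_mul_left, ← tsum_mul_left, ← (sA.mul_left _).tsum_sub (sT.mul_left _)]
      refine tsum_congr fun p => ?_
      unfold skewRate
      ring
    have hT : 0 ≤ ∑' p, (holeForm p : ℝ) * exp (-(t * s * holeForm p)) :=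
      tsum_nonneg fun p => mul_nonneg (by exact_mod_cast holeForm_nonneg p) (exp_pos _).le
    have := three_mul_tsum_holeRow hts
    rw [e]
    nlinarith
  have sE := summable_exp_holeForm hts
  have sR := summable_skew_error hc hc1 hs0 ht hy0 hy2
  have hpt : ∀ p, exp (-(t * skewForm y p)) ≤ exp (-(t * s * holeForm p)) -
      t * (y - 3 / 4 * s) * (skewRate c p * exp (-(t * s * holeForm p))) +
      (t * (y - 3 / 4 * s)) ^ 2 * (skewRate c p ^ 2 *
        (exp (-(t * (s * holeForm p))) / 3 + exp (-(t * skewForm y p)) / 6)) := by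
    intro p
    have h1 := exp_sub_one_sub_le (-(t * ((y - 3 / 4 * s) * skewRate c p)))
    have h2 : exp (-(t * skewForm y p)) = exp (-(t * s * holeForm p)) *
        exp (-(t * ((y - 3 / 4 * s) * skewRate c p))) := by
      rw [← exp_add, hcdef, ← skewForm_sub hs hy0]
      congr 1
      ring
    rw [← mul_assoc t s, h2]
    have h3 := mul_le_mul_of_nonneg_left h1 (exp_pos (-(t * s * holeForm p))).le
    linarith
  have := hasSum_le hpt (summable_exp_skewForm ht hy0 hy2).hasSum
    ((sE.hasSum.sub (sX.hasSum.mul_left _)).add (sR.hasSum.mul_left _))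
  have hp : 0 ≤ t * (y - 3 / 4 * s) := mul_nonneg ht.le (by linarith)
  have := mul_nonneg hp hX
  linarith

theorem latticeTheta_half_circumcentre {y : ℝ} (hy : 0 < y) (α : ℝ) :
    latticeTheta (1 / 2) y (1 / 2 - 1 / 2 * (1 / 2 - 1 / (8 * y ^ 2)), 1 / 2 - 1 / (8 * y ^ 2)) α =
      exp (-(π * α * (y / 4 + 1 / (8 * y) + 1 / (64 * y ^ 3)))) *
        ∑' p, exp (-(π * α * skewForm y p)) := by
  rw [latticeTheta, ← tsum_mul_left]
  refine tsum_congr fun p => ?_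
  rw [← exp_add]
  congr 1
  simp only [skewForm, holeForm, holeRow]
  push_cast
  field_simp
  ring

theorem latticeTheta_half_circumcentre_lt {s y α : ℝ} (hs0 : 0 < s) (hs : s ^ 2 = 4 / 3)
    (hα : 0 < α) (hy : 3 / 4 * s < y)
    (h : π * α * ∑' p, skewRate (s / y) p ^ 2 * (exp (-(π * α * (s * holeForm p))) / 3 +
        exp (-(π * α * skewForm y p)) / 6) <
      3 / 4 * (1 / y + s / (6 * y ^ 2) + 1 / (12 * y ^ 3))) :
    latticeTheta (1 / 2) y
        (1 / 2 - 1 / 2 * (1 / 2 - 1 / (8 * y ^ 2)), 1 / 2 - 1 / (8 * y ^ 2)) α <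
      hexSum (π * α * s) (1 / 3, 1 / 3) := by
  have hy0 : 0 < y := by linarith
  set t := π * α with ht
  have ht0 : 0 < t := by positivity
  set S := ∑' p, skewRate (s / y) p ^ 2 * (exp (-(t * (s * holeForm p))) / 3 +
        exp (-(t * skewForm y p)) / 6) with hS
  rw [latticeTheta_half_circumcentre hy0, hexSum_hole_eq, ← ht]
  have h1 := tsum_exp_skewForm_le hs0 hs ht0 hy.le
  rw [← hS] at h1
  set G := t * (y / 4 + 1 / (8 * y) + 1 / (64 * y ^ 3) - s / 3) with hG
  have hG1 : 3 * G = t * (y - 3 / 4 * s) ^ 2 *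
      (3 / 4 * (1 / y + s / (6 * y ^ 2) + 1 / (12 * y ^ 3))) := by
    have e4 : s ^ 3 = 4 / 3 * s := by rw [pow_succ, hs]
    rw [hG]
    field_simp
    ring_nf
    rw [hs, e4]
    ring
  have hd : 0 < t * (y - 3 / 4 * s) ^ 2 := mul_pos ht0 (pow_pos (by linarith) 2)
  have h2 : (t * (y - 3 / 4 * s)) ^ 2 * S < 3 * G := by
    rw [hG1]
    calc _ = t * (y - 3 / 4 * s) ^ 2 * (t * S) := by ring
      _ < _ := mul_lt_mul_of_pos_left h hd
  have h3 : 3 ≤ ∑' p, exp (-(t * s * holeForm p)) := by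
    have a1 := three_mul_exp_le_hexSum_hole (c := t * s) (by positivity)
    rw [hexSum_hole_eq, mul_comm] at a1
    exact le_of_mul_le_mul_left a1 (exp_pos _)
  set H := ∑' p, exp (-(t * s * holeForm p)) with hH
  have hS0 : 0 ≤ S := tsum_nonneg fun p => mul_nonneg (sq_nonneg _) (by positivity)
  have hG0 : 0 ≤ G := by
    have : 0 ≤ (t * (y - 3 / 4 * s)) ^ 2 * S := by positivity
    linarith
  have h4 : ∑' p, exp (-(t * skewForm y p)) < H * exp G := by
    have := add_one_le_exp G
    nlinarith
  calc _ < exp (-(t * (y / 4 + 1 / (8 * y) + 1 / (64 * y ^ 3)))) * (H * exp G) :=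
        mul_lt_mul_of_pos_left h4 (exp_pos _)
    _ = exp (-(t * s / 3)) * H := by
        rw [mul_comm H, ← mul_assoc, ← exp_add, hG]
        congr 2
        ring

end SkewForm

section SkewSum

theorem six_le_holeForm {p : ℤ × ℤ}
    (hp : p ∉ ({(0, 0), (-1, 0), (0, -1), (1, -1), (-1, -1), (-1, 1), (1, 0), (-2, 0), (0, 1),
      (-2, 1), (1, -2), (0, -2), (-1, 2), (-2, 2), (2, -1), (-2, -1), (2, -2), (-1, -2), (1, 1),
      (-3, 1), (1, -3)} : Finset (ℤ × ℤ))) : 6 ≤ holeForm p := by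
  obtain ⟨k, l⟩ := p
  by_contra hlt
  push Not at hlt
  have hf : holeForm (k, l) = k ^ 2 + k * l + l ^ 2 + k + l := rfl
  have hk1 : k < 4 := by nlinarith [sq_nonneg (k + l + 1)]
  have hk2 : -4 < k := by nlinarith [sq_nonneg (k + l + 1)]
  have hl1 : l < 4 := by nlinarith [sq_nonneg (k + l + 1)]
  have hl2 : -4 < l := by nlinarith [sq_nonneg (k + l + 1)]
  interval_cases k <;> interval_cases l <;> revert hp hlt <;> decide

theorem holeForm_sq_mul_exp_le {u : ℝ} (hu : 2 ≤ u) {p : ℤ × ℤ} (hp : 6 ≤ holeForm p) :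
    (holeForm p : ℝ) ^ 2 * exp (-(u * holeForm p)) ≤ 36 * exp (-u) ^ 6 * exp 2.55 *
      (exp (-(1 / 2)) ^ p.1.natAbs * exp (-(1 / 2)) ^ p.2.natAbs) := by
  have hT : (6 : ℝ) ≤ holeForm p := by exact_mod_cast hp
  have h1 := le_mul_exp_sub_div (a := 6) (by norm_num) (y := holeForm p)
  have h2 : (holeForm p : ℝ) ^ 2 ≤ 36 * exp ((holeForm p - 6) / 3) := by
    have := pow_le_pow_left₀ (by linarith) h1 2
    rw [mul_pow, ← exp_nat_mul] at this
    refine this.trans (le_of_eq ?_)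
    norm_num
    ring
  have h3 : 1 / 2 * |(p.1 : ℝ)| + 1 / 2 * |(p.2 : ℝ)| ≤ 2.55 + (u - 1 / 3) * (holeForm p - 6) := by
    have h4 : 2.5 * (|(p.1 : ℝ)| + |(p.2 : ℝ)|) - 12.75 ≤ holeForm p - 6 := by
      simp only [holeForm]
      push_cast
      have e1 := sq_abs (p.1 : ℝ)
      have e2 := sq_abs (p.2 : ℝ)
      nlinarith [sq_nonneg ((p.1 : ℝ) + p.2 + 1), sq_nonneg (|(p.1 : ℝ)| - |(p.2 : ℝ)|),
        sq_nonneg (|(p.1 : ℝ)| + |(p.2 : ℝ)| - 5)]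
    nlinarith
  calc (holeForm p : ℝ) ^ 2 * exp (-(u * holeForm p))
      ≤ 36 * exp ((holeForm p - 6) / 3) * exp (-(u * holeForm p)) := by gcongr
    _ = 36 * exp (-(6 * u) - (u - 1 / 3) * (holeForm p - 6)) := by
        rw [mul_assoc, ← exp_add]
        congr 2
        ring
    _ ≤ 36 * exp (-(6 * u) + 2.55 + (-(1 / 2 * |(p.1 : ℝ)|) + -(1 / 2 * |(p.2 : ℝ)|))) := by
        have := exp_le_exp.2 (show -(6 * u) - (u - 1 / 3) * (holeForm p - 6) ≤
          -(6 * u) + 2.55 + (-(1 / 2 * |(p.1 : ℝ)|) + -(1 / 2 * |(p.2 : ℝ)|)) by linarith)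
        linarith
    _ = _ := by
        rw [exp_add, exp_add, exp_add, ← exp_nat_mul, ← exp_nat_mul, ← exp_nat_mul,
          Nat.cast_natAbs, Nat.cast_natAbs, Int.cast_abs, Int.cast_abs]
        push_cast
        ring_nf

theorem tsum_skew_error_le {c s t y : ℝ} (hc : 0 ≤ c) (hc1 : c ≤ 4 / 3) (hs : 0 < s) (ht : 0 < t)
    (hy : 0 < y) (h : 3 / 4 ≤ y ^ 2) (hts : 2 ≤ t * s) (hty : 2 ≤ t / y) {E a b : ℝ}
    (hE : exp (-(t * s)) = E) (ha : exp (-(t / y)) = a)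
    (hb : exp (-(t * (2 * y - 1 / (2 * y)))) = b) :
    ∑' p, skewRate c p ^ 2 *
        (exp (-(t * (s * holeForm p))) / 3 + exp (-(t * skewForm y p)) / 6) ≤
      2 * c ^ 2 * (E / 3 + a / 6) + (2 + c / 2) ^ 2 * (E / 3 + b / 6) +
      8 * c ^ 2 * (E ^ 2 / 3 + a ^ 2 / 6) + 4 * (2 - c / 2) ^ 2 * (E ^ 2 / 3 + a * b / 6) +
      2.8 * ((96 * E ^ 4 + 75 * E ^ 5 + 7830 * E ^ 6) / 3 +
        (96 * a ^ 4 + 75 * a ^ 5 + 7830 * a ^ 6) / 6) := by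
  have hsum := summable_skew_error hc hc1 hs ht hy h
  set f : ℤ × ℤ → ℝ := fun p => skewRate c p ^ 2 *
        (exp (-(t * (s * holeForm p))) / 3 + exp (-(t * skewForm y p)) / 6) with hf
  have hE0 : 0 < E := hE ▸ exp_pos _
  have ha0 : 0 < a := ha ▸ exp_pos _
  have hbig : ∀ p, 4 ≤ holeForm p → f p ≤ 2.8 * (holeForm p : ℝ) ^ 2 *
      (exp (-(t * s * holeForm p)) / 3 + exp (-(t / y * holeForm p)) / 6) := by
    intro p hp
    have h1 := skewRate_sq_le_of_four_le hc hc1 hp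
    have h2 : exp (-(t * skewForm y p)) ≤ exp (-(t / y * holeForm p)) := by
      rw [exp_le_exp]
      have := mul_le_mul_of_nonneg_left (holeForm_div_le_skewForm hy h p) ht.le
      rw [div_mul_eq_mul_div, ← mul_div_assoc] at *
      linarith
    simp only [hf]
    rw [mul_assoc t s]
    gcongr
  have hbigN : ∀ p, ∀ n : ℕ, 4 ≤ n → holeForm p = n → f p ≤
      2.8 * (n : ℝ) ^ 2 * (E ^ n / 3 + a ^ n / 6) := by
    intro p n hn hp
    have := hbig p (by omega)
    rw [hp, Int.cast_natCast] at this
    refine this.trans (le_of_eq ?_)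
    rw [← hE, ← ha, ← exp_nat_mul, ← exp_nat_mul]
    ring_nf
  have hev : ∀ p, ∀ A T : ℤ, holeRow p = A → holeForm p = T → f p = (A - c * (T - 3 / 4 * A)) ^ 2 *
      (exp (-(t * (s * T))) / 3 + exp (-(t * (y * A + (T - 3 / 4 * A) / y))) / 6) := by
    rintro p A T rfl rfl
    rfl
  have v00 : ∀ p, holeRow p = 0 → holeForm p = 0 → f p = 0 := by
    intro p h1 h2
    rw [hev p _ _ h1 h2]
    simp
  have v01 : ∀ p, holeRow p = 0 → holeForm p = 1 → f p = c ^ 2 * (E / 3 + a / 6) := by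
    intro p h1 h2
    rw [hev p _ _ h1 h2, ← hE, ← ha]
    push_cast
    ring_nf
  have v21 : ∀ p, holeRow p = 2 → holeForm p = 1 → f p = (2 + c / 2) ^ 2 * (E / 3 + b / 6) := by
    intro p h1 h2
    rw [hev p _ _ h1 h2, ← hE, ← hb]
    push_cast
    rw [show t * (y * 2 + (1 - 3 / 4 * 2) / y) = t * (2 * y - 1 / (2 * y)) by field_simp; ring]
    ring_nf
  have v02 : ∀ p, holeRow p = 0 → holeForm p = 2 →
      f p = 4 * c ^ 2 * (E ^ 2 / 3 + a ^ 2 / 6) := by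
    intro p h1 h2
    rw [hev p _ _ h1 h2, ← hE, ← ha, ← exp_nat_mul, ← exp_nat_mul]
    push_cast
    ring_nf
  have v22 : ∀ p, holeRow p = 2 → holeForm p = 2 →
      f p = (2 - c / 2) ^ 2 * (E ^ 2 / 3 + a * b / 6) := by
    intro p h1 h2
    rw [hev p _ _ h1 h2, ← hE, ← ha, ← hb, ← exp_nat_mul, ← exp_add]
    push_cast
    rw [show t * (y * 2 + (2 - 3 / 4 * 2) / y) = t / y + t * (2 * y - 1 / (2 * y)) by
      field_simp; ring]
    ring_nf
  set K := 2.8 * (36 * exp 2.55) * (E ^ 6 / 3 + a ^ 6 / 6) with hK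
  have hmain := tsum_le_finset_add_geometric hsum
    {(0, 0), (-1, 0), (0, -1), (1, -1), (-1, -1), (-1, 1), (1, 0), (-2, 0), (0, 1),
      (-2, 1), (1, -2), (0, -2), (-1, 2), (-2, 2), (2, -1), (-2, -1), (2, -2), (-1, -2), (1, 1),
      (-3, 1), (1, -3)} (K := K) (r := exp (-(1 / 2)))
    (by positivity) (exp_pos _).le (by rw [exp_lt_one_iff]; norm_num) fun p hp => by
      have h6 := six_le_holeForm hp
      have b1 := holeForm_sq_mul_exp_le hts h6
      have b2 := holeForm_sq_mul_exp_le hty h6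
      rw [hE] at b1
      rw [ha] at b2
      refine (hbig p (by omega)).trans ?_
      rw [hK]
      linarith
  repeat rw [Finset.sum_insert (by decide)] at hmain
  rw [Finset.sum_singleton] at hmain
  rw [v00 (0, 0) (by decide) (by decide), v00 (-1, 0) (by decide) (by decide),
    v00 (0, -1) (by decide) (by decide), v01 (1, -1) (by decide) (by decide),
    v01 (-1, -1) (by decide) (by decide), v21 (-1, 1) (by decide) (by decide),
    v02 (1, 0) (by decide) (by decide), v02 (-2, 0) (by decide) (by decide),
    v22 (0, 1) (by decide) (by decide), v22 (-2, 1) (by decide) (by decide),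
    v22 (1, -2) (by decide) (by decide), v22 (0, -2) (by decide) (by decide)] at hmain
  have f1 := hbigN (-1, 2) 4 le_rfl (by decide)
  have f2 := hbigN (-2, 2) 4 le_rfl (by decide)
  have f3 := hbigN (2, -1) 4 le_rfl (by decide)
  have f4 := hbigN (-2, -1) 4 le_rfl (by decide)
  have f5 := hbigN (2, -2) 4 le_rfl (by decide)
  have f6 := hbigN (-1, -2) 4 le_rfl (by decide)
  have f7 := hbigN (1, 1) 5 (by norm_num) (by decide)
  have f8 := hbigN (-3, 1) 5 (by norm_num) (by decide)
  have f9 := hbigN (1, -3) 5 (by norm_num) (by decide)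
  push_cast at f1 f2 f3 f4 f5 f6 f7 f8 f9
  have hr : exp (-(1 / 2)) ≤ 0.6069 :=
    exp_neg_le_of_one_le 250 (by norm_num) (by norm_num) (by norm_num)
  have hr0 := exp_pos (-(1 / 2) : ℝ)
  have hg : (1 + exp (-(1 / 2))) / (1 - exp (-(1 / 2))) ≤ 4.0878 := by
    rw [div_le_iff₀ (by linarith)]
    linarith
  have hg0 : 0 ≤ (1 + exp (-(1 / 2))) / (1 - exp (-(1 / 2)) : ℝ) :=
    div_nonneg (by linarith) (by linarith)
  have hg2 : ((1 + exp (-(1 / 2))) / (1 - exp (-(1 / 2)) : ℝ)) ^ 2 ≤ 16.711 :=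
    (pow_le_pow_left₀ hg0 hg 2).trans (by norm_num)
  have h255 : exp 2.55 ≤ 13 := exp_le_of_le_mul 250 (by norm_num) (by norm_num)
  have hKt : K * ((1 + exp (-(1 / 2))) / (1 - exp (-(1 / 2)))) ^ 2 ≤
      2.8 * (E ^ 6 / 3 + a ^ 6 / 6) * 7830 := by
    calc _ ≤ 2.8 * (36 * 13) * (E ^ 6 / 3 + a ^ 6 / 6) * 16.711 := by
          rw [hK]
          gcongr
      _ ≤ _ := by
          have : 0 < E ^ 6 / 3 + a ^ 6 / 6 := by positivity
          linarith
  clear_value f K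
  have hrest := add_le_add (add_le_add (add_le_add (add_le_add (add_le_add f1 f2)
    (add_le_add f3 f4)) (add_le_add f5 f6)) (add_le_add f7 f8)) f9
  linarith only [hmain, hrest, hKt]

end SkewSum

section SkewNumeric

theorem mul_exp_neg_le_of_le {t t0 q : ℝ} (h0 : 0 < t0) (h : t0 ≤ t) (hq : 1 ≤ t0 * q) :
    t * exp (-(t * q)) ≤ t0 * exp (-(t0 * q)) := by
  have h1 := le_mul_exp_sub_div (y := t) h0
  have h2 : (t - t0) / t0 ≤ (t - t0) * q := by
    rw [div_le_iff₀ h0]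
    nlinarith
  calc t * exp (-(t * q)) ≤ t0 * exp ((t - t0) * q) * exp (-(t * q)) := by
        gcongr
        exact h1.trans (by gcongr)
    _ = t0 * exp (-(t0 * q)) := by
        rw [mul_assoc, ← exp_add]
        congr 2
        ring

theorem mul_tsum_skew_error_le {c s t t0 y : ℝ} (hc : 0 ≤ c) (hc1 : c ≤ 4 / 3) (hs : 1 ≤ s)
    (ht0 : 1 ≤ t0) (ht : t0 ≤ t) (hy : 0 < y) (h : 3 / 4 ≤ y ^ 2) (hyt : y ≤ t0) :
    t * ∑' p, skewRate c p ^ 2 *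
        (exp (-(t * (s * holeForm p))) / 3 + exp (-(t * skewForm y p)) / 6) ≤
      t0 * ∑' p, skewRate c p ^ 2 *
        (exp (-(t0 * (s * holeForm p))) / 3 + exp (-(t0 * skewForm y p)) / 6) := by
  have hs0 : 0 < s := by linarith
  have ht00 : 0 < t0 := by linarith
  rw [← tsum_mul_left, ← tsum_mul_left]
  refine ((summable_skew_error hc hc1 hs0 (by linarith) hy h).mul_left t).tsum_le_tsum
    (fun p => ?_) ((summable_skew_error hc hc1 hs0 ht00 hy h).mul_left t0)
  rcases (holeForm_nonneg p).eq_or_lt' with h0 | h0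
  · have h1 := skewRate_sq_le hc hc1 p
    rw [h0] at h1
    have h2 : skewRate c p ^ 2 = 0 := le_antisymm (by simpa using h1) (sq_nonneg _)
    rw [h2]
    simp
  · have hT : (1 : ℝ) ≤ holeForm p := by exact_mod_cast h0
    have h1 : 1 ≤ t0 * (s * holeForm p) := by
      have : 1 ≤ s * holeForm p := one_le_mul_of_one_le_of_one_le hs hT
      exact one_le_mul_of_one_le_of_one_le ht0 this
    have h2 : 1 ≤ t0 * skewForm y p := by
      have h3 := holeForm_div_le_skewForm hy h p
      have h4 : 1 / y ≤ skewForm y p := le_trans (by gcongr) h3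
      have h5 : 1 ≤ t0 * (1 / y) := by
        rw [mul_one_div, le_div_iff₀ hy]
        linarith
      exact h5.trans (by gcongr)
    have e1 := mul_exp_neg_le_of_le ht00 ht h1
    have e2 := mul_exp_neg_le_of_le ht00 ht h2
    have := mul_le_mul_of_nonneg_left (add_le_add (div_le_div_of_nonneg_right e1
      (by norm_num : (0 : ℝ) ≤ 3)) (div_le_div_of_nonneg_right e2 (by norm_num : (0 : ℝ) ≤ 6)))
      (sq_nonneg (skewRate c p))
    linarith

/-- A bound for the circumcentre of an isosceles lattice in terms of numerical upper bounds `C`,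
`D`, `P`, `e`, `a`, `b` for the quantities governing the remainder. -/
theorem latticeTheta_half_circumcentre_lt_of_bounds {s y α t0 C D P e a b : ℝ} (hs0 : 1 ≤ s)
    (hs : s ^ 2 = 4 / 3) (hα : 0 < α) (hy : 3 / 4 * s < y) (ht0 : 2 ≤ t0) (ht : t0 ≤ π * α)
    (hyt : 2 * y ≤ t0) (hC : (s / y) ^ 2 ≤ C) (hD : (s / y) ^ 2 * exp (-(t0 / y)) ≤ D)
    (hP : (2 + s / y / 2) ^ 2 ≤ P) (he : exp (-(t0 * s)) ≤ e) (ha : exp (-(t0 / y)) ≤ a)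
    (hb : exp (-(t0 * (2 * y - 1 / (2 * y)))) ≤ b)
    (h : t0 * (2 * C * e / 3 + D / 3 + P * (e / 3 + b / 6) + 8 * C * e ^ 2 / 3 + 4 * D * a / 3 +
        16 * (e ^ 2 / 3 + a * b / 6) + 2.8 * ((96 * e ^ 4 + 75 * e ^ 5 + 7830 * e ^ 6) / 3 +
        (96 * a ^ 4 + 75 * a ^ 5 + 7830 * a ^ 6) / 6)) <
      3 / 4 * (1 / y + s / (6 * y ^ 2) + 1 / (12 * y ^ 3))) :
    latticeTheta (1 / 2) y
        (1 / 2 - 1 / 2 * (1 / 2 - 1 / (8 * y ^ 2)), 1 / 2 - 1 / (8 * y ^ 2)) α <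
      hexSum (π * α * s) (1 / 3, 1 / 3) := by
  have hs1 : 0 < s := by linarith
  have hy0 : 0 < y := by linarith
  have hy2 : 3 / 4 ≤ y ^ 2 := by nlinarith
  have hc : 0 ≤ s / y := by positivity
  have hc1 : s / y ≤ 4 / 3 := by rw [div_le_iff₀ hy0]; linarith
  refine latticeTheta_half_circumcentre_lt hs1 hs hα hy (lt_of_le_of_lt ?_ h)
  refine (mul_tsum_skew_error_le hc hc1 hs0 (by linarith) ht hy0 hy2 (by linarith)).trans ?_
  refine mul_le_mul_of_nonneg_left ?_ (by linarith)
  have ht00 : 0 < t0 := by linarith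
  refine (tsum_skew_error_le hc hc1 hs1 ht00 hy0 hy2 (by nlinarith)
    (by rw [le_div_iff₀ hy0]; linarith) rfl rfl rfl).trans ?_
  set c := s / y
  set E := exp (-(t0 * s))
  set A := exp (-(t0 / y))
  set B := exp (-(t0 * (2 * y - 1 / (2 * y))))
  have hE0 : 0 < E := exp_pos _
  have hA0 : 0 < A := exp_pos _
  have hB0 : 0 < B := exp_pos _
  have hM : (2 - c / 2) ^ 2 ≤ 4 := by nlinarith
  have hC0 : 0 ≤ C := (sq_nonneg _).trans hC
  have hD0 : 0 ≤ D := (by positivity : 0 ≤ c ^ 2 * A).trans hD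
  have hP0 : 0 ≤ P := (sq_nonneg _).trans hP
  have ha0 : 0 ≤ a := hA0.le.trans ha
  have i1 : c ^ 2 * E ≤ C * e := by gcongr
  have i2 : (2 + c / 2) ^ 2 * (E / 3 + B / 6) ≤ P * (e / 3 + b / 6) := by gcongr
  have i3 : c ^ 2 * E ^ 2 ≤ C * e ^ 2 := by gcongr
  have i4 : c ^ 2 * A * A ≤ D * a := by gcongr
  have i5 : 4 * (2 - c / 2) ^ 2 * (E ^ 2 / 3 + A * B / 6) ≤
      4 * 4 * (e ^ 2 / 3 + a * b / 6) := by gcongr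
  have i6 : 2.8 * ((96 * E ^ 4 + 75 * E ^ 5 + 7830 * E ^ 6) / 3 +
      (96 * A ^ 4 + 75 * A ^ 5 + 7830 * A ^ 6) / 6) ≤
      2.8 * ((96 * e ^ 4 + 75 * e ^ 5 + 7830 * e ^ 6) / 3 +
      (96 * a ^ 4 + 75 * a ^ 5 + 7830 * a ^ 6) / 6) := by gcongr
  have e1 : 2 * c ^ 2 * (E / 3 + A / 6) = 2 * (c ^ 2 * E) / 3 + c ^ 2 * A / 3 := by ring
  have e2 : 8 * c ^ 2 * (E ^ 2 / 3 + A ^ 2 / 6) =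
      8 * (c ^ 2 * E ^ 2) / 3 + 4 * (c ^ 2 * A * A) / 3 := by ring
  rw [e1, e2]
  have e3 : 2 * C * e / 3 = 2 * (C * e) / 3 := by ring
  have e4 : 8 * C * e ^ 2 / 3 = 8 * (C * e ^ 2) / 3 := by ring
  have e5 : 4 * D * a / 3 = 4 * (D * a) / 3 := by ring
  rw [e3, e4, e5]
  linarith only [i1, i2, i3, i4, i5, i6, hD]

theorem latticeTheta_half_circumcentre_lt_of_le {s y α : ℝ} (hs0 : 1.1547 ≤ s) (hs1 : s ≤ 1.1548)
    (hs : s ^ 2 = 4 / 3) (hα : 0.85 ≤ α) (hy : 3 / 4 * s < y)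
    (h : y ≤ 1.3 ∨ 4 ≤ α ∧ y ≤ 1.54) :
    latticeTheta (1 / 2) y
        (1 / 2 - 1 / 2 * (1 / 2 - 1 / (8 * y ^ 2)), 1 / 2 - 1 / (8 * y ^ 2)) α <
      hexSum (π * α * s) (1 / 3, 1 / 3) := by
  have hπ := pi_gt_d6
  have hy0 : 0 < y := by linarith
  have hα0 : 0 < α := by linarith
  have hu0 : 0 < 1 / y := by positivity
  have hc1 : s / y ≤ 4 / 3 := by rw [div_le_iff₀ hy0]; linarith
  have hc0 : 0 ≤ s / y := by positivity
  have hC : (s / y) ^ 2 ≤ 16 / 9 := (pow_le_pow_left₀ hc0 hc1 2).trans (by norm_num)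
  have hP : (2 + s / y / 2) ^ 2 ≤ 64 / 9 :=
    (pow_le_pow_left₀ (by positivity) (by linarith : 2 + s / y / 2 ≤ 8 / 3) 2).trans (by norm_num)
  have hE : exp (-(2.67 * s)) ≤ 0.0468 :=
    (exp_le_exp.2 (by linarith : -(2.67 * s) ≤ -3.083)).trans
      (exp_neg_le_of_one_le 250 (by norm_num) (by norm_num) (by norm_num))
  have hB : ∀ t : ℝ, 0 ≤ t → exp (-(t * (2 * y - 1 / (2 * y)))) ≤ exp (-(t * s)) := by
    intro t ht
    rw [exp_le_exp, neg_le_neg_iff]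
    refine mul_le_mul_of_nonneg_left ?_ ht
    have h1 : 1 / (2 * y) ≤ s / 2 := by
      rw [div_le_iff₀ (by positivity)]
      nlinarith
    linarith
  have hsq : ∀ y1 : ℝ, 0 < y1 → y ≤ y1 → 2 * y1 ≤ 2.67 → (s / y) ^ 2 * exp (-(2.67 / y)) ≤
      4 / 3 / y1 ^ 2 * exp (-(2.67 / y1)) := by
    intro y1 h1 h2 h3
    have h4 := pow_le_pow_left₀ hu0.le (le_mul_exp_sub_div (y := 1 / y) (a := 1 / y1)
      (by positivity)) 2
    rw [mul_pow, ← exp_nat_mul] at h4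
    have h5 : (2 : ℕ) * ((1 / y - 1 / y1) / (1 / y1)) ≤ 2.67 / y - 2.67 / y1 := by
      have : 0 ≤ 1 / y - 1 / y1 := sub_nonneg.2 (one_div_le_one_div_of_le hy0 h2)
      rw [div_div_eq_mul_div, div_one, show (2.67 : ℝ) / y - 2.67 / y1 = 2.67 * (1 / y - 1 / y1) by
        ring]
      push_cast
      nlinarith
    calc (s / y) ^ 2 * exp (-(2.67 / y)) = 4 / 3 * (1 / y) ^ 2 * exp (-(2.67 / y)) := by
          rw [div_pow, hs]; ring
      _ ≤ 4 / 3 * ((1 / y1) ^ 2 * exp (2.67 / y - 2.67 / y1)) * exp (-(2.67 / y)) := by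
          gcongr
          exact h4.trans (by gcongr)
      _ = 4 / 3 / y1 ^ 2 * (exp (2.67 / y - 2.67 / y1) * exp (-(2.67 / y))) := by ring
      _ = _ := by
          rw [← exp_add]
          congr 2
          ring
  have hA : ∀ t y1 : ℝ, 0 ≤ t → y ≤ y1 → exp (-(t / y)) ≤ exp (-(t / y1)) := by
    intro t y1 h1 h2
    rw [exp_le_exp, neg_le_neg_iff]
    gcongr
  have hR : ∀ y1 : ℝ, 0 < y1 → y ≤ y1 →
      3 / 4 * (1 / y1 + 1.1547 / (6 * y1 ^ 2) + 1 / (12 * y1 ^ 3)) ≤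
      3 / 4 * (1 / y + s / (6 * y ^ 2) + 1 / (12 * y ^ 3)) := by
    intro y1 h1 h2
    gcongr
  rcases le_or_gt y 1.1 with h1 | h1
  · have ha : exp (-(2.67 / 1.1)) ≤ 0.0895 :=
      exp_neg_le_of_one_le 250 (by norm_num) (by norm_num) (by norm_num)
    refine latticeTheta_half_circumcentre_lt_of_bounds (t0 := 2.67) (C := 16 / 9)
      (D := 4 / 3 / 1.1 ^ 2 * 0.0895) (P := 64 / 9) (e := 0.0468) (a := 0.0895) (b := 0.0468)
      (by linarith) hs hα0 hy (by norm_num) (by nlinarith) (by linarith) hC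
      ((hsq 1.1 (by norm_num) h1 (by norm_num)).trans (by gcongr)) hP hE
      ((hA 2.67 1.1 (by norm_num) h1).trans ha) ((hB _ (by norm_num)).trans hE)
      (lt_of_lt_of_le ?_ (hR 1.1 (by norm_num) h1))
    norm_num
  rcases le_or_gt y 1.3 with h2 | h2
  · have ha : exp (-(2.67 / 1.3)) ≤ 0.1294 :=
      exp_neg_le_of_one_le 250 (by norm_num) (by norm_num) (by norm_num)
    have hc2 : s / y ≤ 1.05 := by rw [div_le_iff₀ hy0]; linarith
    have hb : exp (-(2.67 * (2 * y - 1 / (2 * y)))) ≤ 0.01 := by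
      have h3 : 1 / (2 * y) ≤ 0.455 := by rw [div_le_iff₀ (by positivity)]; linarith
      exact (exp_le_exp.2 (by linarith : -(2.67 * (2 * y - 1 / (2 * y))) ≤ -4.659)).trans
        (exp_neg_le_of_one_le 250 (by norm_num) (by norm_num) (by norm_num))
    refine latticeTheta_half_circumcentre_lt_of_bounds (t0 := 2.67) (C := 1.05 ^ 2)
      (D := 4 / 3 / 1.3 ^ 2 * 0.1294) (P := (2 + 1.05 / 2) ^ 2) (e := 0.0468) (a := 0.1294)
      (b := 0.01)
      (by linarith) hs hα0 hy (by norm_num) (by nlinarith) (by linarith) (by gcongr)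
      ((hsq 1.3 (by norm_num) h2 (by norm_num)).trans (by gcongr)) (by gcongr) hE
      ((hA 2.67 1.3 (by norm_num) h2).trans ha) hb
      (lt_of_lt_of_le ?_ (hR 1.3 (by norm_num) h2))
    norm_num
  · obtain h | ⟨h4, h5⟩ := h
    · linarith
    have he : exp (-(12.5 * s)) ≤ 0.0005 :=
      (exp_le_exp.2 (by linarith : -(12.5 * s) ≤ -8)).trans
        (exp_neg_le_of_one_le 250 (by norm_num) (by norm_num) (by norm_num))
    have ha : exp (-(12.5 / 1.54)) ≤ 0.0005 :=
      exp_neg_le_of_one_le 250 (by norm_num) (by norm_num) (by norm_num)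
    have ha' := (hA 12.5 1.54 (by norm_num) h5).trans ha
    refine latticeTheta_half_circumcentre_lt_of_bounds (t0 := 12.5) (C := 16 / 9)
      (D := 16 / 9 * 0.0005) (P := 64 / 9) (e := 0.0005) (a := 0.0005) (b := 0.0005)
      (by linarith) hs hα0 hy (by norm_num) (by nlinarith) (by linarith) hC
      (by gcongr) hP he ha' ((hB _ (by norm_num)).trans he)
      (lt_of_lt_of_le ?_ (hR 1.54 (by norm_num) h5))
    norm_num

end SkewNumeric

section HoleComparison

theorem one_sub_add_sq_le_exp_neg {d : ℝ} (hd : d ≤ 1.68) :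
    1 - d + 0.29 * d ^ 2 ≤ exp (-d) := by
  obtain h | h := le_total d 0
  · have := quadratic_le_exp_of_nonneg (x := -d) (by linarith)
    nlinarith [sq_nonneg d]
  · refine le_trans ?_ (one_sub_div_pow_le_exp_neg (n := 8) (by norm_num; linarith))
    have h2 : 0 ≤ 0.1475 - 0.109375 * d + 0.01708984375 * d ^ 2 - 0.001708984375 * d ^ 3 := by
      nlinarith [mul_nonneg h h, mul_nonneg (mul_nonneg h h) (sub_nonneg.2 hd),
        sq_nonneg (d - 1.68)]
    have h4 : 0 ≤ d ^ 4 * (70 / 8 ^ 4 - 56 / 8 ^ 5 * d + 28 / 8 ^ 6 * d ^ 2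
        - 8 / 8 ^ 7 * d ^ 3 + 1 / 8 ^ 8 * d ^ 4) := by
      have : 0 ≤ d ^ 2 * (28 / 8 ^ 6 - 8 / 8 ^ 7 * d) :=
        mul_nonneg (sq_nonneg d) (by linarith)
      refine mul_nonneg (by positivity) ?_
      have : 0 ≤ 1 / 8 ^ 8 * d ^ 4 := by positivity
      nlinarith
    have h3 : 0 ≤ d ^ 2 *
        (0.1475 - 0.109375 * d + 0.01708984375 * d ^ 2 - 0.001708984375 * d ^ 3) :=
      mul_nonneg (sq_nonneg d) h2
    push_cast
    nlinarith

/-- The values `1, -1/2` at dual vectors of the Fourier phase of the deep hole `(1/3, 1/3)`. -/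
noncomputable def holeChar (p : ℤ × ℤ) : ℝ := if (3 : ℤ) ∣ p.1 + p.2 then 1 else -(1 / 2)

/-- The binary form taking the values `a`, `b`, `c` at `(1, 0)`, `(0, 1)`, `(1, 1)`. -/
def triForm (a b c : ℝ) (p : ℤ × ℤ) : ℝ :=
  a * (p.1 * (p.1 - p.2)) + b * (p.2 * (p.2 - p.1)) + c * (p.1 * p.2)

/-- The order three rotation of the hexagonal lattice. -/
def triRot : ℤ × ℤ ≃ ℤ × ℤ where
  toFun p := (-p.2, p.1 - p.2)
  invFun p := (p.2 - p.1, -p.1)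
  left_inv p := by ext <;> simp
  right_inv p := by ext <;> simp

theorem abs_holeChar_le (p : ℤ × ℤ) : |holeChar p| ≤ 1 := by
  unfold holeChar
  split_ifs <;> norm_num [abs_le]

theorem holeChar_triRot (p : ℤ × ℤ) : holeChar (triRot p) = holeChar p := by
  have : (3 : ℤ) ∣ (triRot p).1 + (triRot p).2 ↔ (3 : ℤ) ∣ p.1 + p.2 := by
    simp only [triRot, Equiv.coe_fn_mk]
    omega
  simp only [holeChar, this]

theorem triForm_triRot (a b c : ℝ) (p : ℤ × ℤ) : triForm a b c (triRot p) = triForm b c a p := by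
  simp only [triForm, triRot, Equiv.coe_fn_mk]
  push_cast
  ring

theorem triForm_one_ge (p : ℤ × ℤ) :
    1 / 2 * ((p.1 : ℝ) ^ 2 + (p.2 : ℝ) ^ 2) ≤ triForm 1 1 1 p := by
  unfold triForm
  nlinarith [sq_nonneg ((p.1 : ℝ) - p.2)]

theorem triForm_one_eq_cast (p : ℤ × ℤ) :
    triForm 1 1 1 p = ((p.1 ^ 2 - p.1 * p.2 + p.2 ^ 2 : ℤ) : ℝ) := by
  unfold triForm
  push_cast
  ring

theorem sq_triForm_le (a b c : ℝ) (p : ℤ × ℤ) :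
    triForm a b c p ^ 2 ≤ (a ^ 2 + b ^ 2 + c ^ 2) * triForm 1 1 1 p ^ 2 := by
  unfold triForm
  set u : ℝ := p.1 * (p.1 - p.2)
  set v : ℝ := p.2 * (p.2 - p.1) with hv
  set w : ℝ := p.1 * p.2
  have h : u * v + v * w + w * u = 0 := by simp only [u, v, w]; ring
  nlinarith [sq_nonneg (a * v - b * u), sq_nonneg (b * w - c * v), sq_nonneg (c * u - a * w)]

theorem summable_holeChar_mul_triForm (a b c : ℝ) {t : ℝ} (ht : 0 < t) :
    Summable fun p => holeChar p * triForm a b c p * exp (-(t * triForm 1 1 1 p)) := by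
  refine summable_sq_mul_exp_neg (c := t / 2) (C := 0) (K := 2 * (|a| + |b| + |c|))
    (by positivity) (fun p => ?_) fun p => ?_
  · nlinarith [triForm_one_ge p]
  · rw [abs_mul]
    refine (mul_le_of_le_one_left (abs_nonneg _) (abs_holeChar_le p)).trans ?_
    set r : ℝ := (p.1 : ℝ) ^ 2 + (p.2 : ℝ) ^ 2 with hr
    have hr0 : 0 ≤ r := by positivity
    have h1 : |(p.1 : ℝ) * (p.1 - p.2)| ≤ 2 * r := by
      rw [abs_le]; constructor <;> nlinarith [sq_nonneg ((p.1 : ℝ) - p.2), sq_nonneg ((p.1 : ℝ) + p.2)]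
    have h2 : |(p.2 : ℝ) * (p.2 - p.1)| ≤ 2 * r := by
      rw [abs_le]; constructor <;> nlinarith [sq_nonneg ((p.1 : ℝ) - p.2), sq_nonneg ((p.1 : ℝ) + p.2)]
    have h3 : |(p.1 : ℝ) * p.2| ≤ 2 * r := by
      rw [abs_le]; constructor <;> nlinarith [sq_nonneg ((p.1 : ℝ) - p.2), sq_nonneg ((p.1 : ℝ) + p.2)]
    have h4 : 2 * r ≤ 2 * (r + 1) ^ 2 := by nlinarith
    calc |triForm a b c p| ≤ |a| * (2 * r) + |b| * (2 * r) + |c| * (2 * r) := by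
          unfold triForm
          refine (abs_add_three _ _ _).trans ?_
          simp only [abs_mul a, abs_mul b, abs_mul c]
          gcongr
      _ = (|a| + |b| + |c|) * (2 * r) := by ring
      _ ≤ (|a| + |b| + |c|) * (2 * (r + 1) ^ 2) := by gcongr
      _ = _ := by ring

theorem tsum_holeChar_mul_triForm (a b c : ℝ) {t : ℝ} (ht : 0 < t) :
    ∑' p, holeChar p * triForm a b c p * exp (-(t * triForm 1 1 1 p)) =
      (a + b + c) / 3 * ∑' p, holeChar p * triForm 1 1 1 p * exp (-(t * triForm 1 1 1 p)) := by
  have hrot : ∀ a b c : ℝ,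
      ∑' p, holeChar p * triForm a b c p * exp (-(t * triForm 1 1 1 p)) =
        ∑' p, holeChar p * triForm b c a p * exp (-(t * triForm 1 1 1 p)) := fun a b c => by
    rw [← triRot.tsum_eq]
    simp only [holeChar_triRot, triForm_triRot]
  have h1 := summable_holeChar_mul_triForm a b c ht
  have h2 := summable_holeChar_mul_triForm b c a ht
  have h3 := summable_holeChar_mul_triForm c a b ht
  have h : (a + b + c) * ∑' p, holeChar p * triForm 1 1 1 p * exp (-(t * triForm 1 1 1 p)) =
      ∑' p, holeChar p * triForm a b c p * exp (-(t * triForm 1 1 1 p)) +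
        ∑' p, holeChar p * triForm b c a p * exp (-(t * triForm 1 1 1 p)) +
        ∑' p, holeChar p * triForm c a b p * exp (-(t * triForm 1 1 1 p)) := by
    rw [← h1.tsum_add h2, ← (h1.add h2).tsum_add h3, ← tsum_mul_left]
    refine tsum_congr fun p => ?_
    unfold triForm
    ring
  linarith [hrot a b c, hrot b c a]

/-- The six minimal vectors of the hexagonal lattice. -/
def triSix : Finset (ℤ × ℤ) := {(1, 0), (-1, 0), (0, 1), (0, -1), (1, 1), (-1, -1)}

theorem four_le_triForm {p : ℤ × ℤ} (hp : p ∉ triSix) (h3 : ¬ (3 : ℤ) ∣ p.1 + p.2) :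
    4 ≤ triForm 1 1 1 p := by
  have h4 : 4 ≤ p.1 ^ 2 - p.1 * p.2 + p.2 ^ 2 := by
    obtain ⟨m, k⟩ := p
    by_contra hlt
    push Not at hlt
    have hm1 : m < 3 := by nlinarith [sq_nonneg (m - 2 * k)]
    have hm2 : -3 < m := by nlinarith [sq_nonneg (m - 2 * k)]
    have hk1 : k < 3 := by nlinarith [sq_nonneg (k - 2 * m)]
    have hk2 : -3 < k := by nlinarith [sq_nonneg (k - 2 * m)]
    interval_cases m <;> interval_cases k <;> revert hp hlt h3 <;> decide
  rw [triForm_one_eq_cast]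
  exact_mod_cast h4

/-- The origin and the six vectors of norm three of the hexagonal lattice. -/
def triSeven : Finset (ℤ × ℤ) :=
  {(0, 0), (2, 1), (-2, -1), (1, 2), (-1, -2), (1, -1), (-1, 1)}

theorem nine_le_triForm {p : ℤ × ℤ} (hp : p ∉ triSeven) (h3 : (3 : ℤ) ∣ p.1 + p.2) :
    9 ≤ triForm 1 1 1 p := by
  have h4 : 9 ≤ p.1 ^ 2 - p.1 * p.2 + p.2 ^ 2 := by
    obtain ⟨m, k⟩ := p
    by_contra hlt
    push Not at hlt
    have hm1 : m < 4 := by nlinarith [sq_nonneg (m - 2 * k)]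
    have hm2 : -4 < m := by nlinarith [sq_nonneg (m - 2 * k)]
    have hk1 : k < 4 := by nlinarith [sq_nonneg (k - 2 * m)]
    have hk2 : -4 < k := by nlinarith [sq_nonneg (k - 2 * m)]
    interval_cases m <;> interval_cases k <;> revert hp hlt h3 <;> decide
  rw [triForm_one_eq_cast]
  exact_mod_cast h4

theorem neg_tsum_holeChar_mul_triForm_le {t : ℝ} (ht : 4.26 ≤ t) :
    -∑' p, holeChar p * triForm 1 1 1 p * exp (-(t * triForm 1 1 1 p)) ≤ 3.03 * exp (-t) := by
  have ht0 : 0 < t := by linarith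
  set q := exp (-t) with hq
  set f : ℤ × ℤ → ℝ :=
    fun p => -(holeChar p * triForm 1 1 1 p * exp (-(t * triForm 1 1 1 p))) with hf
  have hs : Summable f := (summable_holeChar_mul_triForm 1 1 1 ht0).neg
  have h := tsum_le_finset_add_geometric hs triSix (K := 0.0009 * q) (r := exp (-0.4))
    (by positivity) (exp_pos _).le (by rw [exp_lt_one_iff]; norm_num) fun p hp => by
      have hK : 0 ≤ 0.0009 * q * (exp (-0.4) ^ p.1.natAbs * exp (-0.4) ^ p.2.natAbs) := by
        positivity
      have hT0 : 0 ≤ triForm 1 1 1 p := le_trans (by positivity) (triForm_one_ge p)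
      by_cases h3 : (3 : ℤ) ∣ p.1 + p.2
      · simp only [hf, holeChar, if_pos h3]
        have : 0 ≤ 1 * triForm 1 1 1 p * exp (-(t * triForm 1 1 1 p)) := by positivity
        linarith
      · simp only [hf, holeChar, if_neg h3]
        have h4 := four_le_triForm hp h3
        have h1 := triForm_one_ge p
        set T := triForm 1 1 1 p
        have h5 := exp_neg_sq_add_sq_le_pow (b := 0.4) (by norm_num) p
        have h6 : T * exp (-(t * T)) ≤
            q * exp (-6.52) * exp (-(0.4 * ((p.1 : ℝ) ^ 2 + (p.2 : ℝ) ^ 2))) := by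
          have hT : T ≤ exp (T - 1) := by linarith [add_one_le_exp (T - 1)]
          refine (mul_le_mul_of_nonneg_right hT (exp_pos _).le).trans ?_
          rw [hq, ← exp_add, ← exp_add, ← exp_add, exp_le_exp]
          nlinarith [mul_nonneg (sub_nonneg.2 ht) (by linarith : 0 ≤ T - 1)]
        have h7 : exp (-6.52) ≤ 0.0018 :=
          exp_neg_le_of_one_le 250 (by norm_num) (by norm_num) (by norm_num)
        have h8 : q * exp (-6.52) * exp (-(0.4 * ((p.1 : ℝ) ^ 2 + (p.2 : ℝ) ^ 2))) ≤
            q * 0.0018 * (exp (-0.4) ^ p.1.natAbs * exp (-0.4) ^ p.2.natAbs) := by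
          gcongr
        linarith
  have hsum : ∑ p ∈ triSix, f p = 3 * q := by
    rw [triSix]
    repeat rw [Finset.sum_insert (by decide)]
    rw [Finset.sum_singleton]
    simp only [hf, holeChar, triForm]
    norm_num
    rw [← hq]
    ring
  rw [hsum, tsum_neg] at h
  have hr : exp (-0.4) ≤ 0.671 :=
    exp_neg_le_of_one_le 200 (by norm_num) (by norm_num) (by norm_num)
  have hg : (1 + exp (-0.4)) / (1 - exp (-0.4)) ≤ 5.1 := by
    rw [div_le_iff₀ (by linarith)]
    linarith
  have hg0 : 0 ≤ (1 + exp (-0.4)) / (1 - exp (-0.4)) :=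
    div_nonneg (by linarith [exp_pos (-0.4)]) (by linarith)
  have hg2 : ((1 + exp (-0.4)) / (1 - exp (-0.4))) ^ 2 ≤ 5.1 ^ 2 := by gcongr
  have hq0 : 0 < q := exp_pos _
  have h8 : 0.0009 * q * ((1 + exp (-0.4)) / (1 - exp (-0.4))) ^ 2 ≤ 0.0009 * q * 5.1 ^ 2 := by
    gcongr
  linarith

/-- The remainder of the second order expansion at the vectors of the index three sublattice. -/
noncomputable def triRemainder (t v : ℝ) (p : ℤ × ℤ) : ℝ :=
  if (3 : ℤ) ∣ p.1 + p.2 then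
    triForm 1 1 1 p ^ 2 * (exp (-(t * triForm 1 1 1 p)) / 3 + exp (-(v * triForm 1 1 1 p)) / 6)
  else 0

theorem summable_triRemainder {t v : ℝ} (ht : 0 < t) (hv : 0 < v) :
    Summable (triRemainder t v) := by
  have h1 : ∀ t : ℝ, 0 < t →
      Summable fun p => triForm 1 1 1 p ^ 2 * exp (-(t * triForm 1 1 1 p)) := fun t ht => by
    refine summable_sq_mul_exp_neg (c := t / 2) (C := 0) (K := 4)
      (by positivity) (fun p => ?_) fun p => ?_
    · nlinarith [triForm_one_ge p]
    · rw [abs_of_nonneg (sq_nonneg _), show (4 : ℝ) = 2 ^ 2 by norm_num, ← mul_pow]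
      refine pow_le_pow_left₀ (le_trans (by positivity) (triForm_one_ge p)) ?_ 2
      unfold triForm
      nlinarith [sq_nonneg ((p.1 : ℝ) + p.2)]
  refine Summable.of_norm_bounded (((h1 t ht).div_const 3).add ((h1 v hv).div_const 6)) fun p => ?_
  unfold triRemainder
  split_ifs
  · rw [norm_eq_abs, abs_of_nonneg (by positivity)]
    exact le_of_eq (by ring)
  · rw [norm_zero]
    positivity

theorem tsum_triRemainder_le {B s : ℝ} (hB : 3.695 ≤ B) (hs : 1.1547 ≤ s) (hs' : s ≤ 1.1548) :
    ∑' p, triRemainder (B * s) (0.885 * B) p ≤ 0.045 * exp (-(B * s)) := by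
  have hB0 : 0 < B := by linarith
  set q := exp (-(B * s)) with hq
  set v := 0.885 * B with hv
  have hBs : B * s ≤ 1.1548 * B := by nlinarith
  have hBs' : 1.1547 * B ≤ B * s := by nlinarith
  have h := tsum_le_finset_add_geometric
    (summable_triRemainder (t := B * s) (v := v) (by nlinarith) (by linarith)) triSeven
    (K := 0.00006 * q) (r := exp (-0.378))
    (by positivity) (exp_pos _).le (by rw [exp_lt_one_iff]; norm_num) fun p hp => by
      have hK : 0 ≤ 0.00006 * q * (exp (-0.378) ^ p.1.natAbs * exp (-0.378) ^ p.2.natAbs) := by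
        positivity
      unfold triRemainder
      split_ifs with h3
      · have h4 := nine_le_triForm hp h3
        have h1 := triForm_one_ge p
        set T := triForm 1 1 1 p
        have h5 := exp_neg_sq_add_sq_le_pow (b := 0.378) (by norm_num) p
        have hT : T ^ 2 ≤ exp T := by
          have := sum_le_exp_of_nonneg (x := T) (by linarith) 5
          simp only [Finset.sum_range_succ, Finset.sum_range_zero, Nat.factorial] at this
          norm_num at this
          nlinarith [mul_nonneg (sq_nonneg T) (by nlinarith : 0 ≤ T ^ 2 - 81)]
        have h6 : exp (-(B * s * T)) ≤ exp (-(v * T)) := by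
          rw [exp_le_exp]
          nlinarith
        have h7 : T ^ 2 * exp (-(v * T)) ≤
            q * exp (-9.3) * exp (-(0.378 * ((p.1 : ℝ) ^ 2 + (p.2 : ℝ) ^ 2))) := by
          refine (mul_le_mul_of_nonneg_right hT (exp_pos _).le).trans ?_
          rw [hq, ← exp_add, ← exp_add, ← exp_add, exp_le_exp]
          nlinarith [mul_nonneg (sub_nonneg.2 hB) (by linarith : 0 ≤ T - 9)]
        have h8 : exp (-9.3) ≤ 0.00012 :=
          exp_neg_le_of_one_le 250 (by norm_num) (by norm_num) (by norm_num)
        have h9 : q * exp (-9.3) * exp (-(0.378 * ((p.1 : ℝ) ^ 2 + (p.2 : ℝ) ^ 2))) ≤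
            q * 0.00012 * (exp (-0.378) ^ p.1.natAbs * exp (-0.378) ^ p.2.natAbs) := by
          gcongr
        have h10 := mul_le_mul_of_nonneg_left h6 (sq_nonneg T)
        linarith
      · exact hK
  have hsum : ∑ p ∈ triSeven, triRemainder (B * s) v p =
      54 * (exp (-(B * s * 3)) / 3 + exp (-(v * 3)) / 6) := by
    rw [triSeven]
    repeat rw [Finset.sum_insert (by decide)]
    rw [Finset.sum_singleton]
    simp only [triRemainder, triForm]
    norm_num
    ring
  rw [hsum] at h
  have he1 : exp (-(B * s * 3)) ≤ q * 0.00025 := by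
    have : exp (-(8.5)) ≤ 0.00025 :=
      exp_neg_le_of_one_le 250 (by norm_num) (by norm_num) (by norm_num)
    calc exp (-(B * s * 3)) ≤ q * exp (-8.5) := by
          rw [hq, ← exp_add, exp_le_exp]
          linarith
      _ ≤ _ := by gcongr
  have he2 : exp (-(v * 3)) ≤ q * 0.0042 := by
    have : exp (-(5.54)) ≤ 0.0042 :=
      exp_neg_le_of_one_le 250 (by norm_num) (by norm_num) (by norm_num)
    calc exp (-(v * 3)) ≤ q * exp (-5.54) := by
          rw [hq, ← exp_add, exp_le_exp]
          linarith
      _ ≤ _ := by gcongr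
  have hr : exp (-0.378) ≤ 0.687 :=
    exp_neg_le_of_one_le 200 (by norm_num) (by norm_num) (by norm_num)
  have hg : (1 + exp (-0.378)) / (1 - exp (-0.378)) ≤ 5.5 := by
    rw [div_le_iff₀ (by linarith)]
    linarith
  have hg0 : 0 ≤ (1 + exp (-0.378)) / (1 - exp (-0.378)) :=
    div_nonneg (by linarith [exp_pos (-0.378)]) (by linarith)
  have hg2 : ((1 + exp (-0.378)) / (1 - exp (-0.378))) ^ 2 ≤ 5.5 ^ 2 := by gcongr
  have hq0 : 0 < q := exp_pos _
  have h8 : 0.00006 * q * ((1 + exp (-0.378)) / (1 - exp (-0.378))) ^ 2 ≤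
      0.00006 * q * 5.5 ^ 2 := by
    gcongr
  linarith

end HoleComparison

section HoleStrict

theorem summable_holeChar_mul_exp_neg {Q : ℤ × ℤ → ℝ} {v : ℝ} (hv : 0 < v)
    (h : ∀ p, v * triForm 1 1 1 p ≤ Q p) : Summable fun p => holeChar p * exp (-Q p) := by
  have hs : Summable fun p => exp (-Q p) :=
    summable_exp_neg_of_le (c := v / 2) (C := 0) (by positivity) fun p => by
      nlinarith [triForm_one_ge p, h p]
  refine hs.of_norm_bounded fun p => ?_
  rw [norm_mul, norm_eq_abs, norm_eq_abs, abs_of_pos (exp_pos _)]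
  exact mul_le_of_le_one_left (exp_pos _).le (abs_holeChar_le p)

theorem holeChar_mul_exp_neg_le {t v a b c : ℝ} (ha : a ≤ 1.68) (hb : b ≤ 1.68) (hc : c ≤ 1.68)
    (p : ℤ × ℤ) (h : v * triForm 1 1 1 p ≤ t * triForm 1 1 1 p + triForm a b c p) :
    holeChar p * exp (-(t * triForm 1 1 1 p + triForm a b c p)) ≤
      holeChar p * exp (-(t * triForm 1 1 1 p)) -
        holeChar p * triForm a b c p * exp (-(t * triForm 1 1 1 p)) +
        (a ^ 2 + b ^ 2 + c ^ 2) * triRemainder t v p -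
        if p ∈ triSix then 0.145 * exp (-t) * triForm a b c p ^ 2 else 0 := by
  set T := triForm 1 1 1 p with hT
  set d := triForm a b c p with hd
  have hE := exp_pos (-(t * T))
  have hexp : exp (-(t * T + d)) = exp (-(t * T)) * exp (-d) := by rw [← exp_add]; ring_nf
  by_cases h3 : (3 : ℤ) ∣ p.1 + p.2
  · have h6 : p ∉ triSix := by
      intro hp
      simp only [triSix, Finset.mem_insert, Finset.mem_singleton] at hp
      rcases hp with rfl | rfl | rfl | rfl | rfl | rfl <;> revert h3 <;> decide
    simp only [holeChar, triRemainder, if_pos h3, if_neg h6]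
    have h1 := exp_sub_one_sub_le (-d)
    have h2 : d ^ 2 ≤ (a ^ 2 + b ^ 2 + c ^ 2) * T ^ 2 := sq_triForm_le a b c p
    have h4 : exp (-(t * T + d)) ≤ exp (-(v * T)) := exp_le_exp.2 (by linarith)
    have h5 : exp (-(t * T)) * exp (-d) ≤
        exp (-(t * T)) * (1 - d + d ^ 2 * (1 / 3 + exp (-d) / 6)) :=
      mul_le_mul_of_nonneg_left (by linarith) hE.le
    have h7 : d ^ 2 * (exp (-(t * T)) / 3 + exp (-(t * T + d)) / 6) ≤
        (a ^ 2 + b ^ 2 + c ^ 2) * T ^ 2 * (exp (-(t * T)) / 3 + exp (-(v * T)) / 6) := by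
      gcongr
    rw [hexp] at h7 ⊢
    linarith
  · by_cases h6 : p ∈ triSix
    · have hT1 : T = 1 ∧ d ≤ 1.68 := by
        rw [hT, hd]
        simp only [triSix, Finset.mem_insert, Finset.mem_singleton] at h6
        rcases h6 with rfl | rfl | rfl | rfl | rfl | rfl <;> simp only [triForm] <;>
          constructor <;> push_cast <;> linarith
      simp only [holeChar, triRemainder, if_neg h3, if_pos h6]
      rw [hexp, hT1.1, mul_one]
      have := mul_le_mul_of_nonneg_left (one_sub_add_sq_le_exp_neg hT1.2) (exp_pos (-t)).le
      linarith
    · simp only [holeChar, triRemainder, if_neg h3, if_neg h6]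
      rw [hexp]
      have := mul_le_mul_of_nonneg_left (add_one_le_exp (-d)) hE.le
      linarith

theorem tsum_holeChar_lt {B s a b c : ℝ} (hB : 3.695 ≤ B) (hs : 1.1547 ≤ s) (hs' : s ≤ 1.1548)
    (ha : a ≤ 1.68) (hb : b ≤ 1.68) (hc : c ≤ 1.68) (ha0 : a < 0)
    (h : ∀ p, 0.885 * B * triForm 1 1 1 p ≤ B * s * triForm 1 1 1 p + triForm a b c p)
    (hsum : 0 ≤ a + b + c) (hsum' : B * s * (a + b + c) ≤ a ^ 2 + b ^ 2 + c ^ 2) :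
    ∑' p, holeChar p * exp (-(B * s * triForm 1 1 1 p + triForm a b c p)) <
      ∑' p, holeChar p * exp (-(B * s * triForm 1 1 1 p)) := by
  set t := B * s with ht
  have ht1 : 4.266 ≤ t := by nlinarith
  have ht0 : 0 < t := by linarith
  have hv0 : 0 < 0.885 * B := by linarith
  set D := a ^ 2 + b ^ 2 + c ^ 2 with hD
  have hD0 : 0 < D := by nlinarith [sq_nonneg b, sq_nonneg c]
  have s1 := summable_holeChar_mul_exp_neg hv0 h
  have s2 := summable_holeChar_mul_exp_neg (Q := fun p => t * triForm 1 1 1 p) ht0 fun _ => le_rfl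
  have s3 := summable_holeChar_mul_triForm a b c ht0
  have s4 := (summable_triRemainder ht0 hv0).mul_left D
  have s5 : Summable fun p =>
      if p ∈ triSix then 0.145 * exp (-t) * triForm a b c p ^ 2 else 0 :=
    summable_of_ne_finset_zero (s := triSix) fun p hp => if_neg hp
  have hle := s1.tsum_le_tsum
    (fun p => holeChar_mul_exp_neg_le ha hb hc p (h p)) (((s2.sub s3).add s4).sub s5)
  rw [((s2.sub s3).add s4).tsum_sub s5, (s2.sub s3).tsum_add s4, s2.tsum_sub s3, tsum_mul_left,
    tsum_holeChar_mul_triForm a b c ht0] at hle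
  have h5 : (∑' p, if p ∈ triSix then 0.145 * exp (-t) * triForm a b c p ^ 2 else 0) =
      0.29 * exp (-t) * D := by
    rw [tsum_eq_sum (s := triSix) fun p hp => if_neg hp,
      Finset.sum_congr rfl fun p hp => if_pos hp, triSix]
    repeat rw [Finset.sum_insert (by decide)]
    rw [Finset.sum_singleton]
    simp only [triForm, hD]
    push_cast
    ring
  rw [h5] at hle
  have h6 := mul_le_mul_of_nonneg_left (tsum_triRemainder_le hB hs hs') hD0.le
  have h7 := mul_le_mul_of_nonneg_left
    (neg_tsum_holeChar_mul_triForm_le (t := t) (by linarith)) (by linarith : 0 ≤ (a + b + c) / 3)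
  have h8 : a + b + c ≤ 0.2345 * D := by nlinarith
  have h9 := mul_le_mul_of_nonneg_right h8 (exp_pos (-t)).le
  have h10 := mul_pos hD0 (exp_pos (-t))
  linarith

theorem triForm_lattice (x y B s : ℝ) (p : ℤ × ℤ) :
    B * s * triForm 1 1 1 p + triForm (B * (1 / y - s)) (B * ((x ^ 2 + y ^ 2) / y - s))
      (B * (((1 - x) ^ 2 + y ^ 2) / y - s)) p =
      B * ((p.1 - p.2 * x) ^ 2 / y + (y ^ 2 / y) * p.2 ^ 2) := by
  unfold triForm
  ring

theorem mul_triForm_le_lattice {x y : ℝ} (hx : x ≤ 1 / 2) (hx0 : 0 ≤ x) (hy : 0.865 ≤ y)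
    (hy' : y ≤ 0.9608) (h1 : 1 ≤ x ^ 2 + y ^ 2) (p : ℤ × ℤ) :
    0.885 * triForm 1 1 1 p ≤ (p.1 - p.2 * x) ^ 2 / y + (y ^ 2 / y) * p.2 ^ 2 := by
  have hy0 : 0 < y := by linarith
  have hq : (2 - 1.7936 * y) ^ 2 + y ^ 2 ≤ 1 := by nlinarith
  have hX : 2 - 1.7936 * y ≤ x := by
    by_contra hlt
    push Not at hlt
    nlinarith
  have hn : 1 - x + x ^ 2 + y ^ 2 ≤ 1.7936 * y := by
    nlinarith [mul_nonneg (sub_nonneg.2 hX) (by linarith : 0 ≤ 1 - x - (2 - 1.7936 * y))]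
  rw [← mul_div_right_comm, ← add_div, le_div_iff₀ hy0]
  unfold triForm
  set m : ℝ := (p.1 : ℝ)
  set k : ℝ := (p.2 : ℝ)
  have ha : 0 < 1 - 0.885 * y := by linarith
  have hdisc : 0 ≤ 4 * (1 - 0.885 * y) * (x ^ 2 + y ^ 2 - 0.885 * y) - (2 * x - 0.885 * y) ^ 2 := by
    have := mul_nonneg hy0.le (sub_nonneg.2 hn)
    nlinarith
  have h4 : 0 ≤ 4 * (1 - 0.885 * y) * ((m - k * x) ^ 2 + y ^ 2 * k ^ 2 -
      0.885 * (1 * (m * (m - k)) + 1 * (k * (k - m)) + 1 * (m * k)) * y) := by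
    have := mul_nonneg hdisc (sq_nonneg k)
    have := sq_nonneg (2 * (1 - 0.885 * y) * m - (2 * x - 0.885 * y) * k)
    linarith
  have := nonneg_of_mul_nonneg_right h4 (by linarith)
  linarith

theorem tsum_holeChar_lattice_lt {B s x y : ℝ} (hB : 3.695 ≤ B) (hs : 1.1547 ≤ s)
    (hs' : s ≤ 1.1548) (hs2 : s ^ 2 = 4 / 3) (hx0 : 0 ≤ x) (hx : x ≤ 1 / 2) (hy : 0 < y)
    (hsy : 1 < s * y) (h1 : 1 ≤ x ^ 2 + y ^ 2) (hh : B * (s - 1 / y) ≤ 0.42) :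
    ∑' p : ℤ × ℤ, holeChar p * exp (-(B * ((p.1 - p.2 * x) ^ 2 / y + y * p.2 ^ 2))) <
      ∑' p, holeChar p * exp (-(B * s * triForm 1 1 1 p)) := by
  have hB0 : 0 < B := by linarith
  have hyl : 0.865 ≤ y := by nlinarith
  have hinv : s - 1 / y ≤ 0.1137 := by
    by_contra hlt
    push Not at hlt
    nlinarith
  have hyu : y ≤ 0.9608 := by
    have h : 1 / y * y = 1 := by field_simp
    nlinarith
  have hyy : y ^ 2 / y = y := by field_simp
  set w := s * y with hw
  have hw2 : w ^ 2 = 4 / 3 * y ^ 2 := by rw [hw, mul_pow, hs2]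
  have hw8 : w ≤ 8 / 7 := by nlinarith
  have hx1 : 3 - 2.5 * w ≤ x := by
    by_contra hlt
    push Not at hlt
    have : 0 ≤ (8 - 7 * w) * (w - 1) := mul_nonneg (by linarith) (by linarith)
    nlinarith
  have hn3 : (1 - x) ^ 2 + y ^ 2 - w ≤ 4 * (w - 1) := by
    have : 0 ≤ (8 - 7 * w) * (w - 1) := mul_nonneg (by linarith) (by linarith)
    have : 0 ≤ (x - (3 - 2.5 * w)) * (2 - x - (3 - 2.5 * w)) :=
      mul_nonneg (by linarith) (by linarith)
    nlinarith
  have hd1 : B * (1 / y - s) = -(B * ((w - 1) / y)) := by rw [hw]; field_simp; ring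
  have hd3 : B * (((1 - x) ^ 2 + y ^ 2) / y - s) ≤ 4 * (B * ((w - 1) / y)) := by
    have : B * (((1 - x) ^ 2 + y ^ 2) / y - s) = B * (((1 - x) ^ 2 + y ^ 2 - w) / y) := by
      rw [hw]; field_simp
    rw [this]
    calc B * (((1 - x) ^ 2 + y ^ 2 - w) / y) ≤ B * (4 * (w - 1) / y) := by gcongr
      _ = _ := by ring
  have hd23 : B * ((x ^ 2 + y ^ 2) / y - s) ≤ B * (((1 - x) ^ 2 + y ^ 2) / y - s) := by
    gcongr
    linarith
  have hpos : 0 < B * ((w - 1) / y) := mul_pos hB0 (div_pos (by linarith) hy)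
  have hN : ∀ n₁ n₂ n₃ : ℝ, (n₁ + n₂ + n₃) ^ 2 - 2 * (n₁ ^ 2 + n₂ ^ 2 + n₃ ^ 2) = 4 →
      0 < n₁ + n₂ + n₃ → 3 * s ≤ n₁ + n₂ + n₃ ∧
        s * ((n₁ - s) + (n₂ - s) + (n₃ - s)) ≤ (n₁ - s) ^ 2 + (n₂ - s) ^ 2 + (n₃ - s) ^ 2 := by
    intro n₁ n₂ n₃ hn hn0
    have h3 : (3 * s) ^ 2 ≤ (n₁ + n₂ + n₃) ^ 2 := by
      nlinarith [sq_nonneg (n₁ - n₂), sq_nonneg (n₂ - n₃), sq_nonneg (n₃ - n₁)]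
    refine ⟨(abs_le_of_sq_le_sq' h3 hn0.le).2, ?_⟩
    nlinarith [sq_nonneg (n₁ + n₂ + n₃ - 3 * s)]
  obtain ⟨hN1, hN2⟩ := hN (1 / y) ((x ^ 2 + y ^ 2) / y) (((1 - x) ^ 2 + y ^ 2) / y)
    (by field_simp; ring) (by positivity)
  have key := tsum_holeChar_lt (B := B) (s := s) (a := B * (1 / y - s))
    (b := B * ((x ^ 2 + y ^ 2) / y - s)) (c := B * (((1 - x) ^ 2 + y ^ 2) / y - s)) hB hs hs'
    (by linarith) (by linarith) (by linarith) (by linarith)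
    (fun p => by
      rw [triForm_lattice, mul_comm 0.885 B, mul_assoc]
      exact mul_le_mul_of_nonneg_left (mul_triForm_le_lattice hx hx0 hyl hyu h1 p) hB0.le)
    (by
      have := mul_nonneg hB0.le (sub_nonneg.2 hN1)
      linarith)
    (by
      have := mul_le_mul_of_nonneg_left hN2 (sq_nonneg B)
      linarith)
  simpa only [triForm_lattice, hyy] using key

theorem latticeTheta_hole_eq {x y α : ℝ} (hy : 0 < y) (hα : 0 < α) :
    latticeTheta x y (1 / 3, 1 / 3) α = 1 / α * ∑' p : ℤ × ℤ,
      holeChar p * exp (-(π / α * ((p.1 - p.2 * x) ^ 2 / y + y * p.2 ^ 2))) := by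
  rw [latticeTheta_eq_fourier _ hy _ hα]
  congr 1
  refine tsum_congr fun p => ?_
  rw [mul_comm (holeChar p), holeChar, ← cos_two_pi_mul_int_div_three]
  congr 2
  · ring
  · push_cast
    ring

theorem two_div_sqrt_three : 1.1547 ≤ 2 / √3 ∧ 2 / √3 ≤ 1.1548 ∧ (2 / √3) ^ 2 = 4 / 3 := by
  have h1 := sqrt_three_gt
  have h2 := sqrt_three_lt
  have h3 := sqrt_three_sq
  have h0 : 0 < √3 := by linarith
  refine ⟨?_, ?_, ?_⟩
  · rw [le_div_iff₀ h0]
    nlinarith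
  · rw [div_le_iff₀ h0]
    linarith
  · rw [div_pow, h3]
    norm_num

theorem iInf_latticeTheta_lt_of_near_hex {x y α : ℝ} (hα : 0 < α) (hα' : α ≤ 0.85)
    (hx0 : 0 ≤ x) (hx : x ≤ 1 / 2) (hy : √3 / 2 < y) (h1 : 1 ≤ x ^ 2 + y ^ 2)
    (h : exp (-π / (α * y)) < 1.52 * exp (-(π / α * (2 / √3)))) :
    ⨅ z, latticeTheta x y z α < latticeTheta (1 / 2) (√3 / 2) (1 / 3, 1 / 3) α := by
  have h3 := sqrt_three_gt
  have hy0 : 0 < y := by linarith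
  obtain ⟨hs, hs', hs2⟩ := two_div_sqrt_three
  refine (ciInf_le (bddBelow_range_latticeTheta x y α) (1 / 3, 1 / 3)).trans_lt ?_
  rw [latticeTheta_hex_eq_fourier hα, latticeTheta_hole_eq hy0 hα]
  refine mul_lt_mul_of_pos_left ?_ (by positivity)
  refine (tsum_holeChar_lattice_lt (B := π / α) ?_ hs hs' hs2 hx0 hx hy0 ?_ h1 ?_).trans_eq
    (tsum_congr fun p => ?_)
  · rw [le_div_iff₀ hα]
    have := pi_gt_d4
    linarith
  · rw [div_mul_eq_mul_div, one_lt_div (by linarith)]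
    linarith
  · have h4 : exp (-π / (α * y)) = exp (-(π / α * (2 / √3))) * exp (π / α * (2 / √3 - 1 / y)) := by
      rw [← exp_add]
      congr 1
      field_simp
      ring
    rw [h4, mul_comm] at h
    have h5 := lt_of_mul_lt_mul_right h (exp_pos _).le
    have h6 : (1.52 : ℝ) ≤ exp 0.42 := by
      refine le_trans ?_ (sum_le_exp_of_nonneg (by norm_num) 5)
      simp only [Finset.sum_range_succ, Finset.sum_range_zero, Nat.factorial]
      norm_num
    exact (exp_lt_exp.1 (h5.trans_le h6)).le
  · rw [mul_comm, holeChar]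
    unfold triForm
    ring_nf

theorem iInf_latticeTheta_hex {α : ℝ} (hα : 0 < α) :
    ⨅ z, latticeTheta (1 / 2) (√3 / 2) z α = latticeTheta (1 / 2) (√3 / 2) (1 / 3, 1 / 3) α := by
  refine le_antisymm (ciInf_le (bddBelow_range_latticeTheta _ _ α) _) (le_ciInf fun z => ?_)
  rw [latticeTheta_hex, latticeTheta_hex]
  exact hexSum_hole_le (by positivity) z

theorem iInf_latticeTheta_lt {x y α : ℝ} (hα : 0 < α) (hx0 : 0 ≤ x) (hx : x ≤ 1 / 2)
    (hy : √3 / 2 < y) (h1 : 1 ≤ x ^ 2 + y ^ 2) :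
    ⨅ z, latticeTheta x y z α < latticeTheta (1 / 2) (√3 / 2) (1 / 3, 1 / 3) α := by
  have h3 := sqrt_three_gt
  have hy0 : 0 < y := by linarith
  obtain h85 | h85 := le_total α 0.85
  · obtain h | h := le_or_gt (1.52 * exp (-(π / α * (2 / √3)))) (exp (-π / (α * y)))
    · exact iInf_latticeTheta_lt_of_small x hα h85 hy0 h
    · exact iInf_latticeTheta_lt_of_near_hex hα h85 hx0 hx hy h1 h
  obtain hy1 | hy1 := le_total 1.5397 y
  · exact iInf_latticeTheta_lt_of_long_large x h85 hy1
  by_cases h4 : 1.3 ≤ y ∧ α ≤ 4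
  · exact iInf_latticeTheta_lt_of_long_moderate x h85 h4.2 h4.1
  have hcase : y ≤ 1.3 ∨ 4 ≤ α ∧ y ≤ 1.54 := by
    by_cases hy2 : y ≤ 1.3
    · exact .inl hy2
    · refine .inr ⟨?_, by linarith⟩
      by_contra hα4
      exact h4 ⟨by linarith, by linarith⟩
  obtain ⟨hs, hs', hs2⟩ := two_div_sqrt_three
  have hsq := sqrt_three_sq
  have hyz : 1 / (8 * y ^ 2) ≤ 1 / 2 := by
    rw [div_le_iff₀ (by positivity)]
    nlinarith
  have hP := latticeTheta_half_circumcentre_lt_of_le (s := 2 / √3) hs hs' hs2 h85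
    (by
      have : 3 / 4 * (2 / √3) = √3 / 2 := by
        field_simp
        linarith
      rwa [this]) hcase
  have hskew := latticeTheta_skew_le (x := x) (z := 1 / 2 - 1 / (8 * y ^ 2)) hy0 hα
    (by
      have := pi_gt_d4
      have : 0.735 ≤ α * y := by nlinarith
      nlinarith) (by linarith) (by linarith [(by positivity : 0 ≤ 1 / (8 * y ^ 2))])
  refine (ciInf_le (bddBelow_range_latticeTheta x y α) _).trans_lt (hskew.trans_lt (hP.trans_eq ?_))
  rw [latticeTheta_hex]
  congr 1
  ring

end HoleStrict

/-- Main result: among unit-covolume lattices, the minimal value over shifts of the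
Gaussian lattice sum is maximized exactly by the hexagonal lattice `(1/2, √3/2)`. -/
theorem main_result (α : ℝ) (hα : 0 < α) (x y : ℝ) (hxy : (x, y) ∈ Dplus) :
    ((⨅ z : ℝ × ℝ, latticeTheta x y z α) ≤
      ⨅ z : ℝ × ℝ, latticeTheta (1 / 2) (Real.sqrt 3 / 2) z α) ∧
    ((⨅ z : ℝ × ℝ, latticeTheta x y z α) =
        (⨅ z : ℝ × ℝ, latticeTheta (1 / 2) (Real.sqrt 3 / 2) z α) ↔
      (x, y) = (1 / 2, Real.sqrt 3 / 2)) := by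
  obtain ⟨hx0, hx, hy0, h1⟩ := hxy
  simp only at hx0 hx hy0 h1
  by_cases hhex : (x, y) = (1 / 2, √3 / 2)
  · obtain ⟨rfl, rfl⟩ := Prod.mk.inj hhex
    simp
  have hy : √3 / 2 < y := by
    by_contra hlt
    push Not at hlt
    have hsq := sqrt_three_sq
    have hy2 : y ^ 2 ≤ (√3 / 2) ^ 2 := pow_le_pow_left₀ hy0.le hlt 2
    have hxe : x = 1 / 2 := by nlinarith
    subst hxe
    have h2 : (√3 / 2) ^ 2 ≤ y ^ 2 := by nlinarith
    have hye : √3 / 2 ≤ y := (abs_le_of_sq_le_sq' h2 hy0.le).2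
    exact hhex (by rw [le_antisymm hlt hye])
  have hlt := iInf_latticeTheta_lt hα hx0 hx hy h1
  rw [iInf_latticeTheta_hex hα]
  exact ⟨hlt.le, iff_of_false hlt.ne hhex⟩
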